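/- arXiv:1408.3908 — 5 statements merged into one kernel-verified Lean document; each statement's English description precedes it below -/
import Mathlib

section
/- Let T > 0, let λ : ℕ → [0,∞) be a sequence, let ω be a continuity modulus, and let c : [0,T] → ℝ satisfy μ₁ ≤ c(t) ≤ μ₂ (with 0 < μ₁ ≤ μ₂) and |c(a) − c(b)| ≤ ω(|a−b|) for all a,b ∈ [0,T]. Let σ ∈ [0,1/2] and δ > 0 satisfy 4δ²μ₁ > Λ_∞² + 2δΛ_∞, where Λ_∞ := limsup_{ε→0⁺} ω(ε)/ε^{1−2σ}. Let (u⁰,u¹) ∈ D(A^{1/2}) × H with additionally (u⁰,u¹) ∈ V_{ω_d} for some continuity modulus ω_d, and let u be a solution on [0,T] of the linear equation u'' + 2δ A^σ u' + c(t) A u = 0 with initial data (u⁰,u¹). Then there exists a constant K₂ > 0 depending only on δ, μ₁ and μ₂ with the following property: (u(t),u'(t)) ∈ V_{ω_d} for every t ∈ [0,T], the curves t ↦ ((ω_d(1/λ_k))^{−1/2} λ_k u_k(t))_{k : λ_k>0} and t ↦ ((ω_d(1/λ_k))^{−1/2} u_k'(t))_{k : λ_k>0} are continuous with values in ℓ²,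 and for every ν ≥ 1 such that 4δ²μ₁ ≥ [μ^{1−2σ} ω(1/μ)]² + 2δ[μ^{1−2σ} ω(1/μ)] for every μ ≥ ν, one has both ‖(u(t),u'(t))‖_{ω_d}² ≤ K₂ e^{ν(1+μ₂)t} ‖(u⁰,u¹)‖_{ω_d}² for every t ∈ [0,T], and Σ_{k : λ_k ≥ ν} (1/ω_d(1/λ_k)) (u_k'(t)² + λ_k² u_k(t)²) ≤ K₂ Σ_{k : λ_k ≥ ν} (1/ω_d(1/λ_k)) ((u¹_k)² + λ_k² (u⁰_k)²) for every t ∈ [0,T]. -/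
open Set Filter MeasureTheory Topology

noncomputable section

/-- A continuity modulus: continuous on `[0,∞)`, vanishing at `0`, positive for positive
arguments, nondecreasing, and such that `x ↦ x / ω x` is nondecreasing on `(0,∞)`. -/
def IsModulus (ω : ℝ → ℝ) : Prop :=
  ContinuousOn ω (Ici 0) ∧ ω 0 = 0 ∧ (∀ x : ℝ, 0 < x → 0 < ω x) ∧
  (∀ x y : ℝ, 0 ≤ x → x ≤ y → ω x ≤ ω y) ∧
  (∀ x y : ℝ, 0 < x → x ≤ y → x / ω x ≤ y / ω y)

/-- The curve `t ↦ (v t k)_k` takes values in `ℓ²` and is continuous on `I`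
with respect to the `ℓ²` norm. -/
def L2Cont (I : Set ℝ) (v : ℝ → ℕ → ℝ) : Prop :=
  (∀ t ∈ I, Summable fun k => (v t k) ^ 2) ∧
  ∀ t ∈ I, ∀ ε : ℝ, 0 < ε → ∃ η > (0:ℝ), ∀ s ∈ I, |s - t| < η →
    (∑' k, (v s k - v t k) ^ 2) < ε

/-- A solution on `[0,T]` of the linear equation `u'' + 2δ A^σ u' + c(t) A u = 0` with
initial data `(u0, u1)`, in the diagonal setting.  Each component `u k` is `C¹` with
derivative `v k`, and `v k` is absolutely continuous with the equation holding a.e.,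
which is encoded through the integral formulation; moreover the curves `t ↦ u(t)`,
`t ↦ A^{1/2}u(t)`, `t ↦ u'(t)` are continuous with values in `ℓ²`. -/
def IsLinearSol (lam : ℕ → ℝ) (c : ℝ → ℝ) (σ δ : ℝ) (T : ℝ)
    (u0 u1 : ℕ → ℝ) (u v : ℕ → ℝ → ℝ) : Prop :=
  (∀ k, u k 0 = u0 k) ∧
  (∀ k, v k 0 = u1 k) ∧
  (∀ k, ∀ t ∈ Icc (0:ℝ) T, HasDerivWithinAt (u k) (v k t) (Icc 0 T) t) ∧
  (∀ k, ∀ t ∈ Icc (0:ℝ) T, v k t = u1 k - ∫ s in (0:ℝ)..t,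
      (2 * δ * lam k ^ (2 * σ) * v k s + c s * lam k ^ 2 * u k s)) ∧
  L2Cont (Icc 0 T) (fun t k => u k t) ∧
  L2Cont (Icc 0 T) (fun t k => lam k * u k t) ∧
  L2Cont (Icc 0 T) (fun t k => v k t)

/-- The `k`-th summand of the squared seminorm `‖(u0,u1)‖_{ωd}²` of the interpolation
space `V_{ωd}`: it equals `((u1 k)² + (lam k)² (u0 k)²) / ωd (1 / lam k)` when
`lam k > 0`, and `0` otherwise. -/
def Vsum (lam : ℕ → ℝ) (ωd : ℝ → ℝ) (u0 u1 : ℕ → ℝ) (k : ℕ) : ℝ :=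
  if 0 < lam k then (u1 k ^ 2 + lam k ^ 2 * u0 k ^ 2) / ωd (1 / lam k) else 0

/-- Membership in the interpolation space `V_{ωd}` (inside `D(A^{1/2}) × H`). -/
def MemV (lam : ℕ → ℝ) (ωd : ℝ → ℝ) (u0 u1 : ℕ → ℝ) : Prop :=
  (Summable fun k => u0 k ^ 2) ∧ (Summable fun k => lam k ^ 2 * u0 k ^ 2) ∧
  (Summable fun k => u1 k ^ 2) ∧ Summable (Vsum lam ωd u0 u1)

/-- The forward average `D t = l ∫_t^{t+1/l} C` of a function oscillating by at most `w` at
scale `1/l`. -/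
theorem exists_forward_average {C : ℝ → ℝ} (hC : Continuous C) {m M l w : ℝ} (hl : 0 < l)
    (hm : ∀ t, m ≤ C t) (hM : ∀ t, C t ≤ M)
    (hw : ∀ a b, |a - b| ≤ 1 / l → |C a - C b| ≤ w) :
    ∃ D D' : ℝ → ℝ, (∀ t, HasDerivAt D (D' t) t) ∧ (∀ t, |D' t| ≤ l * w) ∧
      (∀ t, m ≤ D t ∧ D t ≤ M) ∧ ∀ t, |D t - C t| ≤ w := by
  have hl' : 0 < 1 / l := by positivity
  have key : ∀ t p q : ℝ, (∀ s ∈ Icc t (t + 1 / l), p ≤ C s ∧ C s ≤ q) →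
      p ≤ l * ∫ s in t..(t + 1 / l), C s ∧ l * ∫ s in t..(t + 1 / l), C s ≤ q := by
    intro t p q h
    have hle : t ≤ t + 1 / l := by linarith
    have h1 := intervalIntegral.integral_mono_on (μ := volume) hle
      ((continuous_const (y := p)).intervalIntegrable _ _) (hC.intervalIntegrable t (t + 1 / l))
      (fun s hs => (h s hs).1)
    have h2 := intervalIntegral.integral_mono_on (μ := volume) hle
      (hC.intervalIntegrable t (t + 1 / l))
      ((continuous_const (y := q)).intervalIntegrable _ _)
      (fun s hs => (h s hs).2)
    simp only [intervalIntegral.integral_const, add_sub_cancel_left, smul_eq_mul] at h1 h2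
    have e : ∀ x : ℝ, x = l * (1 / l * x) := fun x => by field_simp
    exact ⟨(e p).le.trans (mul_le_mul_of_nonneg_left h1 hl.le),
      (mul_le_mul_of_nonneg_left h2 hl.le).trans (e q).ge⟩
  refine ⟨fun t => l * ∫ s in t..(t + 1 / l), C s, fun t => l * (C (t + 1 / l) - C t),
    fun t => ?_, fun t => ?_, fun t => key t m M fun s _ => ⟨hm s, hM s⟩, fun t => ?_⟩
  · have hF : ∀ x, HasDerivAt (fun x => ∫ s in (0 : ℝ)..x, C s) (C x) x := fun x =>
      (hC.integral_hasStrictDerivAt 0 x).hasDerivAt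
    have h1 : HasDerivAt (fun x => ∫ s in (0 : ℝ)..(x + 1 / l), C s) (C (t + 1 / l)) t := by
      simpa using (hF (t + 1 / l)).comp_add_const t (1 / l)
    refine ((h1.sub (hF t)).const_mul l).congr_of_eventuallyEq (Eventually.of_forall fun x => ?_)
    simp only [Pi.sub_apply]
    rw [intervalIntegral.integral_interval_sub_left (hC.intervalIntegrable _ _)
      (hC.intervalIntegrable _ _)]
  · rw [abs_mul, abs_of_pos hl]
    exact mul_le_mul_of_nonneg_left
      (hw _ _ (by rw [add_sub_cancel_left, abs_of_pos hl'])) hl.le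
  · obtain ⟨h1, h2⟩ := key t (C t - w) (C t + w) fun s hs => by
      have h := abs_le.1 (hw s t (by rw [abs_le]; constructor <;> linarith [hs.1, hs.2]))
      constructor <;> linarith [h.1, h.2]
    rw [abs_le]
    constructor <;> linarith

/-- Uniform energy bound for one mode when dissipation dominates. -/
theorem mode_bound_of_dissipative {T δ μ₁ μ₂ l r w : ℝ} (hδ : 0 < δ)
    (hμ₁ : 0 < μ₁) (hl : 0 < l) (hr : 0 < r) (hrl : r ≤ l)
    {C : ℝ → ℝ} (hC : Continuous C) (hm : ∀ t, μ₁ ≤ C t) (hM : ∀ t, C t ≤ μ₂)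
    (hw : ∀ a b, |a - b| ≤ 1 / l → |C a - C b| ≤ w)
    (hsub : (l * w) ^ 2 + 2 * δ * r * (l * w) ≤ 4 * δ ^ 2 * μ₁ * r ^ 2)
    {u v : ℝ → ℝ} (hu : ∀ t ∈ Icc 0 T, HasDerivWithinAt u (v t) (Icc 0 T) t)
    (hv : ∀ t ∈ Icc 0 T,
      HasDerivWithinAt v (-(2 * δ * r * v t + C t * l ^ 2 * u t)) (Icc 0 T) t)
    {t : ℝ} (ht : t ∈ Icc 0 T) :
    v t ^ 2 + l ^ 2 * u t ^ 2 ≤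
      (2 + 1 / μ₁) * (2 + 3 * δ ^ 2 + μ₂) * (v 0 ^ 2 + l ^ 2 * u 0 ^ 2) := by
  obtain ⟨D, D', hD, hD', hDm, hDC⟩ := exists_forward_average hC hl hm hM hw
  have hw0 : 0 ≤ w := (abs_nonneg _).trans (hw 0 0 (by simp; positivity))
  set E : ℝ → ℝ := fun s =>
    (v s + δ * r * u s) ^ 2 + (δ * r) ^ 2 * u s ^ 2 + l ^ 2 * D s * u s ^ 2 with hE
  set E' : ℝ → ℝ := fun s => -2 * (δ * r) * v s ^ 2 - 2 * (δ * r) * l ^ 2 * C s * u s ^ 2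
    - 2 * l ^ 2 * (C s - D s) * u s * v s + l ^ 2 * D' s * u s ^ 2 with hE'
  have hder : ∀ s ∈ Icc 0 T, HasDerivWithinAt E (E' s) (Icc 0 T) s := by
    intro s hs
    have h1 := (((hv s hs).add ((hu s hs).const_mul (δ * r))).pow 2).add
      (((hu s hs).pow 2).const_mul ((δ * r) ^ 2))
    have h2 := ((hD s).hasDerivWithinAt (s := Icc 0 T)).const_mul (l ^ 2) |>.mul
      ((hu s hs).pow 2)
    refine (h1.add h2).congr_deriv ?_
    simp only [hE', Pi.add_apply, Pi.pow_apply]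
    push_cast
    ring
  have hneg : ∀ s, E' s ≤ 0 := by
    intro s
    have h1 : -(2 * l ^ 2 * (C s - D s) * u s * v s) ≤ 2 * l * w * (l * |u s|) * |v s| := by
      have : |2 * l ^ 2 * (C s - D s) * u s * v s| =
          2 * l * |D s - C s| * (l * |u s|) * |v s| := by
        rw [abs_mul, abs_mul, abs_mul, abs_sub_comm (D s),
          abs_of_pos (by positivity : 0 < 2 * l ^ 2)]
        ring
      refine (neg_le_abs _).trans ?_
      rw [this]
      gcongr
      exact hDC s
    have h2 : l ^ 2 * D' s * u s ^ 2 ≤ l * w * (l * |u s|) ^ 2 := by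
      rw [mul_pow, sq_abs]
      have : D' s ≤ l * w := (le_abs_self _).trans (hD' s)
      nlinarith [mul_le_mul_of_nonneg_left this (by positivity : 0 ≤ l ^ 2 * u s ^ 2)]
    have h3 : 2 * (δ * r) * μ₁ * (l * |u s|) ^ 2 ≤ 2 * (δ * r) * l ^ 2 * C s * u s ^ 2 := by
      rw [mul_pow, sq_abs]
      nlinarith [mul_le_mul_of_nonneg_left (hm s)
        (by positivity : 0 ≤ 2 * (δ * r) * (l ^ 2 * u s ^ 2))]
    have h4 : v s ^ 2 = |v s| ^ 2 := (sq_abs _).symm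
    simp only [hE']
    rw [h4]
    set p := l * |u s|
    set q := |v s|
    have hq : 0 ≤ 2 * (δ * r) * q ^ 2 - 2 * (l * w) * p * q
        + (2 * (δ * r) * μ₁ - l * w) * p ^ 2 := by
      have hdr : 0 < 2 * (δ * r) := by positivity
      refine nonneg_of_mul_nonneg_right (a := 2 * (δ * r)) ?_ hdr
      nlinarith [sq_nonneg (2 * (δ * r) * q - l * w * p),
        mul_le_mul_of_nonneg_right hsub (sq_nonneg p)]
    linarith
  have hanti : AntitoneOn E (Icc 0 T) := by
    refine antitoneOn_of_hasDerivWithinAt_nonpos (convex_Icc 0 T)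
      (fun s hs => (hder s hs).continuousWithinAt)
      (fun s hs => (hder s (interior_subset hs)).mono interior_subset) fun s _ => hneg s
  have hE0 : E t ≤ E 0 := hanti ⟨le_rfl, ht.1.trans ht.2⟩ ht ht.1
  have hμ₂ : 0 < μ₂ := hμ₁.trans_le ((hm 0).trans (hM 0))
  have hlow : v t ^ 2 + l ^ 2 * u t ^ 2 ≤ (2 + 1 / μ₁) * E t := by
    have h1 : v t ^ 2 ≤ 2 * ((v t + δ * r * u t) ^ 2 + (δ * r) ^ 2 * u t ^ 2) := by
      nlinarith [sq_nonneg (v t + 2 * (δ * r * u t))]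
    have h2 : l ^ 2 * μ₁ * u t ^ 2 ≤ l ^ 2 * D t * u t ^ 2 := by
      gcongr; exact (hDm t).1
    have h3 : 0 ≤ l ^ 2 * μ₁ * u t ^ 2 := by positivity
    have h4 : l ^ 2 * u t ^ 2 ≤ 1 / μ₁ * E t := by
      rw [one_div, ← div_eq_inv_mul, le_div_iff₀ hμ₁]
      simp only [hE]
      nlinarith [sq_nonneg (v t + δ * r * u t), sq_nonneg (δ * r * u t)]
    rw [add_mul]
    simp only [hE] at h4 ⊢
    linarith
  have hup : E 0 ≤ (2 + 3 * δ ^ 2 + μ₂) * (v 0 ^ 2 + l ^ 2 * u 0 ^ 2) := by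
    have h1 : (δ * r) ^ 2 * u 0 ^ 2 ≤ δ ^ 2 * (l ^ 2 * u 0 ^ 2) := by
      calc (δ * r) ^ 2 * u 0 ^ 2 ≤ (δ * l) ^ 2 * u 0 ^ 2 := by gcongr
        _ = _ := by ring
    have h2 : l ^ 2 * D 0 * u 0 ^ 2 ≤ l ^ 2 * μ₂ * u 0 ^ 2 := by
      gcongr; exact (hDm 0).2
    have h3 : 0 ≤ (3 * δ ^ 2 + μ₂) * v 0 ^ 2 := by positivity
    have h4 : 0 ≤ l ^ 2 * u 0 ^ 2 := by positivity
    simp only [hE]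
    nlinarith [sq_nonneg (v 0 - δ * r * u 0)]
  calc _ ≤ (2 + 1 / μ₁) * E t := hlow
    _ ≤ (2 + 1 / μ₁) * ((2 + 3 * δ ^ 2 + μ₂) * (v 0 ^ 2 + l ^ 2 * u 0 ^ 2)) := by
      gcongr; exact hE0.trans hup
    _ = _ := by ring

/-- Exponential energy bound for one mode, at a rate proportional to the frequency. -/
theorem mode_bound_exp {T μ₂ l a : ℝ} (hl : 0 ≤ l) (ha : 0 ≤ a)
    {C : ℝ → ℝ} (h0 : ∀ t, 0 ≤ C t) (hM : ∀ t, C t ≤ μ₂)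
    {u v : ℝ → ℝ} (hu : ∀ t ∈ Icc 0 T, HasDerivWithinAt u (v t) (Icc 0 T) t)
    (hv : ∀ t ∈ Icc 0 T, HasDerivWithinAt v (-(a * v t + C t * l ^ 2 * u t)) (Icc 0 T) t)
    {t : ℝ} (ht : t ∈ Icc 0 T) :
    v t ^ 2 + l ^ 2 * u t ^ 2 ≤
      Real.exp (l * (1 + μ₂) * t) * (v 0 ^ 2 + l ^ 2 * u 0 ^ 2) := by
  set K := l * (1 + μ₂) with hK
  set F : ℝ → ℝ := fun s => Real.exp (-K * s) * (v s ^ 2 + l ^ 2 * u s ^ 2) with hF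
  set F' : ℝ → ℝ := fun s => Real.exp (-K * s) * (-K * (v s ^ 2 + l ^ 2 * u s ^ 2)
    - 2 * a * v s ^ 2 + 2 * l ^ 2 * (1 - C s) * u s * v s) with hF'
  have hder : ∀ s ∈ Icc 0 T, HasDerivWithinAt F (F' s) (Icc 0 T) s := by
    intro s hs
    have h1 : HasDerivAt (fun s => Real.exp (-K * s)) (Real.exp (-K * s) * -K) s := by
      simpa using ((hasDerivAt_id s).const_mul (-K)).exp
    refine (h1.hasDerivWithinAt.mul
      (((hv s hs).pow 2).add (((hu s hs).pow 2).const_mul (l ^ 2)))).congr_deriv ?_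
    simp only [hF', Pi.add_apply, Pi.pow_apply]
    push_cast
    ring
  have hneg : ∀ s, F' s ≤ 0 := by
    intro s
    refine mul_nonpos_of_nonneg_of_nonpos (Real.exp_pos _).le ?_
    have h1 : 2 * l ^ 2 * (1 - C s) * u s * v s ≤ K * (v s ^ 2 + l ^ 2 * u s ^ 2) := by
      have hc : |1 - C s| ≤ 1 + μ₂ := by
        rw [abs_le]; constructor <;> linarith [h0 s, hM s]
      calc 2 * l ^ 2 * (1 - C s) * u s * v s = l * ((1 - C s) * (2 * (l * u s) * v s)) := by ring
        _ ≤ l * (|1 - C s| * (v s ^ 2 + l ^ 2 * u s ^ 2)) := by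
          refine mul_le_mul_of_nonneg_left ((le_abs_self _).trans ?_) hl
          rw [abs_mul]
          gcongr
          rw [abs_le]
          constructor <;> nlinarith [sq_nonneg (l * u s + v s), sq_nonneg (l * u s - v s)]
        _ ≤ l * ((1 + μ₂) * (v s ^ 2 + l ^ 2 * u s ^ 2)) := by gcongr
        _ = _ := by rw [hK]; ring
    nlinarith [mul_nonneg ha (sq_nonneg (v s))]
  have hanti : AntitoneOn F (Icc 0 T) := by
    refine antitoneOn_of_hasDerivWithinAt_nonpos (convex_Icc 0 T)
      (fun s hs => (hder s hs).continuousWithinAt)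
      (fun s hs => (hder s (interior_subset hs)).mono interior_subset) fun s _ => hneg s
  have h := hanti ⟨le_rfl, ht.1.trans ht.2⟩ ht ht.1
  simp only [hF, mul_zero, Real.exp_zero, one_mul] at h
  calc _ = Real.exp (K * t) * (Real.exp (-K * t) * (v t ^ 2 + l ^ 2 * u t ^ 2)) := by
        rw [← mul_assoc, ← Real.exp_add]; simp
    _ ≤ _ := by gcongr

/-- Components of an `ℓ²`-continuous curve are continuous. -/
theorem L2Cont.continuousOn_apply {I : Set ℝ} {v : ℝ → ℕ → ℝ} (h : L2Cont I v) (k : ℕ) :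
    ContinuousOn (fun t => v t k) I := by
  rw [Metric.continuousOn_iff]
  intro t ht ε hε
  obtain ⟨η, hη, H⟩ := h.2 t ht (ε ^ 2) (by positivity)
  refine ⟨η, hη, fun s hs hst => ?_⟩
  have hsum : Summable fun k => (v s k - v t k) ^ 2 :=
    Summable.of_nonneg_of_le (fun _ => sq_nonneg _)
      (fun k => by nlinarith [sq_nonneg (v s k + v t k)])
      (((h.1 s hs).add (h.1 t ht)).mul_left 2)
  have h1 : (v s k - v t k) ^ 2 < ε ^ 2 :=
    (hsum.le_tsum k fun _ _ => sq_nonneg _).trans_lt (H s hs (by rwa [Real.dist_eq] at hst))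
  rw [Real.dist_eq]
  exact abs_lt_of_sq_lt_sq h1 hε.le

/-- Componentwise continuous curves whose squares are dominated by a summable sequence
are `ℓ²`-continuous. -/
theorem L2Cont.of_dominated {I : Set ℝ} {v : ℝ → ℕ → ℝ} {M : ℕ → ℝ} (hM : Summable M)
    (hv : ∀ t ∈ I, ∀ k, v t k ^ 2 ≤ M k) (hc : ∀ k, ContinuousOn (fun t => v t k) I) :
    L2Cont I v := by
  refine ⟨fun t ht => hM.of_nonneg_of_le (fun _ => sq_nonneg _) (hv t ht), fun t ht ε hε => ?_⟩
  have h := tendsto_tsum_of_dominated_convergence (𝓕 := 𝓝[I] t)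
    (f := fun s k => (v s k - v t k) ^ 2) (g := fun _ => 0) (bound := fun k => 4 * M k)
    (hM.mul_left 4) (fun k => by simpa using (((hc k) t ht).sub_const (v t k)).pow 2)
    (by
      filter_upwards [self_mem_nhdsWithin] with s hs k
      rw [Real.norm_eq_abs, abs_of_nonneg (sq_nonneg _)]
      nlinarith [sq_nonneg (v s k + v t k), hv s hs k, hv t ht k])
  rw [tsum_zero] at h
  obtain ⟨η, hη, H⟩ := Metric.mem_nhdsWithin_iff.1 (h.eventually (gt_mem_nhds hε))
  exact ⟨η, hη, fun s hs hst => H ⟨by rwa [Metric.mem_ball, Real.dist_eq], hs⟩⟩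

/-- A solution of the integral equation with continuous integrand is differentiable. -/
theorem hasDerivWithinAt_of_eq_sub_integral {T a : ℝ} (hT : 0 ≤ T) {v f : ℝ → ℝ}
    (hf : ContinuousOn f (Icc 0 T)) (hv : ∀ t ∈ Icc 0 T, v t = a - ∫ s in (0 : ℝ)..t, f s)
    {t : ℝ} (ht : t ∈ Icc 0 T) : HasDerivWithinAt v (-(f t)) (Icc 0 T) t := by
  have hg : Continuous (IccExtend hT ((Icc 0 T).domRestrict f)) :=
    (continuousOn_iff_continuous_domRestrict.1 hf).Icc_extend'
  have hgf : ∀ s ∈ Icc 0 T, IccExtend hT ((Icc 0 T).domRestrict f) s = f s := fun s hs => by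
    rw [IccExtend_of_mem hT _ hs]; rfl
  have h := ((hg.integral_hasStrictDerivAt 0 t).hasDerivAt.const_sub a).hasDerivWithinAt
    (s := Icc 0 T)
  rw [hgf t ht] at h
  refine h.congr_of_mem (fun x hx => ?_) ht
  rw [hv x hx]
  congr 1
  refine intervalIntegral.integral_congr fun s hs => (hgf s ?_).symm
  rw [uIcc_of_le hx.1] at hs
  exact ⟨hs.1, hs.2.trans hx.2⟩

/-- The subcriticality condition at the origin gives a threshold frequency. -/
theorem exists_subcritical_threshold {δ μ₁ σ Λ : ℝ} (hδ : 0 < δ) {ω : ℝ → ℝ}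
    (hω : IsModulus ω) (hev : ∀ᶠ x in 𝓝[>] (0 : ℝ), ω x / x ^ (1 - 2 * σ) ≤ Λ)
    (hΛ : Λ ^ 2 + 2 * δ * Λ < 4 * δ ^ 2 * μ₁) :
    ∃ ν : ℝ, 1 ≤ ν ∧ ∀ μ : ℝ, ν ≤ μ →
      (μ ^ (1 - 2 * σ) * ω (1 / μ)) ^ 2 + 2 * δ * (μ ^ (1 - 2 * σ) * ω (1 / μ)) ≤
        4 * δ ^ 2 * μ₁ := by
  obtain ⟨ν, hν⟩ := eventually_atTop.1 (tendsto_inv_atTop_nhdsGT_zero.eventually hev)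
  refine ⟨max ν 1, le_max_right _ _, fun μ hμ => ?_⟩
  have hμ0 : 0 < μ := zero_lt_one.trans_le ((le_max_right _ _).trans hμ)
  have h := hν μ ((le_max_left _ _).trans hμ)
  have e : ω μ⁻¹ / μ⁻¹ ^ (1 - 2 * σ) = μ ^ (1 - 2 * σ) * ω (1 / μ) := by
    rw [Real.inv_rpow hμ0.le, div_inv_eq_mul, one_div, mul_comm]
  rw [e] at h
  have h0 : 0 ≤ μ ^ (1 - 2 * σ) * ω (1 / μ) :=
    mul_nonneg (by positivity) (hω.2.2.1 _ (by positivity)).le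
  refine le_trans ?_ hΛ.le
  gcongr

/-- A function with modulus of continuity `ω` is continuous. -/
theorem IsModulus.continuousOn_of_abs_sub_le {ω c : ℝ → ℝ} (hω : IsModulus ω) {I : Set ℝ}
    (hc : ∀ a ∈ I, ∀ b ∈ I, |c a - c b| ≤ ω |a - b|) : ContinuousOn c I := by
  intro t ht
  have h0 : Tendsto (fun s => ω |s - t|) (𝓝[I] t) (𝓝 0) := by
    have h1 : Tendsto (fun s => |s - t|) (𝓝[I] t) (𝓝[Ici 0] 0) := by
      refine tendsto_nhdsWithin_iff.2 ⟨?_, Eventually.of_forall fun s => mem_Ici.2 (abs_nonneg _)⟩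
      have : Continuous fun s : ℝ => |s - t| := by fun_prop
      simpa using (this.tendsto t).mono_left nhdsWithin_le_nhds
    have h2 := hω.1 0 self_mem_Ici
    rw [ContinuousWithinAt, hω.2.1] at h2
    exact h2.comp h1
  rw [ContinuousWithinAt, tendsto_iff_dist_tendsto_zero]
  refine squeeze_zero' (Eventually.of_forall fun _ => dist_nonneg) ?_ h0
  filter_upwards [self_mem_nhdsWithin] with s hs
  exact hc s hs t ht

/-- Subcritical case: propagation of regularity in the interpolation spaces `V_{ωd}`,
together with a time-independent estimate for the high-frequency components.
The constant `K₂` depends only on `δ`, `μ₁`, `μ₂`. -/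
theorem interpolation_regularity_subcritical (δ μ₁ μ₂ : ℝ)
    (hδ : 0 < δ) (hμ₁ : 0 < μ₁) (hμ : μ₁ ≤ μ₂) :
    ∃ K₂ > (0:ℝ),
      ∀ T : ℝ, 0 < T → ∀ lam : ℕ → ℝ, (∀ k, 0 ≤ lam k) →
      ∀ ω : ℝ → ℝ, IsModulus ω →
      ∀ c : ℝ → ℝ, (∀ t ∈ Icc (0:ℝ) T, μ₁ ≤ c t ∧ c t ≤ μ₂) →
        (∀ a ∈ Icc (0:ℝ) T, ∀ b ∈ Icc (0:ℝ) T, |c a - c b| ≤ ω |a - b|) →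
      ∀ σ : ℝ, 0 ≤ σ → σ ≤ 1 / 2 →
      (∃ Λ : ℝ, 0 ≤ Λ ∧ (∀ᶠ x in 𝓝[>] (0:ℝ), ω x / x ^ (1 - 2 * σ) ≤ Λ) ∧
        Λ ^ 2 + 2 * δ * Λ < 4 * δ ^ 2 * μ₁) →
      ∀ ωd : ℝ → ℝ, IsModulus ωd →
      ∀ u0 u1 : ℕ → ℝ, MemV lam ωd u0 u1 →
      ∀ u v : ℕ → ℝ → ℝ, IsLinearSol lam c σ δ T u0 u1 u v →
        (∀ t ∈ Icc (0:ℝ) T,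
          Summable (Vsum lam ωd (fun k => u k t) (fun k => v k t))) ∧
        L2Cont (Icc 0 T) (fun t k =>
          if 0 < lam k then lam k * u k t / Real.sqrt (ωd (1 / lam k)) else 0) ∧
        L2Cont (Icc 0 T) (fun t k =>
          if 0 < lam k then v k t / Real.sqrt (ωd (1 / lam k)) else 0) ∧
        ∀ ν : ℝ, 1 ≤ ν →
          (∀ μ : ℝ, ν ≤ μ →
            (μ ^ (1 - 2 * σ) * ω (1 / μ)) ^ 2 +
              2 * δ * (μ ^ (1 - 2 * σ) * ω (1 / μ)) ≤ 4 * δ ^ 2 * μ₁) →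
          ∀ t ∈ Icc (0:ℝ) T,
            ((∑' k, Vsum lam ωd (fun j => u j t) (fun j => v j t) k) ≤
              K₂ * Real.exp (ν * (1 + μ₂) * t) * ∑' k, Vsum lam ωd u0 u1 k) ∧
            ((∑' k, if ν ≤ lam k then
                (v k t ^ 2 + lam k ^ 2 * u k t ^ 2) / ωd (1 / lam k) else 0) ≤
              K₂ * ∑' k, if ν ≤ lam k then
                (u1 k ^ 2 + lam k ^ 2 * u0 k ^ 2) / ωd (1 / lam k) else 0) := by
  have hμ₂ : 0 < μ₂ := hμ₁.trans_le hμ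
  set K : ℝ := (2 + 1 / μ₁) * (2 + 3 * δ ^ 2 + μ₂) with hK
  have hK1 : 1 ≤ K := by
    have h1 : 0 < 1 / μ₁ := by positivity
    nlinarith [sq_nonneg δ, mul_pos h1 hμ₂, mul_nonneg h1.le (sq_nonneg δ)]
  have hK0 : 0 < K := by linarith
  refine ⟨K, hK0, ?_⟩
  intro T hT lam hlam ω hω c hcb hc σ hσ0 hσ1 ⟨Λ, _, hev, hΛ⟩ ωd hωd u0 u1 hV u v
    ⟨hu0, hv0, hu, hv, _, _, hvc⟩
  have hcc : ContinuousOn c (Icc 0 T) := hω.continuousOn_of_abs_sub_le hc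
  set C : ℝ → ℝ := IccExtend hT.le ((Icc 0 T).domRestrict c) with hC
  have hCc : Continuous C := (continuousOn_iff_continuous_domRestrict.1 hcc).Icc_extend'
  have hCe : ∀ s ∈ Icc 0 T, C s = c s := fun s hs => by
    rw [hC, IccExtend_of_mem hT.le _ hs]; rfl
  have hCb : ∀ s, μ₁ ≤ C s ∧ C s ≤ μ₂ := fun s => hcb _ (projIcc 0 T hT.le s).2
  have hCω : ∀ a b x, |a - b| ≤ x → |C a - C b| ≤ ω x := fun a b x hx =>
    (hc _ (projIcc 0 T hT.le a).2 _ (projIcc 0 T hT.le b).2).trans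
      (hω.2.2.2.1 _ _ (abs_nonneg _) ((abs_projIcc_sub_projIcc hT.le).trans hx))
  have hucont : ∀ k, ContinuousOn (u k) (Icc 0 T) := fun k s hs =>
    (hu k s hs).continuousWithinAt
  have hvcont : ∀ k, ContinuousOn (v k) (Icc 0 T) := hvc.continuousOn_apply
  have hvder : ∀ k, ∀ t ∈ Icc 0 T, HasDerivWithinAt (v k)
      (-(2 * δ * lam k ^ (2 * σ) * v k t + C t * lam k ^ 2 * u k t)) (Icc 0 T) t := by
    intro k t ht
    rw [hCe t ht]
    refine hasDerivWithinAt_of_eq_sub_integral hT.le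
      (f := fun s => 2 * δ * lam k ^ (2 * σ) * v k s + c s * lam k ^ 2 * u k s) ?_ (hv k) ht
    exact (continuousOn_const.mul (hvcont k)).add
      ((hcc.mul continuousOn_const).mul (hucont k))
  have hhigh : ∀ ν : ℝ, 1 ≤ ν → (∀ μ : ℝ, ν ≤ μ →
      (μ ^ (1 - 2 * σ) * ω (1 / μ)) ^ 2 + 2 * δ * (μ ^ (1 - 2 * σ) * ω (1 / μ)) ≤
        4 * δ ^ 2 * μ₁) → ∀ t ∈ Icc 0 T, ∀ k, ν ≤ lam k →
      v k t ^ 2 + lam k ^ 2 * u k t ^ 2 ≤ K * (u1 k ^ 2 + lam k ^ 2 * u0 k ^ 2) := by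
    intro ν hν hsub t ht k hk
    have hl1 : 1 ≤ lam k := hν.trans hk
    have hl : 0 < lam k := zero_lt_one.trans_le hl1
    have hr : 0 < lam k ^ (2 * σ) := Real.rpow_pos_of_pos hl _
    rw [← hu0 k, ← hv0 k]
    refine mode_bound_of_dissipative (w := ω (1 / lam k)) hδ hμ₁ hl hr ?_ hCc (fun s => (hCb s).1)
      (fun s => (hCb s).2) (fun a b h => hCω a b _ h) ?_ (hu k) (hvder k) ht
    · simpa using Real.rpow_le_rpow_of_exponent_le hl1 (by linarith : 2 * σ ≤ 1)
    · have h := hsub _ hk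
      rw [Real.rpow_sub hl, Real.rpow_one] at h
      have h2 := mul_le_mul_of_nonneg_right h (sq_nonneg (lam k ^ (2 * σ)))
      refine le_trans (le_of_eq ?_) h2
      field_simp
  have hmode : ∀ ν : ℝ, 1 ≤ ν → (∀ μ : ℝ, ν ≤ μ →
      (μ ^ (1 - 2 * σ) * ω (1 / μ)) ^ 2 + 2 * δ * (μ ^ (1 - 2 * σ) * ω (1 / μ)) ≤
        4 * δ ^ 2 * μ₁) → ∀ t ∈ Icc 0 T, ∀ k,
      v k t ^ 2 + lam k ^ 2 * u k t ^ 2 ≤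
        K * Real.exp (ν * (1 + μ₂) * t) * (u1 k ^ 2 + lam k ^ 2 * u0 k ^ 2) := by
    intro ν hν hsub t ht k
    have hF : 0 ≤ u1 k ^ 2 + lam k ^ 2 * u0 k ^ 2 := by positivity
    have ht0 : 0 ≤ t := ht.1
    rcases le_total ν (lam k) with hk | hk
    · refine (hhigh ν hν hsub t ht k hk).trans ?_
      gcongr
      exact le_mul_of_one_le_right hK0.le (Real.one_le_exp (by positivity))
    · have h := mode_bound_exp (μ₂ := μ₂) (hlam k)
        (mul_nonneg (mul_nonneg zero_le_two hδ.le) (Real.rpow_nonneg (hlam k) (2 * σ)))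
        (fun s => hμ₁.le.trans (hCb s).1) (fun s => (hCb s).2) (hu k) (hvder k) ht
      rw [hu0 k, hv0 k] at h
      refine h.trans ?_
      gcongr
      calc Real.exp (lam k * (1 + μ₂) * t) ≤ Real.exp (ν * (1 + μ₂) * t) := by gcongr
        _ ≤ _ := le_mul_of_one_le_left (Real.exp_pos _).le hK1
  have hωk : ∀ k, 0 < lam k → 0 < ωd (1 / lam k) := fun k hk => hωd.2.2.1 _ (by positivity)
  have hVmode : ∀ ν : ℝ, 1 ≤ ν → (∀ μ : ℝ, ν ≤ μ →
      (μ ^ (1 - 2 * σ) * ω (1 / μ)) ^ 2 + 2 * δ * (μ ^ (1 - 2 * σ) * ω (1 / μ)) ≤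
        4 * δ ^ 2 * μ₁) → ∀ t ∈ Icc 0 T, ∀ k,
      Vsum lam ωd (fun j => u j t) (fun j => v j t) k ≤
        K * Real.exp (ν * (1 + μ₂) * t) * Vsum lam ωd u0 u1 k := by
    intro ν hν hsub t ht k
    unfold Vsum
    split_ifs with hk
    · rw [← mul_div_assoc]
      have := hωk k hk
      gcongr
      exact hmode ν hν hsub t ht k
    · simp
  have hVnn : ∀ (x y : ℕ → ℝ) k, 0 ≤ Vsum lam ωd x y k := by
    intro x y k
    unfold Vsum
    split_ifs with hk
    · have := hωk k hk
      positivity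
    · exact le_rfl
  obtain ⟨ν₀, hν₀, hsub₀⟩ := exists_subcritical_threshold hδ hω hev hΛ
  have hsummable : ∀ t ∈ Icc 0 T,
      Summable (Vsum lam ωd (fun k => u k t) (fun k => v k t)) := fun t ht =>
    Summable.of_nonneg_of_le (hVnn _ _) (hVmode ν₀ hν₀ hsub₀ t ht) (hV.2.2.2.mul_left _)
  have hdom : ∀ t ∈ Icc 0 T, ∀ k, Vsum lam ωd (fun j => u j t) (fun j => v j t) k ≤
      K * Real.exp (ν₀ * (1 + μ₂) * T) * Vsum lam ωd u0 u1 k := by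
    intro t ht k
    refine (hVmode ν₀ hν₀ hsub₀ t ht k).trans ?_
    have := hVnn u0 u1 k
    have := ht.2
    gcongr
  refine ⟨hsummable, ?_, ?_, ?_⟩
  · refine L2Cont.of_dominated (hV.2.2.2.mul_left (K * Real.exp (ν₀ * (1 + μ₂) * T)))
      (fun t ht k => le_trans ?_ (hdom t ht k)) fun k => ?_
    · unfold Vsum
      split_ifs with hk
      · have := hωk k hk
        rw [div_pow, Real.sq_sqrt this.le, mul_pow]
        gcongr
        exact le_add_of_nonneg_left (sq_nonneg _)
      · simp
    · split_ifs
      · exact (continuousOn_const.mul (hucont k)).div_const _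
      · exact continuousOn_const
  · refine L2Cont.of_dominated (hV.2.2.2.mul_left (K * Real.exp (ν₀ * (1 + μ₂) * T)))
      (fun t ht k => le_trans ?_ (hdom t ht k)) fun k => ?_
    · unfold Vsum
      split_ifs with hk
      · have := hωk k hk
        rw [div_pow, Real.sq_sqrt this.le]
        gcongr
        exact le_add_of_nonneg_right (by positivity)
      · simp
    · split_ifs
      · exact (hvcont k).div_const _
      · exact continuousOn_const
  · intro ν hν hsub t ht
    refine ⟨?_, ?_⟩
    · rw [← tsum_mul_left]
      exact (hsummable t ht).tsum_le_tsum (hVmode ν hν hsub t ht) (hV.2.2.2.mul_left _)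
    · have htrunc : ∀ x y : ℕ → ℝ, Summable (Vsum lam ωd x y) → Summable fun k =>
          if ν ≤ lam k then (y k ^ 2 + lam k ^ 2 * x k ^ 2) / ωd (1 / lam k) else 0 := by
        intro x y h
        refine h.of_nonneg_of_le (fun k => ?_) fun k => ?_
        · split_ifs with hk
          · have := hωk k (by linarith)
            positivity
          · exact le_rfl
        · split_ifs with hk
          · rw [Vsum, if_pos (by linarith)]
          · exact hVnn _ _ _
      rw [← tsum_mul_left]
      refine (htrunc _ _ (hsummable t ht)).tsum_le_tsum (fun k => ?_)
        ((htrunc _ _ hV.2.2.2).mul_left _)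
      split_ifs with hk
      · have := hωk k (by linarith)
        rw [← mul_div_assoc]
        gcongr
        exact hhigh ν hν hsub t ht k hk
      · simp
end
end

section
/- Let ω_d be a continuity modulus, let T > 0 and L ≥ 0, let λ : ℕ → [0,∞) be a sequence, and let u_k : [0,T] → ℝ (k ∈ ℕ) be C¹ functions such that the curves t ↦ (λ_k u_k(t))_k and t ↦ (u_k'(t))_k are continuous with values in ℓ², and such that Σ_{k : λ_k > 0} (1/ω_d(1/λ_k)) (u_k'(t)² + λ_k² u_k(t)²) ≤ L for every t ∈ [0,T]. Define g(t) := Σ_k λ_k² u_k(t)². Then |g(a) − g(b)| ≤ 3L ω_d(|a−b|) for every a, b ∈ [0,T]. -/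
open Set Filter MeasureTheory Topology

noncomputable section

/-- The low modes of a finite truncation of the elastic energy are Lipschitz, with constant
`L * ω d / d`. -/
lemma abs_low_energy_sub_le {ω : ℝ → ℝ} (hω : IsModulus ω) {T L d : ℝ} (hd : 0 < d)
    {lam : ℕ → ℝ} {u v : ℕ → ℝ → ℝ}
    (hderiv : ∀ k, ∀ t ∈ Icc (0:ℝ) T, HasDerivWithinAt (u k) (v k t) (Icc 0 T) t)
    (F : Finset ℕ) (hF : ∀ k ∈ F, 0 < lam k ∧ d ≤ 1 / lam k)
    (hbound : ∀ t ∈ Icc (0:ℝ) T,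
      ∑ k ∈ F, (v k t ^ 2 + lam k ^ 2 * u k t ^ 2) / ω (1 / lam k) ≤ L)
    {a b : ℝ} (ha : a ∈ Icc (0:ℝ) T) (hb : b ∈ Icc (0:ℝ) T) :
    |∑ k ∈ F, lam k ^ 2 * u k a ^ 2 - ∑ k ∈ F, lam k ^ 2 * u k b ^ 2| ≤
      L * ω d / d * |a - b| := by
  obtain ⟨-, -, hpos, -, hratio⟩ := hω
  have hD : ∀ t ∈ Icc (0:ℝ) T, HasDerivWithinAt (fun t => ∑ k ∈ F, lam k ^ 2 * u k t ^ 2)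
      (∑ k ∈ F, lam k ^ 2 * (2 * u k t * v k t)) (Icc 0 T) t := by
    intro t ht
    refine HasDerivWithinAt.fun_sum fun k _ => ?_
    simpa using ((hderiv k t ht).pow 2).const_mul (lam k ^ 2)
  have hterm : ∀ t, ∀ k ∈ F, |lam k ^ 2 * (2 * u k t * v k t)| ≤
      ω d / d * ((v k t ^ 2 + lam k ^ 2 * u k t ^ 2) / ω (1 / lam k)) := by
    intro t k hk
    obtain ⟨hl, hdl⟩ := hF k hk
    have hw := hpos (1 / lam k) (by positivity)
    have hwd := hpos d hd
    have hlam_le : lam k ≤ ω d / d / ω (1 / lam k) := by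
      have h := hratio d (1 / lam k) hd hdl
      rw [div_le_div_iff₀ hwd hw, div_mul_eq_mul_div, one_mul, le_div_iff₀ hl] at h
      rw [div_div, le_div_iff₀ (by positivity)]
      linarith
    calc |lam k ^ 2 * (2 * u k t * v k t)|
        ≤ lam k * (v k t ^ 2 + lam k ^ 2 * u k t ^ 2) := by
          rw [abs_le]
          constructor
          · nlinarith [mul_nonneg hl.le (sq_nonneg (v k t + lam k * u k t))]
          · nlinarith [mul_nonneg hl.le (sq_nonneg (v k t - lam k * u k t))]
      _ ≤ ω d / d / ω (1 / lam k) * (v k t ^ 2 + lam k ^ 2 * u k t ^ 2) := by gcongr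
      _ = ω d / d * ((v k t ^ 2 + lam k ^ 2 * u k t ^ 2) / ω (1 / lam k)) := by ring
  refine (convex_Icc 0 T).norm_image_sub_le_of_norm_hasDerivWithin_le hD (fun t ht => ?_) hb ha
  rw [Real.norm_eq_abs]
  calc |∑ k ∈ F, lam k ^ 2 * (2 * u k t * v k t)|
      ≤ ∑ k ∈ F, |lam k ^ 2 * (2 * u k t * v k t)| := Finset.abs_sum_le_sum_abs _ _
    _ ≤ ω d / d * ∑ k ∈ F, (v k t ^ 2 + lam k ^ 2 * u k t ^ 2) / ω (1 / lam k) := by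
        rw [Finset.mul_sum]
        exact Finset.sum_le_sum (hterm t)
    _ ≤ ω d / d * L := by
        have := (hpos d hd).le
        gcongr
        exact hbound t ht
    _ = L * ω d / d := by ring

/-- The high modes of a finite truncation of the elastic energy are bounded by `L * ω d`. -/
lemma high_energy_le {ω : ℝ → ℝ} (hω : IsModulus ω) {L d : ℝ} (hd : 0 < d)
    {lam x y : ℕ → ℝ} (F : Finset ℕ) (hF : ∀ k ∈ F, 0 < lam k ∧ 1 / lam k ≤ d)
    (hbound : ∑ k ∈ F, (y k ^ 2 + lam k ^ 2 * x k ^ 2) / ω (1 / lam k) ≤ L) :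
    ∑ k ∈ F, lam k ^ 2 * x k ^ 2 ≤ L * ω d := by
  obtain ⟨-, -, hpos, hmono, -⟩ := hω
  refine le_trans ?_ (mul_le_mul_of_nonneg_right hbound (hpos d hd).le)
  rw [Finset.sum_mul]
  refine Finset.sum_le_sum fun k hk => ?_
  obtain ⟨hl, hld⟩ := hF k hk
  have hx : 0 < 1 / lam k := by positivity
  have hw := hpos _ hx
  rw [div_mul_eq_mul_div, le_div_iff₀ hw]
  exact mul_le_mul (le_add_of_nonneg_left (sq_nonneg _)) (hmono _ _ hx.le hld) hw.le
    (by positivity)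

/-- If the curve `(u(t), u'(t))` is bounded by `L` in the squared seminorm of the
interpolation space `V_{ωd}`, then `t ↦ |A^{1/2}u(t)|²` has continuity modulus
`3 L ωd`. -/
theorem continuity_modulus_of_elastic_energy
    (ωd : ℝ → ℝ) (hωd : IsModulus ωd) (T L : ℝ) (hT : 0 < T) (hL : 0 ≤ L)
    (lam : ℕ → ℝ) (hlam : ∀ k, 0 ≤ lam k)
    (u v : ℕ → ℝ → ℝ)
    (hderiv : ∀ k, ∀ t ∈ Icc (0:ℝ) T, HasDerivWithinAt (u k) (v k t) (Icc 0 T) t)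
    (hvcont : ∀ k, ContinuousOn (v k) (Icc 0 T))
    (hcont1 : L2Cont (Icc 0 T) (fun t k => lam k * u k t))
    (hcont2 : L2Cont (Icc 0 T) (fun t k => v k t))
    (hsum : ∀ t ∈ Icc (0:ℝ) T, Summable fun k =>
      if 0 < lam k then (v k t ^ 2 + lam k ^ 2 * u k t ^ 2) / ωd (1 / lam k) else 0)
    (hbound : ∀ t ∈ Icc (0:ℝ) T,
      (∑' k, if 0 < lam k then
        (v k t ^ 2 + lam k ^ 2 * u k t ^ 2) / ωd (1 / lam k) else 0) ≤ L) :
    ∀ a ∈ Icc (0:ℝ) T, ∀ b ∈ Icc (0:ℝ) T,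
      |(∑' k, lam k ^ 2 * u k a ^ 2) - ∑' k, lam k ^ 2 * u k b ^ 2| ≤
        3 * L * ωd |a - b| := by
  intro a ha b hb
  rcases eq_or_ne a b with rfl | hab
  · simp [hωd.2.1]
  have hd : 0 < |a - b| := abs_pos.2 (sub_ne_zero.2 hab)
  set d := |a - b| with hd_def
  have hpos := hωd.2.2.1
  have hpart : ∀ t ∈ Icc (0:ℝ) T, ∀ F : Finset ℕ, (∀ k ∈ F, 0 < lam k) →
      ∑ k ∈ F, (v k t ^ 2 + lam k ^ 2 * u k t ^ 2) / ωd (1 / lam k) ≤ L := by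
    intro t ht F hF
    refine le_trans (le_of_eq ?_) (((hsum t ht).sum_le_tsum F fun k _ => ?_).trans (hbound t ht))
    · exact Finset.sum_congr rfl fun k hk => (if_pos (hF k hk)).symm
    · split_ifs with h
      · have := hpos (1 / lam k) (by positivity)
        positivity
      · exact le_rfl
  have hfin : ∀ F : Finset ℕ,
      |∑ k ∈ F, lam k ^ 2 * u k a ^ 2 - ∑ k ∈ F, lam k ^ 2 * u k b ^ 2| ≤ 3 * L * ωd d := by
    intro F
    set P := F.filter fun k => 0 < lam k with hP
    have hsupp : ∀ t, ∑ k ∈ F, lam k ^ 2 * u k t ^ 2 = ∑ k ∈ P, lam k ^ 2 * u k t ^ 2 := by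
      intro t
      refine (Finset.sum_filter_of_ne fun k _ hne => ?_).symm
      exact (hlam k).lt_of_ne' fun h => hne (by simp [h])
    have hlow : ∀ k ∈ P.filter (fun k => d ≤ 1 / lam k), 0 < lam k ∧ d ≤ 1 / lam k := by
      intro k hk
      simp only [hP, Finset.mem_filter] at hk
      exact ⟨hk.1.2, hk.2⟩
    have hhigh : ∀ k ∈ P.filter (fun k => ¬ d ≤ 1 / lam k), 0 < lam k ∧ 1 / lam k ≤ d := by
      intro k hk
      simp only [hP, Finset.mem_filter] at hk
      exact ⟨hk.1.2, (not_le.1 hk.2).le⟩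
    have h1 := abs_low_energy_sub_le hωd hd hderiv _ hlow
      (fun t ht => hpart t ht _ fun k hk => (hlow k hk).1) ha hb
    rw [← hd_def, div_mul_cancel₀ _ hd.ne'] at h1
    have h2 : ∀ t ∈ Icc (0:ℝ) T,
        ∑ k ∈ P.filter (fun k => ¬ d ≤ 1 / lam k), lam k ^ 2 * u k t ^ 2 ≤ L * ωd d :=
      fun t ht => high_energy_le hωd hd _ hhigh (hpart t ht _ fun k hk => (hhigh k hk).1)
    have h3 : ∀ t, 0 ≤ ∑ k ∈ P.filter (fun k => ¬ d ≤ 1 / lam k), lam k ^ 2 * u k t ^ 2 :=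
      fun t => Finset.sum_nonneg fun k _ => by positivity
    have hLω : 0 ≤ L * ωd d := mul_nonneg hL (hpos d hd).le
    rw [hsupp a, hsupp b, ← Finset.sum_filter_add_sum_filter_not P (fun k => d ≤ 1 / lam k),
      ← Finset.sum_filter_add_sum_filter_not P (fun k => d ≤ 1 / lam k)
        (fun k => lam k ^ 2 * u k b ^ 2)]
    rw [abs_le] at h1 ⊢
    constructor <;> linarith [h2 a ha, h2 b hb, h3 a, h3 b]
  have hsummable : ∀ t ∈ Icc (0:ℝ) T, Summable fun k => lam k ^ 2 * u k t ^ 2 := by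
    intro t ht
    simpa only [mul_pow] using hcont1.1 t ht
  have hlim : Tendsto
      (fun F : Finset ℕ => |∑ k ∈ F, lam k ^ 2 * u k a ^ 2 - ∑ k ∈ F, lam k ^ 2 * u k b ^ 2|) atTop
      (𝓝 |(∑' k, lam k ^ 2 * u k a ^ 2) - ∑' k, lam k ^ 2 * u k b ^ 2|) :=
    (Tendsto.sub (hsummable a ha).hasSum (hsummable b hb).hasSum).abs
  exact le_of_tendsto hlim
    (Eventually.of_forall hfin)
end
end

section
/- Let λ : ℕ → [0,∞) be a sequence, let α ∈ [0,1/4), and let (u⁰_k)_k and (u¹_k)_k be real sequences such that E := Σ_k λ_k^{4α} ((u¹_k)² + λ_k² (u⁰_k)²) < +∞. Then there exists a continuity modulus ω_d such that: ω_d(1) = 1; ω_d(x) ≤ x^{4α} for every x ≥ 0; lim_{x→0⁺} ω_d(x)/x^{4α} = 0; and Σ_{k : λ_k > 0} (1/ω_d(1/λ_k)) ((u¹_k)² + λ_k² (u⁰_k)²) ≤ 2E. -/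
open Set Filter MeasureTheory Topology

noncomputable section

/-- A summable nonnegative family absorbs some weight `min 1 (c * y k)` with small positive slope. -/
lemma exists_pos_tsum_mul_min_le {a y : ℕ → ℝ} (ha : ∀ k, 0 ≤ a k) (hs : Summable a)
    (hy : ∀ k, 0 ≤ y k) {δ b : ℝ} (hδ : 0 < δ) (hb : 0 < b) :
    ∃ c, 0 < c ∧ c ≤ b ∧ ∑' k, a k * min 1 (c * y k) ≤ δ * ∑' k, a k := by
  rcases (tsum_nonneg ha).eq_or_lt with h0 | h0
  · have hz : ∀ k, a k = 0 := fun k => by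
      have := hs.le_tsum k fun j _ => ha j
      linarith [ha k]
    exact ⟨b, hb, le_rfl, by simp [hz]⟩
  · have hlim : Tendsto (fun c : ℝ => ∑' k, a k * min 1 (c * y k)) (𝓝[>] 0)
        (𝓝 (∑' _ : ℕ, (0 : ℝ))) := by
      refine tendsto_tsum_of_dominated_convergence hs (fun k => ?_) ?_
      · have hc : Continuous fun c : ℝ => a k * min 1 (c * y k) := by fun_prop
        have := (hc.tendsto 0).mono_left (nhdsWithin_le_nhds (s := Ioi 0))
        simpa using this
      · filter_upwards [self_mem_nhdsWithin] with c hc k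
        have hm : 0 ≤ min 1 (c * y k) := le_min zero_le_one (mul_nonneg (le_of_lt hc) (hy k))
        rw [Real.norm_of_nonneg (mul_nonneg (ha k) hm)]
        exact mul_le_of_le_one_right (ha k) (min_le_left _ _)
    rw [tsum_zero] at hlim
    obtain ⟨c, h1, h2⟩ := ((hlim.eventually_lt_const (mul_pos hδ h0)).and
      (Ioc_mem_nhdsGT hb)).exists
    exact ⟨c, h2.1, h2.2, h1.le⟩

/-- A summable nonnegative family remains summable, with controlled sum, after multiplication by
`F (y k)` for some monotone `β`-Lipschitz function `F` tending to infinity. -/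
lemma exists_monotone_lipschitz_tsum_mul_le {a y : ℕ → ℝ} (ha : ∀ k, 0 ≤ a k)
    (hs : Summable a) (hy : ∀ k, 0 ≤ y k) {β : ℝ} (hβ : 0 < β) :
    ∃ F : ℝ → ℝ, F 0 = 0 ∧ Monotone F ∧ (∀ s t, s ≤ t → F t ≤ F s + β * (t - s)) ∧
      Tendsto F atTop atTop ∧ (Summable fun k => a k * F (y k)) ∧
      ∑' k, a k * F (y k) ≤ ∑' k, a k := by
  have hgeo : HasSum (fun n : ℕ => (1 / 2 : ℝ) / 2 ^ n) 1 := by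
    simpa using hasSum_geometric_two' (1 : ℝ)
  choose c hc0 hcb hcs using fun n : ℕ =>
    exists_pos_tsum_mul_min_le (δ := (1 / 2) / 2 ^ n) (b := β * ((1 / 2) / 2 ^ n))
      ha hs hy (by positivity) (by positivity)
  have hcsum : Summable c :=
    Summable.of_nonneg_of_le (fun n => (hc0 n).le) hcb (hgeo.summable.mul_left β)
  have hctot : ∑' n, c n ≤ β := by
    have := hcsum.tsum_le_tsum hcb (hgeo.summable.mul_left β)
    rwa [tsum_mul_left, hgeo.tsum_eq, mul_one] at this
  set h : ℕ → ℝ → ℝ := fun n t => min 1 (c n * max 0 t) with hh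
  have hnn : ∀ n t, 0 ≤ h n t := fun n t =>
    le_min zero_le_one (mul_nonneg (hc0 n).le (le_max_left _ _))
  have hsum : ∀ t, Summable fun n => h n t := fun t =>
    Summable.of_nonneg_of_le (fun n => hnn n t) (fun n => min_le_right _ _)
      (hcsum.mul_right (max 0 t))
  have hmono : ∀ n, Monotone (h n) := fun n s t hst =>
    min_le_min le_rfl (mul_le_mul_of_nonneg_left (max_le_max le_rfl hst) (hc0 n).le)
  have hlip : ∀ n s t, s ≤ t → h n t ≤ h n s + c n * (t - s) := by
    intro n s t hst
    have hm : max 0 t ≤ max 0 s + (t - s) :=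
      max_le (by linarith [le_max_left 0 s]) (by linarith [le_max_right 0 s])
    have h1 := mul_le_mul_of_nonneg_left hm (hc0 n).le
    have h2 : 0 ≤ c n * (t - s) := mul_nonneg (hc0 n).le (by linarith)
    rw [mul_add] at h1
    simp only [hh, min_add]
    exact min_le_min (by linarith) h1
  have hfin : ∀ s : Finset ℕ, ∑ k ∈ s, a k * ∑' n, h n (y k) ≤ ∑' k, a k := by
    intro s
    have hterm : ∀ n, ∑ k ∈ s, a k * h n (y k) ≤ (1 / 2) / 2 ^ n * ∑' k, a k := by
      intro n
      refine le_trans ?_ (hcs n)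
      have he : ∀ k, h n (y k) = min 1 (c n * y k) := fun k => by
        simp [hh, max_eq_right (hy k)]
      simp only [← he]
      refine Summable.sum_le_tsum s (fun k _ => mul_nonneg (ha k) (hnn n _)) ?_
      exact Summable.of_nonneg_of_le (fun k => mul_nonneg (ha k) (hnn n _))
        (fun k => mul_le_of_le_one_right (ha k) (min_le_left _ _)) hs
    simp only [← tsum_mul_left]
    rw [← Summable.tsum_finsetSum fun k _ => (hsum (y k)).mul_left (a k)]
    have := Summable.tsum_le_tsum hterm
      (summable_sum fun k _ => (hsum (y k)).mul_left (a k)) (hgeo.summable.mul_right _)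
    rwa [tsum_mul_right, hgeo.tsum_eq, one_mul] at this
  have hFsum : Summable fun k => a k * ∑' n, h n (y k) :=
    summable_of_sum_le (fun k => mul_nonneg (ha k) (tsum_nonneg fun n => hnn n _)) hfin
  refine ⟨fun t => ∑' n, h n t, by simp [hh], fun s t hst =>
    (hsum s).tsum_le_tsum (fun n => hmono n hst) (hsum t), ?_, ?_, hFsum,
    hFsum.tsum_le_of_sum_le hfin⟩
  · intro s t hst
    have h1 := (hsum t).tsum_le_tsum (fun n => hlip n s t hst)
      ((hsum s).add (hcsum.mul_right (t - s)))
    rw [(hsum s).tsum_add (hcsum.mul_right (t - s)), tsum_mul_right] at h1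
    have h2 := mul_le_mul_of_nonneg_right hctot (sub_nonneg.2 hst)
    linarith
  · refine tendsto_atTop.2 fun B => ?_
    obtain ⟨N, hN⟩ := exists_nat_ge B
    have hev : ∀ n ∈ Finset.range N, ∀ᶠ t in atTop, 1 ≤ h n t := by
      intro n _
      filter_upwards [eventually_ge_atTop (1 / c n)] with t ht
      refine le_min le_rfl ?_
      rw [div_le_iff₀' (hc0 n)] at ht
      exact ht.trans (mul_le_mul_of_nonneg_left (le_max_right _ _) (hc0 n).le)
    filter_upwards [(Finset.eventually_all (Finset.range N)).2 hev] with t ht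
    calc B ≤ N := hN
      _ = ∑ n ∈ Finset.range N, (1 : ℝ) := by simp
      _ ≤ ∑ n ∈ Finset.range N, h n t := Finset.sum_le_sum ht
      _ ≤ ∑' n, h n t := (hsum t).sum_le_tsum _ fun n _ => hnn n t

/-- The power `x ^ p` on `(0,∞)`, damped near `0` by a function of `-log x`. -/
def dampedPow (p : ℝ) (F : ℝ → ℝ) (x : ℝ) : ℝ :=
  if 0 < x then x ^ p / (1 + F (max 0 (-Real.log x))) else 0

section dampedPow

variable {p : ℝ} {F : ℝ → ℝ}

lemma dampedPow_of_pos {x : ℝ} (hx : 0 < x) :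
    dampedPow p F x = x ^ p / (1 + F (max 0 (-Real.log x))) := if_pos hx

lemma dampedPow_nonneg (hF : ∀ t, 0 ≤ t → 0 ≤ F t) (x : ℝ) : 0 ≤ dampedPow p F x := by
  unfold dampedPow
  split_ifs with h
  · have := hF _ (le_max_left 0 (-Real.log x))
    positivity
  · exact le_rfl

lemma dampedPow_le_rpow (hF : ∀ t, 0 ≤ t → 0 ≤ F t) {x : ℝ} (hx : 0 ≤ x) :
    dampedPow p F x ≤ x ^ p := by
  unfold dampedPow
  split_ifs with h
  · exact div_le_self (by positivity) (by linarith [hF _ (le_max_left 0 (-Real.log x))])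
  · positivity

lemma tendsto_dampedPow_div_rpow (hF : Tendsto F atTop atTop) :
    Tendsto (fun x => dampedPow p F x / x ^ p) (𝓝[>] 0) (𝓝 0) := by
  have hl : Tendsto (fun x => max 0 (-Real.log x)) (𝓝[>] 0) atTop :=
    tendsto_atTop_mono (fun x => le_max_right _ _)
      (tendsto_neg_atBot_atTop.comp Real.tendsto_log_nhdsGT_zero)
  refine (tendsto_inv_atTop_zero.comp
    (tendsto_atTop_add_const_left _ 1 (hF.comp hl))).congr' ?_
  filter_upwards [self_mem_nhdsWithin] with x hx
  have hxp : x ^ p ≠ 0 := (Real.rpow_pos_of_pos hx p).ne'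
  rw [dampedPow_of_pos hx, div_right_comm, div_self hxp, one_div]
  rfl

lemma isModulus_dampedPow {β : ℝ} (hp : 0 ≤ p) (hpβ : p + β = 1) (hβ : 0 < β)
    (hF0 : F 0 = 0) (hFm : Monotone F) (hFl : ∀ s t, s ≤ t → F t ≤ F s + β * (t - s))
    (hFt : Tendsto F atTop atTop) : IsModulus (dampedPow p F) := by
  have hFn : ∀ t, 0 ≤ t → 0 ≤ F t := fun t ht => hF0 ▸ hFm ht
  have hpos : ∀ x, 0 < 1 + F (max 0 (-Real.log x)) := fun x => by
    linarith [hFn _ (le_max_left 0 (-Real.log x))]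
  have hFc : Continuous F := by
    refine (LipschitzWith.of_le_add_mul ⟨β, hβ.le⟩ fun s t => ?_).continuous
    change F s ≤ F t + β * dist s t
    rcases le_total s t with hst | hst
    · have := hFm hst
      have : 0 ≤ β * dist s t := by positivity
      linarith
    · rw [Real.dist_eq, abs_of_nonneg (sub_nonneg.2 hst)]
      exact hFl t s hst
  have hd0 : dampedPow p F 0 = 0 := if_neg (lt_irrefl 0)
  refine ⟨?_, hd0, fun x hx => ?_, fun x y hx hxy => ?_, fun x y hx hxy => ?_⟩
  · intro x hx
    rcases (mem_Ici.1 hx).eq_or_lt with rfl | hx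
    · rw [← continuousWithinAt_Ioi_iff_Ici, ContinuousWithinAt, hd0]
      refine squeeze_zero' (Eventually.of_forall fun x => dampedPow_nonneg hFn x) ?_
        (tendsto_dampedPow_div_rpow (p := p) hFt)
      filter_upwards [Ioc_mem_nhdsGT zero_lt_one] with x hx
      exact le_div_self (dampedPow_nonneg hFn x) (Real.rpow_pos_of_pos hx.1 p)
        (Real.rpow_le_one hx.1.le hx.2 hp)
    · have hc : ContinuousAt (fun x => x ^ p / (1 + F (max 0 (-Real.log x)))) x := by
        refine (Real.continuousAt_rpow_const x p (Or.inl hx.ne')).div ?_ (hpos x).ne'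
        have hl := Real.continuousAt_log hx.ne'
        exact continuousAt_const.add
          (hFc.continuousAt.comp (continuousAt_const.max hl.neg))
      refine (hc.congr ?_).continuousWithinAt
      filter_upwards [lt_mem_nhds hx] with z hz using (dampedPow_of_pos hz).symm
  · rw [dampedPow_of_pos hx]
    exact div_pos (Real.rpow_pos_of_pos hx p) (hpos x)
  · rcases hx.eq_or_lt with rfl | hx
    · rw [hd0]
      exact dampedPow_nonneg hFn y
    · have hy := hx.trans_le hxy
      rw [dampedPow_of_pos hx, dampedPow_of_pos hy]
      refine div_le_div₀ (Real.rpow_nonneg hy.le p) (Real.rpow_le_rpow hx.le hxy hp) (hpos y) ?_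
      have hl := Real.log_le_log hx hxy
      have := hFm (max_le_max (le_refl (0 : ℝ)) (neg_le_neg hl))
      linarith
  · have hy := hx.trans_le hxy
    have hform : ∀ z, 0 < z →
        z / dampedPow p F z = Real.exp (Real.log z * β) * (1 + F (max 0 (-Real.log z))) := by
      intro z hz
      rw [dampedPow_of_pos hz, ← Real.rpow_def_of_pos hz, div_div_eq_mul_div,
        show β = 1 - p by linarith, Real.rpow_sub hz, Real.rpow_one]
      ring
    rw [hform x hx, hform y hy]
    have hl := Real.log_le_log hx hxy
    set u := Real.log x
    set v := Real.log y
    have hm : max 0 (-u) ≤ max 0 (-v) + (v - u) :=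
      max_le (by linarith [le_max_left 0 (-v)]) (by linarith [le_max_right 0 (-v)])
    have h1 := hFl _ _ (max_le_max (le_refl (0 : ℝ)) (neg_le_neg hl))
    have h2 : F (max 0 (-u)) ≤ F (max 0 (-v)) + β * (v - u) :=
      h1.trans (add_le_add_right (mul_le_mul_of_nonneg_left (by linarith) hβ.le) _)
    have h3 := hFn _ (le_max_left 0 (-v))
    have h4 := Real.add_one_le_exp (β * (v - u))
    have h5 : 0 ≤ β * (v - u) := mul_nonneg hβ.le (by linarith)
    have h6 : 1 + F (max 0 (-u)) ≤ Real.exp (β * (v - u)) * (1 + F (max 0 (-v))) := by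
      nlinarith [mul_nonneg h5 h3]
    calc Real.exp (u * β) * (1 + F (max 0 (-u)))
        ≤ Real.exp (u * β) * (Real.exp (β * (v - u)) * (1 + F (max 0 (-v)))) := by gcongr
      _ = Real.exp (v * β) * (1 + F (max 0 (-v))) := by
        rw [← mul_assoc, ← Real.exp_add]
        ring_nf

end dampedPow

/-- Customized interpolation spaces: every pair `(u0, u1)` in
`D(A^{α+1/2}) × D(A^α)` with `α ∈ [0,1/4)` actually lies in a space `V_{ωd}` for a
continuity modulus `ωd` vanishing faster than `x^{4α}`, with controlled seminorm. -/
theorem customized_interpolation_space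
    (lam : ℕ → ℝ) (hlam : ∀ k, 0 ≤ lam k)
    (α : ℝ) (hα0 : 0 ≤ α) (hα1 : α < 1 / 4)
    (u0 u1 : ℕ → ℝ)
    (hE : Summable fun k => lam k ^ (4 * α) * (u1 k ^ 2 + lam k ^ 2 * u0 k ^ 2)) :
    ∃ ωd : ℝ → ℝ, IsModulus ωd ∧ ωd 1 = 1 ∧
      (∀ x : ℝ, 0 ≤ x → ωd x ≤ x ^ (4 * α)) ∧
      Tendsto (fun x => ωd x / x ^ (4 * α)) (𝓝[>] (0:ℝ)) (𝓝 0) ∧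
      (Summable fun k =>
        if 0 < lam k then (u1 k ^ 2 + lam k ^ 2 * u0 k ^ 2) / ωd (1 / lam k) else 0) ∧
      (∑' k, if 0 < lam k then
          (u1 k ^ 2 + lam k ^ 2 * u0 k ^ 2) / ωd (1 / lam k) else 0) ≤
        2 * ∑' k, lam k ^ (4 * α) * (u1 k ^ 2 + lam k ^ 2 * u0 k ^ 2) := by
  set a : ℕ → ℝ := fun k => lam k ^ (4 * α) * (u1 k ^ 2 + lam k ^ 2 * u0 k ^ 2) with ha
  have ha0 : ∀ k, 0 ≤ a k := fun k =>
    mul_nonneg (Real.rpow_nonneg (hlam k) _) (by positivity)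
  set y : ℕ → ℝ := fun k => max 0 (Real.log (lam k)) with hy
  have hy0 : ∀ k, 0 ≤ y k := fun k => le_max_left _ _
  obtain ⟨F, hF0, hFm, hFl, hFt, hFs, hFle⟩ :=
    exists_monotone_lipschitz_tsum_mul_le ha0 hE hy0 (β := 1 - 4 * α) (by linarith)
  have hFn : ∀ t, 0 ≤ t → 0 ≤ F t := fun t ht => hF0 ▸ hFm ht
  have hmod : IsModulus (dampedPow (4 * α) F) :=
    isModulus_dampedPow (by linarith) (by ring) (by linarith) hF0 hFm hFl hFt
  have hterm : ∀ k, (if 0 < lam k then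
      (u1 k ^ 2 + lam k ^ 2 * u0 k ^ 2) / dampedPow (4 * α) F (1 / lam k) else 0) ≤
      a k + a k * F (y k) := by
    intro k
    split_ifs with hk
    · rw [dampedPow_of_pos (one_div_pos.2 hk), one_div, Real.log_inv, neg_neg,
        Real.inv_rpow hk.le]
      refine le_of_eq ?_
      simp only [ha, hy, div_div_eq_mul_div, div_inv_eq_mul]
      ring
    · exact add_nonneg (ha0 k) (mul_nonneg (ha0 k) (hFn _ (hy0 k)))
  have hsum : Summable fun k => if 0 < lam k then
      (u1 k ^ 2 + lam k ^ 2 * u0 k ^ 2) / dampedPow (4 * α) F (1 / lam k) else 0 := by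
    refine Summable.of_nonneg_of_le (fun k => ?_) hterm (hE.add hFs)
    split_ifs
    · exact div_nonneg (by positivity) (dampedPow_nonneg hFn _)
    · exact le_rfl
  refine ⟨dampedPow (4 * α) F, hmod, ?_, fun x hx => dampedPow_le_rpow hFn hx,
    tendsto_dampedPow_div_rpow hFt, hsum, ?_⟩
  · rw [dampedPow_of_pos one_pos]
    simp [hF0]
  · have := hsum.tsum_le_tsum hterm (hE.add hFs)
    rw [hE.tsum_add hFs] at this
    linarith
end
end

section
/- Let λ : ℕ → [0,∞) be a sequence, let m : [0,∞) → [0,∞) be continuous, let σ > 1/2 and δ > 0 be real numbers, and let u be a solution on [0,T] (for some T > 0) of the Kirchhoff equation u'' + 2δ A^σ u' + m(|A^{1/2}u|²) A u = 0 with initial data (u⁰,u¹) ∈ D(A^{1/2}) × H. Then there exist constants K₃ > 0 and K₄ > 0, depending only on δ (in particular independent of T and u), such that |A^{1/2}u(t)|² ≤ K₃ ( |u¹|² + |u⁰|² + |A^{1/2}u⁰|² + M(|A^{1/2}u⁰|²) ) exp(K₄ t) for every t ∈ [0,T], where M(x) := ∫₀ˣ m(s) ds. -/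
open Set Filter MeasureTheory Topology

noncomputable section

/-- A solution on the interval `I` (which contains `0`) of the Kirchhoff equation
`u'' + 2δ A^σ u' + m(|A^{1/2}u|²) A u = 0` with initial data `(u0, u1)`, in the diagonal
setting where `A` multiplies the `k`-th component by `lam k ^ 2`.  Each component is `C²`
on `I`, satisfies the componentwise ODE, and the curves `t ↦ u(t)`, `t ↦ A^{1/2}u(t)`,
`t ↦ u'(t)` are continuous with values in `ℓ²`. -/
def IsKirchhoffSol (lam : ℕ → ℝ) (m : ℝ → ℝ) (σ δ : ℝ) (I : Set ℝ)
    (u0 u1 : ℕ → ℝ) (u : ℕ → ℝ → ℝ) : Prop :=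
  (∀ k, ContDiffOn ℝ 2 (u k) I) ∧
  (∀ k, u k 0 = u0 k) ∧
  (∀ k, derivWithin (u k) I 0 = u1 k) ∧
  (∀ k, ∀ t ∈ I,
    derivWithin (derivWithin (u k) I) I t
      + 2 * δ * lam k ^ (2 * σ) * derivWithin (u k) I t
      + m (∑' j, lam j ^ 2 * u j t ^ 2) * lam k ^ 2 * u k t = 0) ∧
  L2Cont I (fun t k => u k t) ∧
  L2Cont I (fun t k => lam k * u k t) ∧
  L2Cont I (fun t k => derivWithin (u k) I t)

lemma le_initial_of_hasDerivWithinAt_nonpos {T : ℝ} {f f' : ℝ → ℝ}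
    (hf : ∀ t ∈ Icc (0:ℝ) T, HasDerivWithinAt f (f' t) (Icc 0 T) t)
    (hf' : ∀ t ∈ Icc (0:ℝ) T, f' t ≤ 0) {t : ℝ} (ht : t ∈ Icc (0:ℝ) T) : f t ≤ f 0 :=
  antitoneOn_of_hasDerivWithinAt_nonpos (convex_Icc 0 T)
    (fun s hs => (hf s hs).continuousWithinAt)
    (fun s hs => (hf s (interior_subset hs)).mono interior_subset)
    (fun s hs => hf' s (interior_subset hs)) ⟨le_rfl, ht.1.trans ht.2⟩ ht ht.1

lemma L2Cont.continuousOn_tsum_sq {I : Set ℝ} {v : ℝ → ℕ → ℝ} (hv : L2Cont I v) :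
    ContinuousOn (fun t => ∑' k, v t k ^ 2) I := by
  have hmem : ∀ w : ℕ → ℝ, (Summable fun k => w k ^ 2) → Memℓp w 2 := fun w hw =>
    memℓp_gen (by simpa using hw)
  have hnorm : ∀ w : lp (fun _ : ℕ => ℝ) 2, ‖w‖ ^ 2 = ∑' k, w k ^ 2 := fun w => by
    simpa using lp.norm_rpow_eq_tsum (p := 2) (by simp) w
  let V : I → lp (fun _ : ℕ => ℝ) 2 := fun t => ⟨v t, hmem _ (hv.1 t t.2)⟩
  have hV : Continuous V := by
    rw [Metric.continuous_iff]
    intro t ε hε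
    obtain ⟨η, hη, h⟩ := hv.2 t t.2 (ε ^ 2) (by positivity)
    refine ⟨η, hη, fun s hs => ?_⟩
    have h1 := h s s.2 hs
    rw [dist_eq_norm]
    refine lt_of_pow_lt_pow_left₀ 2 hε.le ?_
    rw [hnorm]
    exact h1
  rw [continuousOn_iff_continuous_domRestrict]
  have h2 : I.domRestrict (fun t => ∑' k, v t k ^ 2) = fun t => ‖V t‖ ^ 2 := by
    funext t
    rw [hnorm]
    rfl
  rw [h2]
  exact hV.norm.pow 2

section Mode

variable {T : ℝ} {y v : ℝ → ℝ}

/-- In the overdamped regime `b ≤ a²`, the quantity `y' (y' + a y)` decays exponentially along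
solutions of `y'' + 2 a y' + b y = 0`. -/
lemma overdamped_decay {a : ℝ} {b : ℝ → ℝ} (ha : 0 < a)
    (hb : ∀ t ∈ Icc (0:ℝ) T, 0 ≤ b t ∧ b t ≤ a ^ 2)
    (hy : ∀ t ∈ Icc (0:ℝ) T, HasDerivWithinAt y (v t) (Icc 0 T) t)
    (hv : ∀ t ∈ Icc (0:ℝ) T, HasDerivWithinAt v (-(2 * a * v t) - b t * y t) (Icc 0 T) t)
    {t : ℝ} (ht : t ∈ Icc (0:ℝ) T) :
    v t ^ 2 + a * (y t * v t) ≤ (v 0 ^ 2 + a * (y 0 * v 0)) * Real.exp (-(2 * a * t)) := by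
  have key := le_initial_of_hasDerivWithinAt_nonpos (T := T)
    (f := fun s => (v s ^ 2 + a * (y s * v s)) * Real.exp (2 * a * s))
    (f' := fun s => -(a * v s ^ 2 + 2 * b s * y s * v s + a * b s * y s ^ 2)
      * Real.exp (2 * a * s))
    (fun s hs => by
      have he : HasDerivWithinAt (fun s => Real.exp (2 * a * s))
          (Real.exp (2 * a * s) * (2 * a * 1)) (Icc 0 T) s :=
        (((hasDerivAt_id s).const_mul (2 * a)).exp).hasDerivWithinAt
      have := ((((hv s hs).pow 2).add (((hy s hs).mul (hv s hs)).const_mul a))).mul he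
      refine this.congr_deriv ?_
      simp only [Pi.add_apply, Pi.mul_apply, Pi.pow_apply]
      push_cast
      ring)
    (fun s hs => by
      obtain ⟨hb0, hb1⟩ := hb s hs
      refine mul_nonpos_of_nonpos_of_nonneg ?_ (Real.exp_pos _).le
      have h1 : a * (a * v s ^ 2 + 2 * b s * y s * v s + a * b s * y s ^ 2)
          = (a * v s + b s * y s) ^ 2 + b s * (a ^ 2 - b s) * y s ^ 2 := by ring
      have h2 : 0 ≤ b s * (a ^ 2 - b s) * y s ^ 2 :=
        mul_nonneg (mul_nonneg hb0 (sub_nonneg.2 hb1)) (sq_nonneg _)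
      have h3 : 0 ≤ a * v s ^ 2 + 2 * b s * y s * v s + a * b s * y s ^ 2 := by
        refine nonneg_of_mul_nonneg_right (a := a) ?_ ha
        rw [h1]; positivity
      linarith) ht
  simp only [mul_zero, Real.exp_zero, mul_one] at key
  rw [Real.exp_neg, ← div_eq_mul_inv, le_div_iff₀ (Real.exp_pos _)]
  exact key

variable {δ A L : ℝ} {c : ℝ → ℝ}

/-- A modified energy for a single mode. -/
lemma exists_mode_energy (hδ : 0 < δ) (hL : 0 ≤ L) (hA0 : 0 ≤ A) (hA : 1 ≤ L → L ≤ A)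
    (hc : ∀ t ∈ Icc (0:ℝ) T, 0 ≤ c t)
    (hy : ∀ t ∈ Icc (0:ℝ) T, HasDerivWithinAt y (v t) (Icc 0 T) t)
    (hv : ∀ t ∈ Icc (0:ℝ) T,
      HasDerivWithinAt v (-(2 * (δ * A) * v t) - c t * L ^ 2 * y t) (Icc 0 T) t) :
    ∃ ψ ψ' : ℝ → ℝ,
      (∀ t ∈ Icc (0:ℝ) T, HasDerivWithinAt ψ (ψ' t) (Icc 0 T) t) ∧
      (∀ t ∈ Icc (0:ℝ) T, ψ' t ≤ ψ t - c t * (2 * L ^ 2 * (y t * v t))) ∧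
      (∀ t, min (δ ^ 2) 1 * (L ^ 2 * y t ^ 2) ≤ ψ t) ∧
      ψ 0 ≤ (2 + 3 * δ ^ 2) * (v 0 ^ 2 + y 0 ^ 2 + L ^ 2 * y 0 ^ 2) := by
  rcases lt_or_ge L 1 with hL1 | hL1
  · refine ⟨fun s => v s ^ 2 + y s ^ 2, _,
      fun s hs => ((hv s hs).pow 2).add ((hy s hs).pow 2), fun s hs => ?_, fun s => ?_, ?_⟩
    · have h1 : 0 ≤ δ * A * v s ^ 2 := by positivity
      push_cast
      nlinarith [sq_nonneg (v s - y s)]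
    · have h1 : L ^ 2 * y s ^ 2 ≤ 1 * y s ^ 2 := by
        gcongr
        exact pow_le_one₀ hL hL1.le
      have h2 : min (δ ^ 2) 1 * (L ^ 2 * y s ^ 2) ≤ 1 * (L ^ 2 * y s ^ 2) := by
        gcongr
        exact min_le_right _ _
      nlinarith [sq_nonneg (v s)]
    · have : 0 ≤ L ^ 2 * y 0 ^ 2 := by positivity
      nlinarith [sq_nonneg (v 0), sq_nonneg (y 0), mul_nonneg (sq_nonneg δ) (sq_nonneg (v 0)),
        mul_nonneg (sq_nonneg δ) (sq_nonneg (y 0)), mul_nonneg (sq_nonneg δ) this]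
  · have hLA := hA hL1
    have hApos : 0 < A := by linarith
    obtain ⟨μ, hμ⟩ : ∃ μ, μ = L / A := ⟨_, rfl⟩
    have hμA : μ * A = L := by rw [hμ]; field_simp
    have hμ0 : 0 ≤ μ := by rw [hμ]; positivity
    have hμ1 : μ ≤ 1 := by rw [hμ]; exact div_le_one_of_le₀ hLA hA0
    have hform : ∀ s, |2 * δ * (μ * L * (y s * v s))| ≤ v s ^ 2 + δ ^ 2 * (L ^ 2 * y s ^ 2) := by
      intro s
      have h1 : |2 * δ * (μ * L * (y s * v s))| = μ * |2 * δ * (L * y s * v s)| := by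
        rw [show 2 * δ * (μ * L * (y s * v s)) = μ * (2 * δ * (L * y s * v s)) by ring, abs_mul,
          abs_of_nonneg hμ0]
      have h2 : |2 * δ * (L * y s * v s)| ≤ v s ^ 2 + δ ^ 2 * (L ^ 2 * y s ^ 2) := by
        rw [abs_le]
        constructor <;> nlinarith [sq_nonneg (v s - δ * L * y s), sq_nonneg (v s + δ * L * y s)]
      rw [h1]
      exact (mul_le_of_le_one_left (abs_nonneg _) hμ1).trans h2
    have hlow : ∀ s, δ ^ 2 * (L ^ 2 * y s ^ 2) ≤
        v s ^ 2 + 2 * δ * μ * L * (y s * v s) + 2 * δ ^ 2 * L ^ 2 * y s ^ 2 := by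
      intro s
      have := (abs_le.1 (hform s)).1
      linarith
    refine ⟨fun s => v s ^ 2 + 2 * δ * μ * L * (y s * v s) + 2 * δ ^ 2 * L ^ 2 * y s ^ 2, _,
      fun s hs => (((hv s hs).pow 2).add (((hy s hs).mul (hv s hs)).const_mul _)).add
        (((hy s hs).pow 2).const_mul _), fun s hs => ?_, fun s => ?_, ?_⟩
    · have h0 : 0 ≤ δ ^ 2 * (L ^ 2 * y s ^ 2) := by positivity
      have h1 := hlow s
      have h2 : 0 ≤ 2 * δ * μ * L * (c s * L ^ 2 * y s ^ 2) := by
        have := hc s hs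
        positivity
      have h3 : 2 * δ * μ * L * v s ^ 2 ≤ 4 * δ * A * v s ^ 2 := by
        have : μ * L ≤ 2 * A := by nlinarith
        nlinarith [mul_le_mul_of_nonneg_left this (mul_nonneg hδ.le (sq_nonneg (v s)))]
      have h4 : 2 * δ * μ * L * (y s * (2 * (δ * A) * v s)) = 4 * δ ^ 2 * L ^ 2 * (y s * v s) := by
        linear_combination 4 * δ ^ 2 * L * (y s * v s) * hμA
      push_cast
      nlinarith
    · refine le_trans ?_ (hlow s)
      gcongr
      exact min_le_left _ _
    · have := (abs_le.1 (hform 0)).2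
      have h5 : 0 ≤ L ^ 2 * y 0 ^ 2 := by positivity
      nlinarith [sq_nonneg (v 0), sq_nonneg (y 0), mul_nonneg (sq_nonneg δ) (sq_nonneg (v 0)),
        mul_nonneg (sq_nonneg δ) (sq_nonneg (y 0)), mul_nonneg (sq_nonneg δ) h5]

/-- Control of the total variation of `L² y²` for a single mode, up to a lower order term for
low frequencies. -/
lemma exists_mode_variation {Λ : ℝ} (hΛ : 1 ≤ Λ) (hδ : 0 < δ) (hL : 0 ≤ L)
    (hA : 1 ≤ L → L ≤ A)
    (hc : ∀ t ∈ Icc (0:ℝ) T, 0 ≤ c t)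
    (hc' : Λ ≤ L → ∀ t ∈ Icc (0:ℝ) T, c t * L ^ 2 ≤ (δ * A) ^ 2)
    (hy : ∀ t ∈ Icc (0:ℝ) T, HasDerivWithinAt y (v t) (Icc 0 T) t)
    (hv : ∀ t ∈ Icc (0:ℝ) T,
      HasDerivWithinAt v (-(2 * (δ * A) * v t) - c t * L ^ 2 * y t) (Icc 0 T) t) :
    ∃ g g' : ℝ → ℝ,
      (∀ t ∈ Icc (0:ℝ) T, HasDerivWithinAt g (g' t) (Icc 0 T) t) ∧
      (∀ t ∈ Icc (0:ℝ) T,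
        |2 * L ^ 2 * (y t * v t)| ≤ g' t + Λ * (L ^ 2 * y t ^ 2 + v t ^ 2)) ∧
      ∀ t, g t - g 0 ≤ (2 / δ ^ 2 + 1 / δ + 1) * (v 0 ^ 2 + L ^ 2 * y 0 ^ 2) := by
  rcases lt_or_ge L Λ with hLΛ | hLΛ
  · refine ⟨fun _ => 0, fun _ => 0, fun s _ => hasDerivWithinAt_const _ _ _, fun s _ => ?_,
      fun s => ?_⟩
    · have h1 : |2 * L ^ 2 * (y s * v s)| = L * |2 * (L * y s * v s)| := by
        rw [show 2 * L ^ 2 * (y s * v s) = L * (2 * (L * y s * v s)) by ring, abs_mul,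
          abs_of_nonneg hL]
      have h2 : |2 * (L * y s * v s)| ≤ L ^ 2 * y s ^ 2 + v s ^ 2 := by
        rw [abs_le]
        constructor <;> nlinarith [sq_nonneg (v s - L * y s), sq_nonneg (v s + L * y s)]
      rw [h1, zero_add]
      exact mul_le_mul hLΛ.le h2 (abs_nonneg _) (by linarith)
    · rw [sub_zero]
      positivity
  · have hL1 : 1 ≤ L := hΛ.trans hLΛ
    have hLA := hA hL1
    have hApos : 0 < A := by linarith
    obtain ⟨a, rfl⟩ : ∃ a, A = a / δ := ⟨A * δ, by field_simp⟩
    have haeq : δ * (a / δ) = a := by field_simp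
    rw [haeq] at hc' hv
    have ha : 0 < a := by rw [← haeq]; positivity
    have hLa : L / a ≤ 1 / δ := by
      rw [div_le_div_iff₀ ha hδ, one_mul]
      rwa [le_div_iff₀ hδ] at hLA
    obtain ⟨Q, hQ⟩ : ∃ Q, Q = |v 0 ^ 2 + a * (y 0 * v 0)| := ⟨_, rfl⟩
    have hQ0 : 0 ≤ Q := hQ ▸ abs_nonneg _
    have hQ1 : 2 * L ^ 2 * Q / a ^ 2 ≤
        (2 / δ ^ 2 + 1 / δ) * (v 0 ^ 2 + L ^ 2 * y 0 ^ 2) := by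
      obtain ⟨r, hr⟩ : ∃ r, r = L / a := ⟨_, rfl⟩
      have hr0 : 0 ≤ r := by rw [hr]; positivity
      have hra : r * a = L := by rw [hr]; field_simp
      have h1 : 2 * L ^ 2 * Q / a ^ 2 = |2 * (r ^ 2 * v 0 ^ 2) + r * (2 * (L * y 0 * v 0))| := by
        rw [show 2 * (r ^ 2 * v 0 ^ 2) + r * (2 * (L * y 0 * v 0))
          = 2 * r ^ 2 * (v 0 ^ 2 + a * (y 0 * v 0)) by rw [← hra]; ring, abs_mul, ← hQ,
          abs_of_nonneg (by positivity), hr]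
        ring
      have h2 : |2 * (L * y 0 * v 0)| ≤ v 0 ^ 2 + L ^ 2 * y 0 ^ 2 := by
        rw [abs_le]
        constructor <;> nlinarith [sq_nonneg (v 0 - L * y 0), sq_nonneg (v 0 + L * y 0)]
      have h3 : |r * (2 * (L * y 0 * v 0))| ≤ 1 / δ * (v 0 ^ 2 + L ^ 2 * y 0 ^ 2) := by
        rw [abs_mul, abs_of_nonneg hr0]
        exact mul_le_mul (hr ▸ hLa) h2 (abs_nonneg _) (by positivity)
      have h4 : |2 * (r ^ 2 * v 0 ^ 2)| ≤ 2 / δ ^ 2 * (v 0 ^ 2 + L ^ 2 * y 0 ^ 2) := by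
        rw [abs_of_nonneg (by positivity)]
        have h5 : r ^ 2 ≤ (1 / δ) ^ 2 := pow_le_pow_left₀ hr0 (hr ▸ hLa) 2
        have h6 : v 0 ^ 2 ≤ v 0 ^ 2 + L ^ 2 * y 0 ^ 2 := by
          have : 0 ≤ L ^ 2 * y 0 ^ 2 := by positivity
          linarith
        calc 2 * (r ^ 2 * v 0 ^ 2) ≤ 2 * ((1 / δ) ^ 2 * (v 0 ^ 2 + L ^ 2 * y 0 ^ 2)) := by gcongr
          _ = _ := by ring
      rw [h1]
      calc _ ≤ _ := abs_add_le _ _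
        _ ≤ _ := add_le_add h4 h3
        _ = _ := by ring
    refine ⟨fun s => -(2 * L ^ 2 * Q / a ^ 2) * Real.exp (-(2 * a) * s) + -(L ^ 2) * y s ^ 2, _,
      fun s hs => (((((hasDerivAt_id s).const_mul (-(2 * a))).exp).hasDerivWithinAt).const_mul
        _).add (((hy s hs).pow 2).const_mul _), fun s hs => ?_, fun s => ?_⟩
    · have hdec := overdamped_decay ha (b := fun s => c s * L ^ 2)
        (fun s hs => ⟨mul_nonneg (hc s hs) (sq_nonneg _), hc' hLΛ s hs⟩) hy hv hs
      have h1 : a * (y s * v s) ≤ Q * Real.exp (-(2 * a) * s) := by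
        have : (v 0 ^ 2 + a * (y 0 * v 0)) * Real.exp (-(2 * a * s))
            ≤ Q * Real.exp (-(2 * a * s)) := by
          gcongr
          rw [hQ]; exact le_abs_self _
        rw [neg_mul]
        nlinarith [sq_nonneg (v s)]
      have h2 : y s * v s ≤ Q * Real.exp (-(2 * a) * s) / a := by
        rwa [le_div_iff₀ ha, mul_comm]
      have h3 : 0 ≤ Q * Real.exp (-(2 * a) * s) / a := by positivity
      have h4 : |y s * v s| ≤ 2 * (Q * Real.exp (-(2 * a) * s) / a) - y s * v s := by
        rw [abs_le]
        constructor <;> linarith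
      have h5 : 0 ≤ Λ * (L ^ 2 * y s ^ 2 + v s ^ 2) := by positivity
      rw [abs_mul, abs_of_nonneg (by positivity : 0 ≤ 2 * L ^ 2)]
      have h6 := mul_le_mul_of_nonneg_left h4 (by positivity : 0 ≤ 2 * L ^ 2)
      refine h6.trans ((le_of_eq ?_).trans (le_add_of_nonneg_right h5))
      simp only [id]
      push_cast
      field_simp
      ring
    · have h1 : 0 ≤ 2 * L ^ 2 * Q / a ^ 2 * Real.exp (-(2 * a) * s) := by positivity
      have h2 : 0 ≤ L ^ 2 * y s ^ 2 := by positivity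
      simp only [mul_zero, Real.exp_zero, mul_one]
      nlinarith [sq_nonneg (v 0)]

end Mode

/-- Energy inequality for a finite truncation, in which the coefficient `c` is uniformly close to
the value of `m` at the truncated sum. -/
lemma truncated_energy_le {T : ℝ} (S : Finset ℕ) {f f' ψ ψ' g g' : ℕ → ℝ → ℝ} {c m : ℝ → ℝ}
    {ε R : ℝ} (hm : Continuous m) (hm0 : ∀ x, 0 ≤ m x) (hε : 0 ≤ ε)
    (hf : ∀ k, ∀ t ∈ Icc (0:ℝ) T, HasDerivWithinAt (f k) (f' k t) (Icc 0 T) t)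
    (hf0 : ∀ k t, 0 ≤ f k t)
    (hψ : ∀ k, ∀ t ∈ Icc (0:ℝ) T, HasDerivWithinAt (ψ k) (ψ' k t) (Icc 0 T) t)
    (hψ' : ∀ k, ∀ t ∈ Icc (0:ℝ) T, ψ' k t ≤ ψ k t - c t * f' k t)
    (hg : ∀ k, ∀ t ∈ Icc (0:ℝ) T, HasDerivWithinAt (g k) (g' k t) (Icc 0 T) t)
    (hg' : ∀ t ∈ Icc (0:ℝ) T, |∑ k ∈ S, f' k t| ≤ ∑ k ∈ S, g' k t + R)
    (hc : ∀ t ∈ Icc (0:ℝ) T, |m (∑ k ∈ S, f k t) - c t| ≤ ε)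
    {t : ℝ} (ht : t ∈ Icc (0:ℝ) T) :
    ∑ k ∈ S, ψ k t ≤ (∑ k ∈ S, ψ k 0 + (∫ s in (0:ℝ)..(∑ k ∈ S, f k 0), m s)
      + ε * (∑ k ∈ S, (g k t - g k 0) + R * t)) * Real.exp t := by
  have hM : ∀ x, HasDerivAt (fun x => ∫ s in (0:ℝ)..x, m s) (m x) x := fun x =>
    intervalIntegral.integral_hasDerivAt_right (hm.intervalIntegrable _ _)
      hm.aestronglyMeasurable.stronglyMeasurableAtFilter hm.continuousAt
  have hM0 : ∀ x, 0 ≤ x → 0 ≤ ∫ s in (0:ℝ)..x, m s := fun x hx =>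
    intervalIntegral.integral_nonneg hx fun s _ => hm0 s
  have key := le_initial_of_hasDerivWithinAt_nonpos (T := T)
    (f := fun s => (∑ k ∈ S, ψ k s + ∫ r in (0:ℝ)..(∑ k ∈ S, f k s), m r) * Real.exp (-s)
      - ε * (∑ k ∈ S, g k s + R * s))
    (f' := fun s => (∑ k ∈ S, ψ' k s + m (∑ k ∈ S, f k s) * ∑ k ∈ S, f' k s) * Real.exp (-s)
      + (∑ k ∈ S, ψ k s + ∫ r in (0:ℝ)..(∑ k ∈ S, f k s), m r) * (Real.exp (-s) * (-1))
      - ε * (∑ k ∈ S, g' k s + R * 1))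
    (fun s hs => by
      have h1 : HasDerivWithinAt (fun s => ∑ k ∈ S, f k s) (∑ k ∈ S, f' k s) (Icc 0 T) s :=
        HasDerivWithinAt.fun_sum fun k _ => hf k s hs
      have h2 : HasDerivWithinAt (fun s => ∑ k ∈ S, ψ k s) (∑ k ∈ S, ψ' k s) (Icc 0 T) s :=
        HasDerivWithinAt.fun_sum fun k _ => hψ k s hs
      have h3 : HasDerivWithinAt (fun s => ∑ k ∈ S, g k s) (∑ k ∈ S, g' k s) (Icc 0 T) s :=
        HasDerivWithinAt.fun_sum fun k _ => hg k s hs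
      have h4 : HasDerivWithinAt (fun s => Real.exp (-s)) (Real.exp (-s) * (-1)) (Icc 0 T) s :=
        (hasDerivAt_neg s).exp.hasDerivWithinAt
      have h5 := (hM (∑ k ∈ S, f k s)).comp_hasDerivWithinAt s h1
      exact ((h2.add h5).mul h4).sub
        ((h3.add ((hasDerivWithinAt_id s _).const_mul R)).const_mul ε))
    (fun s hs => by
      have h1 : ∑ k ∈ S, ψ' k s ≤ ∑ k ∈ S, ψ k s - c s * ∑ k ∈ S, f' k s := by
        rw [Finset.mul_sum, ← Finset.sum_sub_distrib]
        exact Finset.sum_le_sum fun k _ => hψ' k s hs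
      have h2 := hM0 _ (Finset.sum_nonneg fun k (_ : k ∈ S) => hf0 k s)
      have h3 : (m (∑ k ∈ S, f k s) - c s) * ∑ k ∈ S, f' k s
          ≤ ε * (∑ k ∈ S, g' k s + R) := by
        refine (le_abs_self _).trans ?_
        rw [abs_mul]
        exact mul_le_mul (hc s hs) (hg' s hs) (abs_nonneg _) hε
      have h4 : 0 ≤ ε * (∑ k ∈ S, g' k s + R) :=
        mul_nonneg hε ((abs_nonneg _).trans (hg' s hs))
      have h5 : Real.exp (-s) ≤ 1 := Real.exp_le_one_iff.2 (by linarith [hs.1])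
      have h6 : (∑ k ∈ S, ψ' k s + m (∑ k ∈ S, f k s) * ∑ k ∈ S, f' k s
          - (∑ k ∈ S, ψ k s + ∫ r in (0:ℝ)..(∑ k ∈ S, f k s), m r)) * Real.exp (-s)
          ≤ ε * (∑ k ∈ S, g' k s + R) * Real.exp (-s) := by
        gcongr
        linarith
      have h7 := mul_le_of_le_one_right h4 h5
      linarith) ht
  have h1 := hM0 _ (Finset.sum_nonneg fun k (_ : k ∈ S) => hf0 k t)
  simp only [neg_zero, Real.exp_zero, mul_one, mul_zero, add_zero] at key
  have h2 : (∑ k ∈ S, ψ k t) * Real.exp (-t) ≤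
      (∑ k ∈ S, ψ k t + ∫ r in (0:ℝ)..(∑ k ∈ S, f k t), m r) * Real.exp (-t) := by
    gcongr
    linarith
  rw [← div_le_iff₀ (Real.exp_pos t), div_eq_mul_inv, ← Real.exp_neg, Finset.sum_sub_distrib]
  linarith

/-- If `2σ > 1`, the overdamping condition `c λ² ≤ (δ λ^{2σ})²` holds at high frequencies. -/
lemma exists_overdamping_threshold {σ δ : ℝ} (hσ : 1 / 2 < σ) (hδ : 0 < δ) (C : ℝ) :
    ∃ Λ : ℝ, 1 ≤ Λ ∧ ∀ L, Λ ≤ L → C * L ^ 2 ≤ (δ * L ^ (2 * σ)) ^ 2 := by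
  have h := (tendsto_rpow_atTop (show 0 < 2 * (2 * σ - 1) by linarith)).eventually_ge_atTop
    (C / δ ^ 2)
  obtain ⟨Λ, hΛ⟩ := eventually_atTop.1 h
  refine ⟨max 1 Λ, le_max_left _ _, fun L hL => ?_⟩
  have hL0 : 0 < L := lt_of_lt_of_le one_pos ((le_max_left _ _).trans hL)
  have h1 := hΛ L ((le_max_right _ _).trans hL)
  rw [div_le_iff₀ (by positivity)] at h1
  have h2 : (L ^ (2 * σ)) ^ 2 = L ^ (2 * (2 * σ - 1)) * L ^ 2 := by
    rw [← Real.rpow_natCast (L ^ (2 * σ)), ← Real.rpow_mul hL0.le, ← Real.rpow_natCast L,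
      ← Real.rpow_add hL0]
    congr 1
    push_cast
    ring
  calc C * L ^ 2 ≤ L ^ (2 * (2 * σ - 1)) * δ ^ 2 * L ^ 2 := by gcongr
    _ = (δ * L ^ (2 * σ)) ^ 2 := by rw [mul_pow, h2]; ring

/-- A sequence of continuous nonnegative functions whose sum is continuous on a compact set has
partial sums that stay uniformly close to the sum after composition with a continuous function. -/
lemma eventually_abs_comp_partialSum_sub_le {K : Set ℝ} (hK : IsCompact K) {f : ℕ → ℝ → ℝ}
    {m : ℝ → ℝ} (hm : Continuous m) (hf : ∀ k, ContinuousOn (f k) K) (hf0 : ∀ k t, 0 ≤ f k t)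
    (hsum : ∀ t ∈ K, Summable fun k => f k t)
    (hF : ContinuousOn (fun t => ∑' k, f k t) K) {ε : ℝ} (hε : 0 < ε) :
    ∀ᶠ n in atTop, ∀ t ∈ K,
      |m (∑ k ∈ Finset.range n, f k t) - m (∑' k, f k t)| ≤ ε := by
  obtain ⟨B, hB⟩ := hK.bddAbove_image hF
  have hle : ∀ n : ℕ, ∀ t ∈ K, ∑ k ∈ Finset.range n, f k t ≤ ∑' k, f k t := fun n t ht =>
    (hsum t ht).sum_le_tsum _ fun k _ => hf0 k t
  have hB' : ∀ t ∈ K, ∑' k, f k t ≤ B := fun t ht => hB (mem_image_of_mem _ ht)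
  have h1 : TendstoUniformlyOn (fun (n : ℕ) t => ∑ k ∈ Finset.range n, f k t)
      (fun t => ∑' k, f k t) atTop K :=
    Monotone.tendstoUniformlyOn_of_forall_tendsto hK
      (fun n => continuousOn_finsetSum _ fun k _ => hf k)
      (fun t _ => monotone_nat_of_le_succ fun n => by
        rw [Finset.sum_range_succ]; exact le_add_of_nonneg_right (hf0 _ _))
      hF (fun t ht => (hsum t ht).hasSum.tendsto_sum_nat)
  have hu : UniformContinuousOn m (Icc 0 B) :=
    isCompact_Icc.uniformContinuousOn_of_continuous hm.continuousOn
  have h2 := UniformContinuousOn.comp_tendstoUniformlyOn_eventually (s := Icc 0 B)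
    (.of_forall fun n t ht => ⟨Finset.sum_nonneg fun k _ => hf0 k t, (hle n t ht).trans (hB' t ht)⟩)
    (fun t ht => ⟨tsum_nonneg fun k => hf0 k t, hB' t ht⟩) hu h1
  filter_upwards [Metric.tendstoUniformlyOn_iff.1 h2 ε hε] with n hn t ht
  rw [abs_sub_comm, ← Real.dist_eq]
  exact (hn t ht).le

lemma IsKirchhoffSol.tsum_le_of_continuous {δ σ T : ℝ} (hδ : 0 < δ) (hσ : 1 / 2 < σ) (hT : 0 < T)
    {lam : ℕ → ℝ} (hlam : ∀ k, 0 ≤ lam k) {m : ℝ → ℝ} (hm : Continuous m) (hm0 : ∀ x, 0 ≤ m x)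
    {u0 u1 : ℕ → ℝ} (hu0 : Summable fun k => u0 k ^ 2)
    (hlu0 : Summable fun k => lam k ^ 2 * u0 k ^ 2) (hu1 : Summable fun k => u1 k ^ 2)
    {u : ℕ → ℝ → ℝ} (hu : IsKirchhoffSol lam m σ δ (Icc 0 T) u0 u1 u) {t : ℝ}
    (ht : t ∈ Icc (0:ℝ) T) :
    (∑' k, lam k ^ 2 * u k t ^ 2) ≤ (2 + 3 * δ ^ 2) / min (δ ^ 2) 1 *
      ((∑' k, u1 k ^ 2) + (∑' k, u0 k ^ 2) + (∑' k, lam k ^ 2 * u0 k ^ 2) +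
        ∫ s in (0:ℝ)..(∑' k, lam k ^ 2 * u0 k ^ 2), m s) * Real.exp t := by
  obtain ⟨hC2, hinit, hinit', hode, -, hLu, hv2⟩ := hu
  obtain ⟨v, hv⟩ : ∃ v : ℕ → ℝ → ℝ, v = fun k => derivWithin (u k) (Icc 0 T) := ⟨_, rfl⟩
  have hvk : ∀ k, derivWithin (u k) (Icc 0 T) = v k := fun k => by rw [hv]
  simp only [hvk] at hinit' hode hv2
  have hmul : ∀ t k, (lam k * u k t) ^ 2 = lam k ^ 2 * u k t ^ 2 := fun t k => mul_pow _ _ _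
  have hFs := hLu.1
  have hFc := hLu.continuousOn_tsum_sq
  simp only [hmul] at hFs hFc
  have hVs := hv2.1
  have hVc := hv2.continuousOn_tsum_sq
  obtain ⟨F, hFdef⟩ : ∃ F : ℝ → ℝ, F = fun t => ∑' k, lam k ^ 2 * u k t ^ 2 := ⟨_, rfl⟩
  have hFt : ∀ t, ∑' k, lam k ^ 2 * u k t ^ 2 = F t := fun t => by rw [hFdef]
  have huniq : UniqueDiffOn ℝ (Icc (0:ℝ) T) := uniqueDiffOn_Icc hT
  have hy : ∀ k, ∀ t ∈ Icc (0:ℝ) T, HasDerivWithinAt (u k) (v k t) (Icc 0 T) t := fun k t ht =>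
    hvk k ▸ ((hC2 k).differentiableOn (by norm_num) t ht).hasDerivWithinAt
  have hvd : ∀ k, ∀ t ∈ Icc (0:ℝ) T, HasDerivWithinAt (v k)
      (-(2 * (δ * lam k ^ (2 * σ)) * v k t) - m (F t) * lam k ^ 2 * u k t) (Icc 0 T) t := by
    intro k t ht
    have h1 : ContDiffOn ℝ 1 (v k) (Icc 0 T) :=
      hvk k ▸ (hC2 k).derivWithin huniq (by norm_num)
    refine (h1.differentiableOn (by norm_num) t ht).hasDerivWithinAt.congr_deriv ?_
    have := hode k t ht
    rw [hFt] at this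
    linarith
  obtain ⟨C, hC⟩ := isCompact_Icc.bddAbove_image
    (hm.comp_continuousOn (hFdef ▸ hFc : ContinuousOn F (Icc 0 T)))
  obtain ⟨B, hB⟩ := isCompact_Icc.bddAbove_image (hFc.add hVc)
  obtain ⟨Λ, hΛ1, hΛ⟩ := exists_overdamping_threshold hσ hδ C
  have hA : ∀ k, 1 ≤ lam k → lam k ≤ lam k ^ (2 * σ) := fun k hk => by
    simpa using Real.rpow_le_rpow_of_exponent_le hk (by linarith : (1:ℝ) ≤ 2 * σ)
  choose ψ ψ' hψ hψ' hψlow hψ0 using fun k => exists_mode_energy hδ (hlam k)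
    (Real.rpow_nonneg (hlam k) _) (hA k) (fun t _ => hm0 (F t)) (hy k) (hvd k)
  choose g g' hg hg' hgV using fun k => exists_mode_variation hΛ1 hδ (hlam k) (hA k)
    (fun t _ => hm0 (F t)) (fun hk t ht => (mul_le_mul_of_nonneg_right
      (hC (mem_image_of_mem _ ht)) (sq_nonneg _)).trans (hΛ _ hk)) (hy k) (hvd k)
  simp only [hinit, hinit'] at hψ0 hgV
  obtain ⟨I0, hI0⟩ : ∃ I0, I0 = ∫ s in (0:ℝ)..(∑' k, lam k ^ 2 * u0 k ^ 2), m s := ⟨_, rfl⟩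
  obtain ⟨D, hD⟩ : ∃ D, D = (∑' k, u1 k ^ 2) + (∑' k, u0 k ^ 2)
    + (∑' k, lam k ^ 2 * u0 k ^ 2) := ⟨_, rfl⟩
  obtain ⟨V, hVdef⟩ : ∃ V, V = (2 / δ ^ 2 + 1 / δ + 1) *
    ((∑' k, u1 k ^ 2) + ∑' k, lam k ^ 2 * u0 k ^ 2) + Λ * B * t := ⟨_, rfl⟩
  have hlu0nn : ∀ k, 0 ≤ lam k ^ 2 * u0 k ^ 2 := fun k => by positivity
  have hI0nn : 0 ≤ I0 := hI0 ▸
    intervalIntegral.integral_nonneg (tsum_nonneg hlu0nn) fun s _ => hm0 s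
  have hf0 : ∀ k t, 0 ≤ lam k ^ 2 * u k t ^ 2 := fun k t => by positivity
  have hf : ∀ k, ∀ t ∈ Icc (0:ℝ) T, HasDerivWithinAt (fun t => lam k ^ 2 * u k t ^ 2)
      (2 * lam k ^ 2 * (u k t * v k t)) (Icc 0 T) t := fun k t ht =>
    (((hy k t ht).pow 2).const_mul (lam k ^ 2)).congr_deriv (by push_cast; ring)
  have hmin : 0 < min (δ ^ 2) 1 := lt_min (by positivity) one_pos
  have happrox : ∀ ε > 0, min (δ ^ 2) 1 * F t ≤
      ((2 + 3 * δ ^ 2) * D + I0 + ε * V) * Real.exp t := by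
    intro ε hε
    have hlim : Tendsto (fun n : ℕ => min (δ ^ 2) 1 * ∑ k ∈ Finset.range n, lam k ^ 2 * u k t ^ 2)
        atTop (𝓝 (min (δ ^ 2) 1 * F t)) :=
      (hFt t ▸ (hFs t ht).hasSum.tendsto_sum_nat).const_mul _
    refine le_of_tendsto hlim ?_
    filter_upwards [eventually_abs_comp_partialSum_sub_le isCompact_Icc hm
      (fun k t ht => (hf k t ht).continuousWithinAt) hf0 hFs hFc hε] with n hn
    have hkey := truncated_energy_le (T := T) (Finset.range n) (R := Λ * B)
      (c := fun t => m (F t)) hm hm0 hε.le hf hf0 hψ hψ' hg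
      (fun s hs => by
        have h1 : ∑ k ∈ Finset.range n, (lam k ^ 2 * u k s ^ 2 + v k s ^ 2) ≤ B := by
          rw [Finset.sum_add_distrib]
          exact (add_le_add ((hFs s hs).sum_le_tsum _ fun k _ => hf0 k s)
            ((hVs s hs).sum_le_tsum _ fun k _ => sq_nonneg _)).trans
            (hB (mem_image_of_mem _ hs))
        calc _ ≤ ∑ k ∈ Finset.range n, |2 * lam k ^ 2 * (u k s * v k s)| :=
              Finset.abs_sum_le_sum_abs _ _
          _ ≤ ∑ k ∈ Finset.range n, (g' k s + Λ * (lam k ^ 2 * u k s ^ 2 + v k s ^ 2)) :=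
              Finset.sum_le_sum fun k _ => hg' k s hs
          _ = ∑ k ∈ Finset.range n, g' k s
                + Λ * ∑ k ∈ Finset.range n, (lam k ^ 2 * u k s ^ 2 + v k s ^ 2) := by
              rw [Finset.sum_add_distrib, Finset.mul_sum]
          _ ≤ _ := by gcongr)
      (fun s hs => by simpa only [hFt] using hn s hs) ht
    have h1 : min (δ ^ 2) 1 * ∑ k ∈ Finset.range n, lam k ^ 2 * u k t ^ 2
        ≤ ∑ k ∈ Finset.range n, ψ k t := by
      rw [Finset.mul_sum]
      exact Finset.sum_le_sum fun k _ => hψlow k t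
    have hs1 := hu1.sum_le_tsum (Finset.range n) fun k _ => sq_nonneg _
    have hs2 := hu0.sum_le_tsum (Finset.range n) fun k _ => sq_nonneg _
    have hs3 := hlu0.sum_le_tsum (Finset.range n) fun k _ => hlu0nn k
    have h2 : ∑ k ∈ Finset.range n, ψ k 0 ≤ (2 + 3 * δ ^ 2) * D := by
      refine (Finset.sum_le_sum fun k _ => hψ0 k).trans ?_
      rw [← Finset.mul_sum, Finset.sum_add_distrib, Finset.sum_add_distrib, hD]
      gcongr
    have h3 : ∑ k ∈ Finset.range n, (g k t - g k 0) + Λ * B * t ≤ V := by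
      rw [hVdef]
      gcongr
      refine (Finset.sum_le_sum fun k _ => hgV k t).trans ?_
      rw [← Finset.mul_sum, Finset.sum_add_distrib]
      gcongr
    have h4 : ∫ s in (0:ℝ)..(∑ k ∈ Finset.range n, lam k ^ 2 * u k 0 ^ 2), m s ≤ I0 := by
      rw [hI0]
      simp only [hinit]
      exact intervalIntegral.integral_mono_interval le_rfl
        (Finset.sum_nonneg fun k _ => hlu0nn k) hs3 (.of_forall fun s => hm0 s)
        (hm.intervalIntegrable _ _)
    refine (h1.trans hkey).trans ?_
    gcongr
  have hlim : Tendsto (fun ε : ℝ => ((2 + 3 * δ ^ 2) * D + I0 + ε * V) * Real.exp t) (𝓝[>] 0)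
      (𝓝 (((2 + 3 * δ ^ 2) * D + I0 + 0 * V) * Real.exp t)) :=
    (Continuous.tendsto (by fun_prop) 0).mono_left nhdsWithin_le_nhds
  have hfin := ge_of_tendsto hlim (eventually_mem_nhdsWithin.mono fun ε hε => happrox ε hε)
  rw [hFt, ← hI0, ← hD, div_mul_eq_mul_div, div_mul_eq_mul_div, le_div_iff₀ hmin, mul_comm]
  refine hfin.trans ?_
  gcongr
  nlinarith [mul_nonneg (sq_nonneg δ) hI0nn]

/-- A priori bound in the supercritical case: `|A^{1/2}u(t)|²` grows at most
exponentially, with constants depending only on `δ`.  Here `M(x) = ∫₀ˣ m(s) ds`. -/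
theorem apriori_bound_supercritical (δ : ℝ) (hδ : 0 < δ) :
    ∃ K₃ > (0:ℝ), ∃ K₄ > (0:ℝ),
      ∀ lam : ℕ → ℝ, (∀ k, 0 ≤ lam k) →
      ∀ m : ℝ → ℝ, ContinuousOn m (Ici 0) → (∀ x : ℝ, 0 ≤ x → 0 ≤ m x) →
      ∀ σ : ℝ, 1 / 2 < σ →
      ∀ T : ℝ, 0 < T →
      ∀ u0 u1 : ℕ → ℝ,
        (Summable fun k => u0 k ^ 2) →
        (Summable fun k => lam k ^ 2 * u0 k ^ 2) →
        (Summable fun k => u1 k ^ 2) →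
      ∀ u : ℕ → ℝ → ℝ, IsKirchhoffSol lam m σ δ (Icc 0 T) u0 u1 u →
      ∀ t ∈ Icc (0:ℝ) T,
        (∑' k, lam k ^ 2 * u k t ^ 2) ≤
          K₃ * ((∑' k, u1 k ^ 2) + (∑' k, u0 k ^ 2) + (∑' k, lam k ^ 2 * u0 k ^ 2) +
              ∫ s in (0:ℝ)..(∑' k, lam k ^ 2 * u0 k ^ 2), m s) *
            Real.exp (K₄ * t) := by
  refine ⟨(2 + 3 * δ ^ 2) / min (δ ^ 2) 1,
    div_pos (by positivity) (lt_min (by positivity) one_pos), 1, one_pos, ?_⟩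
  intro lam hlam m hm hm0 σ hσ T hT u0 u1 hu0 hlu0 hu1 u hu t ht
  have hpos : ∀ w : ℕ → ℝ, 0 ≤ ∑' k, lam k ^ 2 * w k ^ 2 := fun w =>
    tsum_nonneg fun k => by positivity
  have hext : ∀ x, 0 ≤ x → m (max x 0) = m x := fun x hx => by rw [max_eq_left hx]
  have hsol : IsKirchhoffSol lam (fun x => m (max x 0)) σ δ (Icc 0 T) u0 u1 u := by
    obtain ⟨h1, h2, h3, h4, h5⟩ := hu
    refine ⟨h1, h2, h3, fun k s hs => ?_, h5⟩
    simp only [hext _ (hpos fun k => u k s)]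
    exact h4 k s hs
  have h := hsol.tsum_le_of_continuous hδ hσ hT hlam
    (hm.comp_continuous (continuous_id.max continuous_const) fun x =>
      mem_Ici.2 (le_max_right _ _))
    (fun x => hm0 _ (le_max_right _ _)) hu0 hlu0 hu1 ht
  rw [intervalIntegral.integral_congr (g := m) fun s hs => ?_] at h
  · rwa [one_mul]
  · rw [uIcc_of_le (hpos u0)] at hs
    exact hext s hs.1
end
end

section
/- Let λ : ℕ → [0,∞) be a sequence, let m : [0,∞) → [0,∞) be continuous, let σ > 1/2 and δ > 0 be real numbers, and let (u⁰,u¹) ∈ V_{ω_d} for some continuity modulus ω_d. Then there exists a global solution u on [0,+∞) of the Kirchhoff equation u'' + 2δ A^σ u' + m(|A^{1/2}u|²) A u = 0 with initial data (u⁰,u¹), belonging to C⁰([0,+∞), D(A^{1/2})) ∩ C¹([0,+∞), H), such that moreover (u(t),u'(t)) ∈ V_{ω_d} for every t ≥ 0 and the curves t ↦ ((ω_d(1/λ_k))^{−1/2} λ_k u_k(t))_{k : λ_k>0} and t ↦ ((ω_d(1/λ_k))^{−1/2} u_k'(t))_{k : λ_k>0} are continuous with values in ℓ². -/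
open Set Filter MeasureTheory Topology

noncomputable section

/-- The curve `t ↦ (u(t), u'(t))` lies in `V_{ωd}` for every `t ∈ I` and the weighted
curves `t ↦ ((ωd(1/λ_k))^{-1/2} λ_k u_k(t))_k` and `t ↦ ((ωd(1/λ_k))^{-1/2} u_k'(t))_k`
(over `k` with `λ_k > 0`) are continuous with values in `ℓ²`. -/
def VRegCurves (lam : ℕ → ℝ) (ωd : ℝ → ℝ) (I : Set ℝ) (u : ℕ → ℝ → ℝ) : Prop :=
  (∀ t ∈ I, Summable (Vsum lam ωd (fun k => u k t) (fun k => derivWithin (u k) I t))) ∧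
  L2Cont I (fun t k =>
    if 0 < lam k then lam k * u k t / Real.sqrt (ωd (1 / lam k)) else 0) ∧
  L2Cont I (fun t k =>
    if 0 < lam k then derivWithin (u k) I t / Real.sqrt (ωd (1 / lam k)) else 0)


/-! ### Differential inequalities and global solutions of truncated vector fields -/

theorem le_initial_of_deriv_nonpos {f f' : ℝ → ℝ} {T : ℝ}
    (hf : ∀ t ∈ Icc 0 T, HasDerivWithinAt f (f' t) (Icc 0 T) t)
    (hf' : ∀ t ∈ Icc 0 T, f' t ≤ 0) {t : ℝ} (ht : t ∈ Icc 0 T) : f t ≤ f 0 := by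
  have hd : ∀ x ∈ interior (Icc (0:ℝ) T), HasDerivAt f (f' x) x := fun x hx =>
    (hf x (interior_subset hx)).hasDerivAt (mem_interior_iff_mem_nhds.1 hx)
  refine antitoneOn_of_deriv_nonpos (convex_Icc 0 T)
    (fun x hx => (hf x hx).continuousWithinAt)
    (fun x hx => (hd x hx).differentiableAt.differentiableWithinAt)
    (fun x hx => ?_) ⟨le_rfl, ht.1.trans ht.2⟩ ht ht.1
  rw [(hd x hx).deriv]
  exact hf' x (interior_subset hx)

theorem le_exp_mul_of_deriv_le {f f' : ℝ → ℝ} {T K : ℝ}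
    (hf : ∀ t ∈ Icc 0 T, HasDerivWithinAt f (f' t) (Icc 0 T) t)
    (hf' : ∀ t ∈ Icc 0 T, f' t ≤ K * f t) {t : ℝ} (ht : t ∈ Icc 0 T) :
    f t ≤ Real.exp (K * t) * f 0 := by
  have h := le_initial_of_deriv_nonpos (f := fun s => Real.exp (-(K * s)) * f s)
    (f' := fun s => Real.exp (-(K * s)) * (f' s - K * f s)) (T := T) ?_ ?_ ht
  · simp only [mul_zero, neg_zero, Real.exp_zero, one_mul] at h
    calc f t = Real.exp (K * t) * (Real.exp (-(K * t)) * f t) := by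
          rw [← mul_assoc, ← Real.exp_add]; simp
      _ ≤ _ := by gcongr
  · intro s hs
    have h1 : HasDerivWithinAt (fun s => Real.exp (-(K * s))) (Real.exp (-(K * s)) * (-(K * 1)))
        (Icc 0 T) s := ((((hasDerivAt_id s).const_mul K).neg).exp).hasDerivWithinAt
    refine (h1.mul (hf s hs)).congr_deriv ?_
    ring
  · intro s hs
    exact mul_nonpos_of_nonneg_of_nonpos (Real.exp_pos _).le (sub_nonpos.2 (hf' s hs))

theorem exists_solution_of_contDiff_of_hasCompactSupport {E : Type*} [NormedAddCommGroup E]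
    [NormedSpace ℝ E] [CompleteSpace E] {F : E → E} (hF : ContDiff ℝ 1 F)
    (hc : HasCompactSupport F) (y₀ : E) {T : ℝ} (hT : 0 ≤ T) :
    ∃ y : ℝ → E, y 0 = y₀ ∧ ∀ t ∈ Icc 0 T, HasDerivWithinAt y (F (y t)) (Icc 0 T) t := by
  obtain ⟨K, hK⟩ := ContDiff.lipschitzWith_of_hasCompactSupport hc hF (by simp)
  obtain ⟨L, hL⟩ := hF.continuous.bounded_above_of_compact_support hc
  have hPL : IsPicardLindelof (fun _ => F) (tmin := 0) (tmax := T) ⟨0, le_rfl, hT⟩ y₀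
      (L.toNNReal * T.toNNReal) 0 L.toNNReal K := by
    refine IsPicardLindelof.of_time_independent (fun x _ => (hL x).trans (Real.le_coe_toNNReal L))
      hK.lipschitzOnWith ?_
    simp [hT]
  exact hPL.exists_eq_forall_mem_Icc_hasDerivWithinAt₀

/-! ### Finite-dimensional Kirchhoff systems -/

section Finite

variable {ι : Type*} [Fintype ι]

theorem hasDerivWithinAt_energy {lam p : ι → ℝ} {δ : ℝ} {c M : ℝ → ℝ}
    (hM : ∀ s, HasDerivAt M (c s) s) {x v : ι → ℝ → ℝ} {θ : ℝ} {I : Set ℝ} {t : ℝ}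
    (hx : ∀ k, HasDerivWithinAt (x k) (θ * v k t) I t)
    (hv : ∀ k, HasDerivWithinAt (v k)
      (θ * (-(2 * δ * p k * v k t) - c (∑ j, lam j ^ 2 * x j t ^ 2) * lam k ^ 2 * x k t)) I t) :
    HasDerivWithinAt (fun s => ∑ k, v k s ^ 2 + M (∑ j, lam j ^ 2 * x j s ^ 2))
      (-(4 * δ * θ * ∑ k, p k * v k t ^ 2)) I t := by
  have h1 : HasDerivWithinAt (fun s => ∑ k, v k s ^ 2) (∑ k, 2 * v k t * (θ *
      (-(2 * δ * p k * v k t) - c (∑ j, lam j ^ 2 * x j t ^ 2) * lam k ^ 2 * x k t))) I t :=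
    HasDerivWithinAt.fun_sum fun k _ => ((hv k).pow 2).congr_deriv (by simp)
  have h2 : HasDerivWithinAt (fun s => ∑ j, lam j ^ 2 * x j s ^ 2)
      (∑ j, lam j ^ 2 * (2 * x j t * (θ * v j t))) I t :=
    HasDerivWithinAt.fun_sum fun k _ =>
      (((hx k).pow 2).const_mul (lam k ^ 2)).congr_deriv (by simp)
  refine (h1.add ((hM _).comp_hasDerivWithinAt t h2)).congr_deriv ?_
  rw [Finset.mul_sum, Finset.mul_sum, ← Finset.sum_add_distrib, ← Finset.sum_neg_distrib]
  exact Finset.sum_congr rfl fun k _ => by ring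

theorem nonneg_of_deriv_nonneg {c M : ℝ → ℝ} (hc : ∀ s, 0 ≤ c s)
    (hM : ∀ s, HasDerivAt M (c s) s) (hM0 : M 0 = 0) {s : ℝ} (hs : 0 ≤ s) : 0 ≤ M s := by
  rw [← hM0]
  exact monotone_of_deriv_nonneg (fun s => (hM s).differentiableAt)
    (fun s => by rw [(hM s).deriv]; exact hc s) hs

/-- Along a solution slowed down by a factor `θ`, velocities stay below the initial energy. -/
theorem sum_sq_velocity_le {lam p : ι → ℝ} (hp : ∀ k, 0 ≤ p k) {δ : ℝ} (hδ : 0 < δ) {c M : ℝ → ℝ}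
    (hc : ∀ s, 0 ≤ c s) (hM : ∀ s, HasDerivAt M (c s) s) (hM0 : M 0 = 0) {T : ℝ}
    {x v : ι → ℝ → ℝ} {θ : ℝ → ℝ} (hθ : ∀ t, 0 ≤ θ t)
    (hx : ∀ k, ∀ t ∈ Icc 0 T, HasDerivWithinAt (x k) (θ t * v k t) (Icc 0 T) t)
    (hv : ∀ k, ∀ t ∈ Icc 0 T, HasDerivWithinAt (v k)
      (θ t * (-(2 * δ * p k * v k t) - c (∑ j, lam j ^ 2 * x j t ^ 2) * lam k ^ 2 * x k t))
        (Icc 0 T) t) {t : ℝ} (ht : t ∈ Icc 0 T) :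
    ∑ k, v k t ^ 2 ≤ ∑ k, v k 0 ^ 2 + M (∑ j, lam j ^ 2 * x j 0 ^ 2) := by
  have h := le_initial_of_deriv_nonpos (fun t ht => hasDerivWithinAt_energy hM
    (fun k => hx k t ht) (fun k => hv k t ht)) (fun t _ => ?_) ht
  · have : 0 ≤ M (∑ j, lam j ^ 2 * x j t ^ 2) := nonneg_of_deriv_nonneg hc hM hM0 (by positivity)
    linarith
  · have h1 : 0 ≤ ∑ k, p k * v k t ^ 2 :=
      Finset.sum_nonneg fun k _ => mul_nonneg (hp k) (sq_nonneg _)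
    have := hθ t
    have : 0 ≤ 4 * δ * θ t * ∑ k, p k * v k t ^ 2 := by positivity
    linarith

theorem exists_finite_kirchhoff {lam p : ι → ℝ} (hp : ∀ k, 0 ≤ p k) {δ : ℝ} (hδ : 0 < δ)
    {c M : ℝ → ℝ} (hc : ∀ s, 0 ≤ c s) (hcd : ContDiff ℝ 1 c) (hM : ∀ s, HasDerivAt M (c s) s)
    (hM0 : M 0 = 0) (a b : ι → ℝ) {T : ℝ} (hT : 0 ≤ T) :
    ∃ x v : ι → ℝ → ℝ, (∀ k, x k 0 = a k) ∧ (∀ k, v k 0 = b k) ∧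
      (∀ k, ∀ t ∈ Icc 0 T, HasDerivWithinAt (x k) (v k t) (Icc 0 T) t) ∧
      (∀ k, ∀ t ∈ Icc 0 T, HasDerivWithinAt (v k)
        (-(2 * δ * p k * v k t) - c (∑ j, lam j ^ 2 * x j t ^ 2) * lam k ^ 2 * x k t)
        (Icc 0 T) t) := by
  set E₀ : ℝ := ∑ k, b k ^ 2 + M (∑ j, lam j ^ 2 * a j ^ 2) with hE₀
  set ρ : ℝ := ‖a‖ + √E₀ * T + √E₀ + 1 with hρ
  have hρ0 : 0 < ρ := by positivity
  let χ : ContDiffBump (0 : (ι → ℝ) × (ι → ℝ)) := ⟨ρ, ρ + 1, hρ0, by linarith⟩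
  let F : (ι → ℝ) × (ι → ℝ) → (ι → ℝ) × (ι → ℝ) := fun y =>
    χ y • (y.2, fun k => -(2 * δ * p k * y.2 k) -
      c (∑ j, lam j ^ 2 * y.1 j ^ 2) * lam k ^ 2 * y.1 k)
  have hF : ContDiff ℝ 1 F := by
    refine χ.contDiff.smul (contDiff_snd.prodMk (contDiff_pi.2 fun k => ?_))
    have h1 : ∀ j, ContDiff ℝ 1 fun y : (ι → ℝ) × (ι → ℝ) => y.1 j := fun j =>
      (contDiff_apply ℝ ℝ j).comp contDiff_fst
    have h2 : ContDiff ℝ 1 fun y : (ι → ℝ) × (ι → ℝ) => y.2 k :=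
      (contDiff_apply ℝ ℝ k).comp contDiff_snd
    have h3 : ContDiff ℝ 1 fun y : (ι → ℝ) × (ι → ℝ) => ∑ j, lam j ^ 2 * y.1 j ^ 2 :=
      ContDiff.sum fun j _ => contDiff_const.mul ((h1 j).pow 2)
    exact (contDiff_const.mul h2).neg.sub (((hcd.comp h3).mul contDiff_const).mul (h1 k))
  have hFc : HasCompactSupport F := χ.hasCompactSupport.smul_right
  obtain ⟨y, hy0, hy⟩ := exists_solution_of_contDiff_of_hasCompactSupport hF hFc (a, b) hT
  have hx : ∀ k, ∀ t ∈ Icc 0 T, HasDerivWithinAt (fun t => (y t).1 k)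
      (χ (y t) * (y t).2 k) (Icc 0 T) t := fun k t ht =>
    hasDerivWithinAt_pi.1 (hy t ht).fst k
  have hv : ∀ k, ∀ t ∈ Icc 0 T, HasDerivWithinAt (fun t => (y t).2 k)
      (χ (y t) * (-(2 * δ * p k * (y t).2 k) - c (∑ j, lam j ^ 2 * (y t).1 j ^ 2) *
        lam k ^ 2 * (y t).1 k)) (Icc 0 T) t := fun k t ht =>
    hasDerivWithinAt_pi.1 (hy t ht).snd k
  have hvb : ∀ k, ∀ t ∈ Icc 0 T, |(y t).2 k| ≤ √E₀ := fun k t ht => by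
    refine Real.abs_le_sqrt ?_
    have h := sum_sq_velocity_le (x := fun k t => (y t).1 k) (v := fun k t => (y t).2 k)
      (θ := fun t => χ (y t)) hp hδ hc hM hM0 (fun t => χ.nonneg) hx hv ht
    simp only [hy0] at h
    exact (Finset.single_le_sum (f := fun k => (y t).2 k ^ 2) (fun _ _ => sq_nonneg _)
      (Finset.mem_univ k)).trans h
  have hxb : ∀ k, ∀ t ∈ Icc 0 T, |(y t).1 k| ≤ ‖a‖ + √E₀ * T := fun k t ht => by
    have h := norm_image_sub_le_of_norm_deriv_le_segment' (hx k) (C := √E₀) (fun s hs => ?_) t ht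
    · simp only [hy0, Real.norm_eq_abs] at h
      have h1 : |a k| ≤ ‖a‖ := norm_le_pi_norm a k
      have h2 : √E₀ * (t - 0) ≤ √E₀ * T :=
        mul_le_mul_of_nonneg_left (by linarith [ht.2]) (Real.sqrt_nonneg _)
      calc |(y t).1 k| = |a k + ((y t).1 k - a k)| := by ring_nf
        _ ≤ |a k| + |(y t).1 k - a k| := abs_add_le _ _
        _ ≤ _ := by linarith
    · rw [norm_mul, Real.norm_of_nonneg χ.nonneg]
      exact (mul_le_of_le_one_left (norm_nonneg _) χ.le_one).trans (hvb k s (Ico_subset_Icc_self hs))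
  have hone : ∀ t ∈ Icc 0 T, χ (y t) = 1 := fun t ht => by
    refine χ.one_of_mem_closedBall (mem_closedBall_zero_iff.2 ?_)
    have hs := Real.sqrt_nonneg E₀
    have hsT := mul_nonneg hs hT
    have hna := norm_nonneg a
    change ‖y t‖ ≤ ρ
    refine norm_prod_le_iff.2 ⟨(pi_norm_le_iff_of_nonneg hρ0.le).2 fun k => ?_,
      (pi_norm_le_iff_of_nonneg hρ0.le).2 fun k => ?_⟩
    · exact (hxb k t ht).trans (by linarith)
    · exact (hvb k t ht).trans (by linarith)
  refine ⟨fun k t => (y t).1 k, fun k t => (y t).2 k, fun k => by simp [hy0],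
    fun k => by simp [hy0], fun k t ht => ?_, fun k t ht => ?_⟩
  · simpa [hone t ht] using hx k t ht
  · have := hv k t ht
    rwa [hone t ht, one_mul] at this

end Finite

section Apriori

variable {ι : Type*} [Fintype ι]

theorem abs_cross_term_le {l p δ a b : ℝ} (hl : 0 ≤ l) (hlp : l ≤ p) (hp : 0 < p) :
    |4 * δ * (l ^ 2 / p * (a * b))| ≤ 2 * δ ^ 2 * (l ^ 2 * a ^ 2) + 2 * b ^ 2 := by
  obtain ⟨r, hr⟩ : ∃ r, r = l / p := ⟨_, rfl⟩
  have hr0 : 0 ≤ r := hr ▸ div_nonneg hl hp.le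
  have hr1 : r ≤ 1 := hr ▸ (div_le_one hp).2 hlp
  have he : 4 * δ * (l ^ 2 / p * (a * b)) = 4 * r * (δ * l * a) * b := by rw [hr]; ring
  have h1 := mul_nonneg hr0 (sq_nonneg (δ * l * a + b))
  have h2 := mul_nonneg hr0 (sq_nonneg (δ * l * a - b))
  have h3 := mul_nonneg (sub_nonneg.2 hr1) (add_nonneg (sq_nonneg (δ * l * a)) (sq_nonneg b))
  rw [he, abs_le]
  constructor <;> nlinarith

/-- The a priori bound on `∑ λ² x²`: it does not depend on the size of the nonlinearity. -/
theorem sum_lam_sq_le {lam p : ι → ℝ} (hl : ∀ k, 0 ≤ lam k) (hp : ∀ k, 0 ≤ p k)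
    (hlp : ∀ k, 1 ≤ lam k → lam k ≤ p k) {δ : ℝ} (hδ : 0 < δ) {c M : ℝ → ℝ}
    (hc : ∀ s, 0 ≤ c s) (hM : ∀ s, HasDerivAt M (c s) s) (hM0 : M 0 = 0) {T : ℝ}
    {x v : ι → ℝ → ℝ}
    (hx : ∀ k, ∀ t ∈ Icc 0 T, HasDerivWithinAt (x k) (v k t) (Icc 0 T) t)
    (hv : ∀ k, ∀ t ∈ Icc 0 T, HasDerivWithinAt (v k)
      (-(2 * δ * p k * v k t) - c (∑ j, lam j ^ 2 * x j t ^ 2) * lam k ^ 2 * x k t)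
        (Icc 0 T) t) {E : ℝ}
    (hE : ∑ k, v k 0 ^ 2 + M (∑ j, lam j ^ 2 * x j 0 ^ 2) ≤ E) {t : ℝ} (ht : t ∈ Icc 0 T) :
    ∑ k, lam k ^ 2 * x k t ^ 2 ≤
      3 * ∑ k, lam k ^ 2 * x k 0 ^ 2 + 2 * E / δ ^ 2 + Real.exp t * (∑ k, x k 0 ^ 2 + E) := by
  have hx' : ∀ k, ∀ t ∈ Icc 0 T, HasDerivWithinAt (x k) (1 * v k t) (Icc 0 T) t := by
    simpa using hx
  have hv' : ∀ k, ∀ t ∈ Icc 0 T, HasDerivWithinAt (v k)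
      (1 * (-(2 * δ * p k * v k t) - c (∑ j, lam j ^ 2 * x j t ^ 2) * lam k ^ 2 * x k t))
        (Icc 0 T) t := by simpa using hv
  have hS : ∀ t ∈ Icc 0 T, ∑ k, v k t ^ 2 ≤ E := fun t ht =>
    (sum_sq_velocity_le (θ := fun _ => 1) hp hδ hc hM hM0 (fun _ => zero_le_one) hx' hv' ht).trans hE
  have hMn : ∀ t, 0 ≤ M (∑ j, lam j ^ 2 * x j t ^ 2) := fun t =>
    nonneg_of_deriv_nonneg hc hM hM0 (by positivity)
  -- low frequencies
  have hlow : ∑ k, x k t ^ 2 + E ≤ Real.exp (1 * t) * (∑ k, x k 0 ^ 2 + E) := by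
    refine le_exp_mul_of_deriv_le (f := fun t => ∑ k, x k t ^ 2 + E)
      (f' := fun t => ∑ k, 2 * x k t * v k t) (fun s hs => ?_) (fun s hs => ?_) ht
    · exact (HasDerivWithinAt.fun_sum fun k _ =>
        ((hx k s hs).pow 2).congr_deriv (by simp)).add_const E
    · have h1 : ∑ k, 2 * x k s * v k s ≤ ∑ k, (x k s ^ 2 + v k s ^ 2) :=
        Finset.sum_le_sum fun k _ => two_mul_le_add_sq _ _
      rw [Finset.sum_add_distrib] at h1
      linarith [hS s hs]
  -- high frequencies
  let g : ι → ℝ := fun k => if 1 ≤ lam k then lam k ^ 2 / p k else 0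
  have hg0 : ∀ k, 0 ≤ g k := fun k => by
    dsimp only [g]; split_ifs
    · exact div_nonneg (sq_nonneg _) (hp k)
    · exact le_rfl
  have hgp : ∀ k, g k ≤ p k := fun k => by
    dsimp only [g]; split_ifs with h
    · have := hlp k h
      rw [div_le_iff₀ (by linarith)]; nlinarith
    · exact hp k
  have hhigh := le_initial_of_deriv_nonpos
    (f := fun s => (∑ k, v k s ^ 2 + M (∑ j, lam j ^ 2 * x j s ^ 2)) +
      4 * δ * ∑ k, g k * (x k s * v k s + δ * p k * x k s ^ 2))
    (f' := fun s => -(4 * δ * 1 * ∑ k, p k * v k s ^ 2) + 4 * δ * ∑ k, g k * (v k s ^ 2 -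
      c (∑ j, lam j ^ 2 * x j s ^ 2) * lam k ^ 2 * x k s ^ 2)) (T := T)
    (fun s hs => (hasDerivWithinAt_energy hM (fun k => hx' k s hs) (fun k => hv' k s hs)).add
      ((HasDerivWithinAt.fun_sum fun k _ => (((hx k s hs).mul (hv k s hs)).add
        (((hx k s hs).pow 2).const_mul (δ * p k))).const_mul (g k) |>.congr_deriv
          (by push_cast; ring)).const_mul (4 * δ))) (fun s hs => ?_) ht
  swap
  · have : ∑ k, g k * (v k s ^ 2 - c (∑ j, lam j ^ 2 * x j s ^ 2) * lam k ^ 2 * x k s ^ 2) ≤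
        ∑ k, p k * v k s ^ 2 := Finset.sum_le_sum fun k _ => by
      have h1 := mul_nonneg (hg0 k) (mul_nonneg (mul_nonneg (hc (∑ j, lam j ^ 2 * x j s ^ 2))
        (sq_nonneg (lam k))) (sq_nonneg (x k s)))
      have h2 := mul_le_mul_of_nonneg_right (hgp k) (sq_nonneg (v k s))
      linarith
    nlinarith
  let h : ι → ℝ → ℝ := fun k s => if 1 ≤ lam k then lam k ^ 2 * x k s ^ 2 else 0
  have hlower : ∀ s, 2 * δ ^ 2 * ∑ k, h k s - 2 * ∑ k, v k s ^ 2 ≤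
      4 * δ * ∑ k, g k * (x k s * v k s + δ * p k * x k s ^ 2) := fun s => by
    rw [Finset.mul_sum, Finset.mul_sum, Finset.mul_sum, ← Finset.sum_sub_distrib]
    refine Finset.sum_le_sum fun k _ => ?_
    dsimp only [g, h]; split_ifs with h1
    · have hp0 : 0 < p k := by linarith [hlp k h1]
      have h2 := abs_le.1 (abs_cross_term_le (δ := δ) (a := x k s) (b := v k s) (hl k) (hlp k h1) hp0)
      have h3 : 4 * δ * (lam k ^ 2 / p k * (x k s * v k s + δ * p k * x k s ^ 2)) =
        4 * δ * (lam k ^ 2 / p k * (x k s * v k s)) + 4 * δ ^ 2 * (lam k ^ 2 * x k s ^ 2) := by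
        field_simp
      linarith [h2.1]
    · nlinarith [sq_nonneg (v k s)]
  have hupper : ∀ s, 4 * δ * ∑ k, g k * (x k s * v k s + δ * p k * x k s ^ 2) ≤
      6 * δ ^ 2 * ∑ k, lam k ^ 2 * x k s ^ 2 + 2 * ∑ k, v k s ^ 2 := fun s => by
    rw [Finset.mul_sum, Finset.mul_sum, Finset.mul_sum, ← Finset.sum_add_distrib]
    refine Finset.sum_le_sum fun k _ => ?_
    dsimp only [g]; split_ifs with h1
    · have hp0 : 0 < p k := by linarith [hlp k h1]
      have h2 := abs_le.1 (abs_cross_term_le (δ := δ) (a := x k s) (b := v k s) (hl k) (hlp k h1) hp0)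
      have h3 : 4 * δ * (lam k ^ 2 / p k * (x k s * v k s + δ * p k * x k s ^ 2)) =
        4 * δ * (lam k ^ 2 / p k * (x k s * v k s)) + 4 * δ ^ 2 * (lam k ^ 2 * x k s ^ 2) := by
        field_simp
      linarith [h2.2]
    · simp only [zero_mul, mul_zero]; positivity
  have hsplit : ∑ k, lam k ^ 2 * x k t ^ 2 ≤ ∑ k, h k t + ∑ k, x k t ^ 2 := by
    rw [← Finset.sum_add_distrib]
    refine Finset.sum_le_sum fun k _ => ?_
    dsimp only [h]; split_ifs with h1
    · nlinarith [sq_nonneg (x k t)]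
    · have h2 : lam k ^ 2 ≤ 1 := by nlinarith [hl k]
      nlinarith [sq_nonneg (x k t)]
  have h0 : (0:ℝ) ∈ Icc 0 T := ⟨le_rfl, ht.1.trans ht.2⟩
  have hh : ∑ k, h k t ≤ 3 * ∑ k, lam k ^ 2 * x k 0 ^ 2 + 2 * E / δ ^ 2 + E := by
    have e1 := hlower t
    have e2 := hupper 0
    have e3 := hS t ht
    have e4 := hS 0 h0
    have e5 := hMn t
    have e6 : 0 ≤ E := (Finset.sum_nonneg fun k _ => sq_nonneg (v k t)).trans e3
    have e7 : 2 * δ ^ 2 * ∑ k, h k t ≤ 6 * δ ^ 2 * ∑ k, lam k ^ 2 * x k 0 ^ 2 + 4 * E := by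
      linarith
    have e8 : ∑ k, h k t ≤ 3 * ∑ k, lam k ^ 2 * x k 0 ^ 2 + 2 * E / δ ^ 2 := by
      rw [← mul_le_mul_iff_right₀ (show 0 < 2 * δ ^ 2 by positivity)]
      refine e7.trans (le_of_eq ?_)
      field_simp
      ring
    linarith
  rw [one_mul] at hlow
  linarith

end Apriori

/-! ### Estimates for a single mode -/

theorem single_mode_high {l p δ C : ℝ} (hp : 0 < p) (hδ : 0 < δ) (hC : 2 ≤ C)
    (hlp : C * l ^ 2 ≤ 2 * δ ^ 2 * p ^ 2) {T : ℝ} {x v c : ℝ → ℝ}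
    (hc : ∀ t ∈ Icc 0 T, 0 ≤ c t ∧ c t ≤ C)
    (hx : ∀ t ∈ Icc 0 T, HasDerivWithinAt x (v t) (Icc 0 T) t)
    (hv : ∀ t ∈ Icc 0 T, HasDerivWithinAt v (-(2 * δ * p * v t) - c t * l ^ 2 * x t) (Icc 0 T) t)
    {t : ℝ} (ht : t ∈ Icc 0 T) :
    v t ^ 2 + l ^ 2 * x t ^ 2 ≤ 3 * C / 2 * (v 0 ^ 2 + l ^ 2 * x 0 ^ 2) := by
  have hC0 : 0 < C := by linarith
  have hr : C * (l / p) ^ 2 ≤ 2 * δ ^ 2 := by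
    rw [div_pow, ← mul_div_assoc, div_le_iff₀ (by positivity)]; exact hlp
  let G : ℝ → ℝ := fun s => C * (l ^ 2 / p * (x s * v s) + δ * l ^ 2 * x s ^ 2) + 2 * δ * v s ^ 2
  have hcross : ∀ s, |C * (l ^ 2 / p * (x s * v s))| ≤
      C * δ / 2 * (l ^ 2 * x s ^ 2) + δ * v s ^ 2 := fun s => by
    have he : C * (l ^ 2 / p * (x s * v s)) = C * (l / p) * (l * x s) * v s := by ring
    obtain ⟨r, hr'⟩ : ∃ r, r = l / p := ⟨_, rfl⟩
    obtain ⟨y, hy⟩ : ∃ y, y = l * x s := ⟨_, rfl⟩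
    rw [he, ← mul_pow, ← hr', ← hy]
    rw [← hr'] at hr
    have h1 : C * (C * r ^ 2) * v s ^ 2 ≤ C * (2 * δ ^ 2) * v s ^ 2 := by gcongr
    have key : ∀ e : ℝ, e ^ 2 = 1 → 0 ≤ C * δ / 2 * y ^ 2 + δ * v s ^ 2 + e * (C * r * y * v s) := by
      intro e he
      have h2 : 0 ≤ C * (δ * y + e * r * v s) ^ 2 := by positivity
      have h3 : C * (δ * y + e * r * v s) ^ 2 =
        C * δ ^ 2 * y ^ 2 + 2 * δ * (e * (C * r * y * v s)) + e ^ 2 * (C * r ^ 2 * v s ^ 2) := by ring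
      rw [h3, he] at h2
      have h4 : C * r ^ 2 * v s ^ 2 ≤ 2 * δ ^ 2 * v s ^ 2 := by gcongr
      have h5 : 0 ≤ 2 * δ * (C * δ / 2 * y ^ 2 + δ * v s ^ 2 + e * (C * r * y * v s)) := by
        linarith
      exact nonneg_of_mul_nonneg_right h5 (by positivity)
    have k1 := key 1 (by norm_num)
    have k2 := key (-1) (by norm_num)
    rw [abs_le]; constructor <;> linarith
  have hG := le_initial_of_deriv_nonpos (f := G)
    (f' := fun s => C * (l ^ 2 / p * (v s ^ 2 - c s * l ^ 2 * x s ^ 2)) -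
      2 * δ * (4 * δ * p * v s ^ 2 + 2 * c s * l ^ 2 * x s * v s)) (T := T)
    (fun s hs => ((((((hx s hs).mul (hv s hs)).const_mul (l ^ 2 / p)).add
      (((hx s hs).pow 2).const_mul (δ * l ^ 2))).const_mul C).add
        (((hv s hs).pow 2).const_mul (2 * δ))).congr_deriv (by simp; field_simp; ring))
    (fun s hs => ?_) ht
  swap
  · obtain ⟨c0, c1⟩ := hc s hs
    have h1 : C * (l / p) ^ 2 * (p * v s ^ 2) ≤ 2 * δ ^ 2 * (p * v s ^ 2) := by gcongr
    have h2 : c s * (p * v s ^ 2) ≤ C * (p * v s ^ 2) := by gcongr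
    have h3 : 0 ≤ c s * p * (C * (l / p) * (l * x s) + 2 * δ * v s) ^ 2 := by positivity
    have h4 : c s * p * (C * (l / p) * (l * x s) + 2 * δ * v s) ^ 2 =
      C * (C * (l ^ 2 / p * (c s * l ^ 2 * x s ^ 2)) + 2 * δ * (2 * c s * l ^ 2 * x s * v s))
        + 4 * δ ^ 2 * (c s * (p * v s ^ 2)) := by field_simp; ring
    have h5 : C * (l / p) ^ 2 * (p * v s ^ 2) = C * (l ^ 2 / p * v s ^ 2) := by field_simp
    have h6 : 4 * δ ^ 2 * (c s * (p * v s ^ 2)) ≤ 4 * δ ^ 2 * (C * (p * v s ^ 2)) := by gcongr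
    have h7 : 0 ≤ C * (C * (l ^ 2 / p * (c s * l ^ 2 * x s ^ 2)) +
      2 * δ * (2 * c s * l ^ 2 * x s * v s) + 4 * δ ^ 2 * (p * v s ^ 2)) := by linarith
    have h8 := nonneg_of_mul_nonneg_right h7 hC0
    have h9 : 0 ≤ δ ^ 2 * (p * v s ^ 2) := by positivity
    linarith
  have u1 := (abs_le.1 (hcross t)).1
  have u2 := (abs_le.1 (hcross 0)).2
  simp only [G] at hG
  have hv0 := sq_nonneg (v 0)
  have hvt := sq_nonneg (v t)
  have hx0 : 0 ≤ l ^ 2 * x 0 ^ 2 := by positivity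
  have hxt : 0 ≤ l ^ 2 * x t ^ 2 := by positivity
  have w1 : 0 ≤ (C - 2) * (l ^ 2 * x t ^ 2) := mul_nonneg (by linarith) hxt
  have w2 : 0 ≤ (C - 2) * v 0 ^ 2 := mul_nonneg (by linarith) hv0
  have w3 : δ * (v t ^ 2 + l ^ 2 * x t ^ 2) ≤ δ * (3 * C / 2 * (v 0 ^ 2 + l ^ 2 * x 0 ^ 2)) := by
    have w4 := mul_nonneg hδ.le w1
    have w5 := mul_nonneg hδ.le w2
    linarith
  exact le_of_mul_le_mul_left w3 hδ

theorem single_mode_low {l p δ C Λ : ℝ} (hp : 0 ≤ p) (hδ : 0 < δ) (hC : 0 ≤ C) (hl : 0 ≤ l)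
    (hlΛ : l ≤ Λ) {T : ℝ} {x v c : ℝ → ℝ}
    (hc : ∀ t ∈ Icc 0 T, 0 ≤ c t ∧ c t ≤ C)
    (hx : ∀ t ∈ Icc 0 T, HasDerivWithinAt x (v t) (Icc 0 T) t)
    (hv : ∀ t ∈ Icc 0 T, HasDerivWithinAt v (-(2 * δ * p * v t) - c t * l ^ 2 * x t) (Icc 0 T) t)
    {t : ℝ} (ht : t ∈ Icc 0 T) :
    v t ^ 2 + l ^ 2 * x t ^ 2 ≤
      Real.exp ((1 + C) * Λ * T) * (v 0 ^ 2 + l ^ 2 * x 0 ^ 2) := by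
  have h := le_exp_mul_of_deriv_le (f := fun s => v s ^ 2 + l ^ 2 * x s ^ 2)
    (f' := fun s => -(4 * δ * p * v s ^ 2) + 2 * (1 - c s) * l * ((l * x s) * v s))
    (T := T) (K := (1 + C) * Λ)
    (fun s hs => (((hv s hs).pow 2).add (((hx s hs).pow 2).const_mul (l ^ 2))).congr_deriv
      (by simp; ring)) (fun s hs => ?_) ht
  · refine h.trans ?_
    have hΛ : 0 ≤ Λ := hl.trans hlΛ
    have := ht.2
    gcongr
  · obtain ⟨c0, c1⟩ := hc s hs
    obtain ⟨y, hy⟩ : ∃ y, y = l * x s := ⟨_, rfl⟩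
    rw [← mul_pow, ← hy]
    have h1 : 0 ≤ 4 * δ * p * v s ^ 2 := by positivity
    have h2 : |1 - c s| ≤ 1 + C := by rw [abs_le]; constructor <;> linarith
    have h3 : 2 * |y * v s| ≤ v s ^ 2 + y ^ 2 := by
      rw [abs_mul, ← sq_abs y, ← sq_abs (v s)]
      linarith [two_mul_le_add_sq |y| |v s|]
    have hΛ : 0 ≤ Λ := hl.trans hlΛ
    calc _ ≤ 2 * (1 - c s) * l * (y * v s) := by linarith
      _ ≤ |2 * (1 - c s) * l * (y * v s)| := le_abs_self _
      _ = |1 - c s| * l * (2 * |y * v s|) := by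
          rw [abs_mul, abs_mul, abs_mul, abs_of_nonneg hl, abs_two]; ring
      _ ≤ (1 + C) * Λ * (v s ^ 2 + y ^ 2) := by gcongr

/-- Uniform in the frequency, with no regularity of the coefficient `c` required. -/
theorem exists_single_mode_bound {σ δ : ℝ} (hσ : 1 / 2 < σ) (hδ : 0 < δ) (C T : ℝ) :
    ∃ K, 0 ≤ K ∧ ∀ (l τ : ℝ) (x v c : ℝ → ℝ), 0 ≤ l → τ ≤ T →
      (∀ t ∈ Icc 0 τ, 0 ≤ c t ∧ c t ≤ C) →
      (∀ t ∈ Icc 0 τ, HasDerivWithinAt x (v t) (Icc 0 τ) t) →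
      (∀ t ∈ Icc 0 τ, HasDerivWithinAt v
        (-(2 * δ * l ^ (2 * σ) * v t) - c t * l ^ 2 * x t) (Icc 0 τ) t) →
      ∀ t ∈ Icc 0 τ, v t ^ 2 + l ^ 2 * x t ^ 2 ≤ K * (v 0 ^ 2 + l ^ 2 * x 0 ^ 2) := by
  obtain ⟨D, hCD, hD⟩ : ∃ D, C ≤ D ∧ 2 ≤ D := ⟨max C 2, le_max_left _ _, le_max_right _ _⟩
  set Λ : ℝ := (D / (2 * δ ^ 2)) ^ (4 * σ - 2)⁻¹ with hΛ
  have hD0 : 0 < D := by linarith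
  have hΛ0 : 0 ≤ Λ := by positivity
  refine ⟨3 * D / 2 + Real.exp ((1 + D) * Λ * T), by positivity, ?_⟩
  intro l τ x v c hl hτ hc hx hv t ht
  have hc' : ∀ t ∈ Icc 0 τ, 0 ≤ c t ∧ c t ≤ D := fun t ht => ⟨(hc t ht).1, (hc t ht).2.trans hCD⟩
  have he : 0 ≤ v 0 ^ 2 + l ^ 2 * x 0 ^ 2 := by positivity
  have hex := Real.exp_pos ((1 + D) * Λ * T)
  by_cases hlΛ : l ≤ Λ
  · have h := single_mode_low (Real.rpow_nonneg hl (2 * σ)) hδ hD0.le hl hlΛ hc' hx hv ht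
    have h2 : Real.exp ((1 + D) * Λ * τ) ≤ Real.exp ((1 + D) * Λ * T) := by gcongr
    nlinarith
  · push Not at hlΛ
    have hl0 : 0 < l := hΛ0.trans_lt hlΛ
    have h := single_mode_high (Real.rpow_pos_of_pos hl0 (2 * σ)) hδ hD ?_ hc' hx hv ht
    · nlinarith
    · have h1 : D / (2 * δ ^ 2) ≤ l ^ (4 * σ - 2) := by
        have h2 := Real.rpow_le_rpow hΛ0 hlΛ.le (show 0 ≤ 4 * σ - 2 by linarith)
        rwa [hΛ, Real.rpow_inv_rpow (by positivity) (by linarith)] at h2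
      rw [div_le_iff₀ (by positivity)] at h1
      have h3 : (l ^ (2 * σ)) ^ 2 = l ^ (4 * σ - 2) * l ^ 2 := by
        rw [← Real.rpow_natCast, ← Real.rpow_mul hl, ← Real.rpow_natCast, ← Real.rpow_add hl0]
        congr 1; push_cast; ring
      rw [h3]
      nlinarith [sq_nonneg l]

/-! ### Compactness and passage to the limit -/

theorem continuousOn_Ici_of_lipschitz_on_bounded {g : ℝ → ℝ} {B : ℝ → ℝ}
    (h : ∀ T, ∀ s ∈ Icc 0 T, ∀ t ∈ Icc 0 T, |g s - g t| ≤ B T * |s - t|) :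
    ContinuousOn g (Ici 0) := by
  intro t ht
  rw [ContinuousWithinAt, tendsto_iff_norm_sub_tendsto_zero]
  have h1 : Tendsto (fun s => B (t + 1) * |s - t|) (𝓝[Ici 0] t) (𝓝 0) := by
    have : Continuous fun s => B (t + 1) * |s - t| := by fun_prop
    simpa using (this.tendsto t).mono_left nhdsWithin_le_nhds
  refine tendsto_of_tendsto_of_tendsto_of_le_of_le' tendsto_const_nhds h1
    (Eventually.of_forall fun s => norm_nonneg _) ?_
  filter_upwards [self_mem_nhdsWithin, nhdsWithin_le_nhds (Iio_mem_nhds (lt_add_one t))]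
    with s hs hs'
  exact h (t + 1) s ⟨hs, hs'.le⟩ t ⟨ht, by linarith⟩

/-- A diagonal Arzelà–Ascoli extraction for countably many curves on growing intervals. -/
theorem exists_subseq_tendsto_of_lipschitz {ι : Type*} [Countable ι] {f : ℕ → ι → ℝ → ℝ}
    {B : ι → ℝ → ℝ}
    (hb : ∀ (n : ℕ) (i : ι) (T : ℝ), ∀ t ∈ Icc 0 T, t ≤ n → |f n i t| ≤ B i T)
    (hl : ∀ (n : ℕ) (i : ι) (T : ℝ), ∀ s ∈ Icc 0 T, ∀ t ∈ Icc 0 T, s ≤ n → t ≤ n →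
      |f n i s - f n i t| ≤ B i T * |s - t|) :
    ∃ (φ : ℕ → ℕ) (g : ι → ℝ → ℝ), StrictMono φ ∧
      (∀ i, ∀ t ∈ Ici (0:ℝ), Tendsto (fun n => f (φ n) i t) atTop (𝓝 (g i t))) ∧
      ∀ i, ContinuousOn (g i) (Ici 0) := by
  classical
  let F : ℕ → ι × ℚ → ℝ := fun n z =>
    if 0 ≤ (z.2 : ℝ) ∧ (z.2 : ℝ) ≤ n then f n z.1 z.2 else 0
  have hF : ∀ n, F n ∈ Set.pi univ fun z : ι × ℚ => Icc (-|B z.1 z.2|) |B z.1 z.2| := by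
    intro n z _
    change F n z ∈ Icc (-|B z.1 z.2|) |B z.1 z.2|
    rw [mem_Icc, ← abs_le]
    dsimp only [F]
    split_ifs with h
    · exact (hb n z.1 z.2 z.2 ⟨h.1, le_rfl⟩ h.2).trans (le_abs_self _)
    · simp
  obtain ⟨G, -, φ, hφ, hlim⟩ := (isCompact_univ_pi fun z : ι × ℚ =>
    isCompact_Icc (a := -|B z.1 z.2|) (b := |B z.1 z.2|)).tendsto_subseq hF
  rw [tendsto_pi_nhds] at hlim
  have hφt : Tendsto (fun n => (φ n : ℝ)) atTop atTop :=
    tendsto_natCast_atTop_atTop.comp hφ.tendsto_atTop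
  have hcau : ∀ i, ∀ t ∈ Ici (0:ℝ), ∃ y, Tendsto (fun n => f (φ n) i t) atTop (𝓝 y) := by
    intro i t ht
    refine cauchySeq_tendsto_of_complete (Metric.cauchySeq_iff'.2 fun ε hε => ?_)
    set b := |B i (t + 1)| + 1 with hbdef
    have hb0 : 0 < b := by positivity
    obtain ⟨q, hq1, hq2⟩ := exists_rat_btwn
      (show t < t + min 1 (ε / (4 * b)) by
        have : 0 < min 1 (ε / (4 * b)) := by positivity
        linarith)
    have hq3 : (q : ℝ) ≤ t + 1 := by linarith [min_le_left 1 (ε / (4 * b))]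
    have hq4 : (q : ℝ) - t ≤ ε / (4 * b) := by linarith [min_le_right 1 (ε / (4 * b))]
    have ht0 : (0:ℝ) ≤ t := ht
    obtain ⟨N, hN⟩ := Metric.cauchySeq_iff'.1 (hlim (i, q)).cauchySeq (ε / 4) (by positivity)
    obtain ⟨N', hN'⟩ := eventually_atTop.1 (hφt.eventually_ge_atTop (t + 1))
    have key : ∀ n, N' ≤ n → |f (φ n) i t - f (φ n) i q| ≤ ε / 4 := by
      intro n hn
      have h1 := hN' n hn
      refine (hl (φ n) i (t + 1) t ⟨ht0, by linarith⟩ q ⟨by linarith, hq3⟩ (by linarith)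
        (by linarith)).trans ?_
      rw [abs_sub_comm, abs_of_nonneg (show 0 ≤ (q:ℝ) - t by linarith)]
      calc B i (t + 1) * (q - t) ≤ b * (ε / (4 * b)) := by
            refine mul_le_mul ?_ hq4 (by linarith) hb0.le
            linarith [le_abs_self (B i (t + 1))]
        _ = ε / 4 := by field_simp
    have hFq : ∀ n, N' ≤ n → F (φ n) (i, q) = f (φ n) i q := by
      intro n hn
      have h1 := hN' n hn
      dsimp only [F]
      rw [if_pos ⟨by linarith, by linarith⟩]
    refine ⟨max N N', fun n hn => ?_⟩
    have e1 := abs_le.1 (key n ((le_max_right _ _).trans hn))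
    have e2 := abs_le.1 (key (max N N') (le_max_right _ _))
    have e3 := hN n ((le_max_left _ _).trans hn)
    have e4 := hN (max N N') (le_max_left _ _)
    simp only [Function.comp_apply] at e3 e4
    rw [Real.dist_eq, hFq _ ((le_max_right _ _).trans hn)] at e3
    rw [Real.dist_eq, hFq _ (le_max_right _ _)] at e4
    have e5 := abs_lt.1 e3
    have e6 := abs_lt.1 e4
    rw [Real.dist_eq, abs_lt]
    constructor <;> linarith [e1.1, e1.2, e2.1, e2.2, e5.1, e5.2, e6.1, e6.2]
  choose! g hg using hcau
  refine ⟨φ, g, hφ, hg, fun i => continuousOn_Ici_of_lipschitz_on_bounded (B := B i) ?_⟩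
  intro T s hs t ht
  refine le_of_tendsto ((hg i s hs.1).sub (hg i t ht.1)).abs ?_
  filter_upwards [hφt.eventually_ge_atTop T] with n hn
  exact hl (φ n) i T s hs t ht (hs.2.trans hn) (ht.2.trans hn)

theorem hasDerivWithinAt_Ici_of_tendsto {τ : ℕ → ℝ} (hτ : Tendsto τ atTop atTop)
    {f g : ℕ → ℝ → ℝ} {F G : ℝ → ℝ}
    (hfg : ∀ n, ∀ t ∈ Icc 0 (τ n), HasDerivWithinAt (f n) (g n t) (Icc 0 (τ n)) t)
    (hgc : ∀ n, ContinuousOn (g n) (Icc 0 (τ n)))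
    (hgb : ∀ T, ∃ B, ∀ n, ∀ t ∈ Icc 0 T, t ≤ τ n → |g n t| ≤ B)
    (hF : ∀ t ∈ Ici (0:ℝ), Tendsto (fun n => f n t) atTop (𝓝 (F t)))
    (hG : ∀ t ∈ Ici (0:ℝ), Tendsto (fun n => g n t) atTop (𝓝 (G t)))
    (hGc : ContinuousOn G (Ici 0)) {t : ℝ} (ht : t ∈ Ici (0:ℝ)) :
    HasDerivWithinAt F (G t) (Ici 0) t := by
  have hint : ∀ s ∈ Ici (0:ℝ), F s = F 0 + ∫ r in 0..s, G (max r 0) := by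
    intro s hs
    have hs0 : (0:ℝ) ≤ s := hs
    obtain ⟨B, hB⟩ := hgb s
    have h1 : Tendsto (fun n => ∫ r in 0..s, g n r) atTop (𝓝 (∫ r in 0..s, G (max r 0))) := by
      refine intervalIntegral.tendsto_integral_filter_of_dominated_convergence (fun _ => B) ?_ ?_
        intervalIntegrable_const ?_
      · filter_upwards [hτ.eventually_ge_atTop s] with n hn
        rw [uIoc_of_le hs0]
        exact ((hgc n).mono (Ioc_subset_Icc_self.trans (Icc_subset_Icc_right hn))).aestronglyMeasurable
          measurableSet_Ioc
      · filter_upwards [hτ.eventually_ge_atTop s] with n hn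
        refine Eventually.of_forall fun r hr => ?_
        rw [uIoc_of_le hs0] at hr
        exact hB n r ⟨hr.1.le, hr.2⟩ (hr.2.trans hn)
      · refine Eventually.of_forall fun r hr => ?_
        rw [uIoc_of_le hs0] at hr
        rw [max_eq_left hr.1.le]
        exact hG r hr.1.le
    have h2 : Tendsto (fun n => ∫ r in 0..s, g n r) atTop (𝓝 (F s - F 0)) := by
      refine ((hF s hs).sub (hF 0 (mem_Ici.2 le_rfl))).congr' ?_
      filter_upwards [hτ.eventually_ge_atTop s] with n hn
      have hsub : Icc 0 s ⊆ Icc 0 (τ n) := Icc_subset_Icc_right hn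
      refine (intervalIntegral.integral_eq_sub_of_hasDerivAt_of_le hs0
        (fun r hr => ((hfg n r (hsub hr)).continuousWithinAt.mono hsub)) (fun r hr => ?_) ?_).symm
      · exact (hfg n r (hsub (Ioo_subset_Icc_self hr))).hasDerivAt
          (Icc_mem_nhds hr.1 (hr.2.trans_le hn))
      · refine ContinuousOn.intervalIntegrable ?_
        rw [uIcc_of_le hs0]
        exact (hgc n).mono hsub
    have := tendsto_nhds_unique h1 h2
    linarith
  have hcont : Continuous fun r => G (max r 0) :=
    hGc.comp_continuous (by fun_prop) fun r => mem_Ici.2 (le_max_right _ _)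
  have hd : HasDerivAt (fun s => F 0 + ∫ r in 0..s, G (max r 0)) (G (max t 0)) t :=
    (hcont.integral_hasStrictDerivAt 0 t).hasDerivAt.const_add _
  rw [max_eq_left ht] at hd
  exact hd.hasDerivWithinAt.congr hint (hint t ht)

theorem tendsto_tsum_nhdsWithin_of_dominated {w : ℝ → ℕ → ℝ}
    {b : ℝ → ℕ → ℝ} (hb : ∀ T, Summable (b T)) (hwb : ∀ T, ∀ t ∈ Icc 0 T, ∀ k, |w t k| ≤ b T k)
    (hw : ∀ k, ContinuousOn (fun t => w t k) (Ici 0)) :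
    ContinuousOn (fun t => ∑' k, w t k) (Ici 0) := by
  intro t ht
  refine tendsto_tsum_of_dominated_convergence (hb (t + 1)) (fun k => hw k t ht) ?_
  filter_upwards [self_mem_nhdsWithin, nhdsWithin_le_nhds (Iio_mem_nhds (lt_add_one t))]
    with s hs hs'
  exact hwb (t + 1) s ⟨hs, hs'.le⟩

theorem l2Cont_of_dominated {w : ℝ → ℕ → ℝ}
    {b : ℝ → ℕ → ℝ} (hb : ∀ T, Summable (b T)) (hwb : ∀ T, ∀ t ∈ Icc 0 T, ∀ k, w t k ^ 2 ≤ b T k)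
    (hw : ∀ k, ContinuousOn (fun t => w t k) (Ici 0)) : L2Cont (Ici 0) w := by
  refine ⟨fun t ht => Summable.of_nonneg_of_le (fun k => sq_nonneg _) (hwb t t ⟨ht, le_rfl⟩) (hb t),
    fun t ht ε hε => ?_⟩
  have ht0 : (0:ℝ) ≤ t := ht
  have h := tendsto_tsum_nhdsWithin_of_dominated (w := fun s k => (w s k - w t k) ^ 2)
    (b := fun T k => 2 * (b T k + b t k)) (fun T => ((hb T).add (hb t)).mul_left 2)
    (fun T s hs k => ?_) (fun k => ((hw k).sub continuousOn_const).pow 2) t ht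
  · obtain ⟨η, hη, h2⟩ := Metric.tendsto_nhdsWithin_nhds.1 h ε hε
    refine ⟨η, hη, fun s hs hst => ?_⟩
    have h3 := h2 hs (by rwa [Real.dist_eq])
    simp only [sub_self, ne_eq, OfNat.ofNat_ne_zero, not_false_eq_true, zero_pow, tsum_zero,
      Real.dist_eq, sub_zero] at h3
    exact (le_abs_self _).trans_lt h3
  · rw [abs_of_nonneg (sq_nonneg _)]
    nlinarith [hwb T s hs k, hwb t t ⟨ht0, le_rfl⟩ k, sq_nonneg (w s k + w t k)]

/-! ### Galerkin approximations -/

/-- A Galerkin approximation on `[0, n]`: only the first `n` modes are excited, and the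
nonlinearity `m` is replaced by `q ^ 2` with `q` close to `√m` on the range of `|A^{1/2}x|²`,
which is bounded by `R`. -/
structure IsGalerkin (lam : ℕ → ℝ) (m : ℝ → ℝ) (σ δ : ℝ) (u0 u1 : ℕ → ℝ) (R : ℝ → ℝ) (n : ℕ)
    (x v : ℕ → ℝ → ℝ) (q : ℝ → ℝ) : Prop where
  continuous_q : Continuous q
  near : ∀ s ∈ Icc 0 (R n), |q s - √(m s)| ≤ 1 / (n + 1)
  x_eq_zero : ∀ k, n ≤ k → x k = fun _ => 0
  v_eq_zero : ∀ k, n ≤ k → v k = fun _ => 0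
  x_init : ∀ k < n, x k 0 = u0 k
  v_init : ∀ k < n, v k 0 = u1 k
  hasDeriv_x : ∀ k, ∀ t ∈ Icc (0:ℝ) n, HasDerivWithinAt (x k) (v k t) (Icc 0 n) t
  hasDeriv_v : ∀ k, ∀ t ∈ Icc (0:ℝ) n, HasDerivWithinAt (v k)
    (-(2 * δ * lam k ^ (2 * σ) * v k t) - q (∑' j, lam j ^ 2 * x j t ^ 2) ^ 2 * lam k ^ 2 * x k t)
      (Icc 0 n) t
  tsum_le : ∀ t ∈ Icc (0:ℝ) n, ∑' j, lam j ^ 2 * x j t ^ 2 ≤ R t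

theorem exists_isGalerkin {lam : ℕ → ℝ} (hlam : ∀ k, 0 ≤ lam k) {m : ℝ → ℝ}
    (hmc : ContinuousOn m (Ici 0)) {σ δ : ℝ}
    (hσ : 1 / 2 < σ) (hδ : 0 < δ) {u0 u1 : ℕ → ℝ} (h0 : Summable fun k => u0 k ^ 2)
    (h0' : Summable fun k => lam k ^ 2 * u0 k ^ 2) (h1 : Summable fun k => u1 k ^ 2) :
    ∃ R : ℝ → ℝ, Monotone R ∧ ∀ n, ∃ x v q, IsGalerkin lam m σ δ u0 u1 R n x v q := by
  set D0 := ∑' k, u0 k ^ 2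
  set D1 := ∑' k, lam k ^ 2 * u0 k ^ 2
  set D2 := ∑' k, u1 k ^ 2
  have hD0 : 0 ≤ D0 := tsum_nonneg fun k => sq_nonneg _
  have hD1 : 0 ≤ D1 := tsum_nonneg fun k => by positivity
  have hD2 : 0 ≤ D2 := tsum_nonneg fun k => sq_nonneg _
  have hwc : ContinuousOn (fun s => √(m s)) (Ici 0) := hmc.sqrt
  have hIcc : ∀ b : ℝ, Icc 0 b ⊆ Ici 0 := fun b => Icc_subset_Ici_self
  have hEint : IntervalIntegrable (fun s => (√(m s) + 1) ^ 2) volume 0 D1 := by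
    refine ContinuousOn.intervalIntegrable ?_
    rw [uIcc_of_le hD1]
    exact ((hwc.mono (hIcc D1)).add continuousOn_const).pow 2
  set E := D2 + ∫ s in 0..D1, (√(m s) + 1) ^ 2
  have hE : 0 ≤ E := add_nonneg hD2 (intervalIntegral.integral_nonneg hD1 fun s _ => sq_nonneg _)
  let R : ℝ → ℝ := fun t => 3 * D1 + 2 * E / δ ^ 2 + Real.exp t * (D0 + E)
  have hR : Monotone R := fun s t hst => by
    have : Real.exp s ≤ Real.exp t := Real.exp_le_exp.2 hst
    dsimp only [R]; gcongr
  have hRD : ∀ t, D1 ≤ R t := fun t => by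
    have : 0 ≤ 2 * E / δ ^ 2 + Real.exp t * (D0 + E) := by positivity
    dsimp only [R]; linarith
  refine ⟨R, hR, fun n => ?_⟩
  obtain ⟨P, hP⟩ := exists_polynomial_near_of_continuousOn 0 (R n) (fun s => √(m s))
    (hwc.mono (hIcc _)) (1 / ((n:ℝ) + 1)) Nat.one_div_pos_of_nat
  have hPc : Continuous fun s => P.eval s := P.continuous
  have hPd : ContDiff ℝ 1 fun s => P.eval s := by
    simpa only [Polynomial.coe_aeval_eq_eval] using P.contDiff_aeval (𝕜 := ℝ) 1
  let c : ℝ → ℝ := fun s => P.eval s ^ 2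
  have hcc : Continuous c := hPc.pow 2
  let M : ℝ → ℝ := fun s => ∫ r in 0..s, c r
  have hM : ∀ s, HasDerivAt M (c s) s := fun s => (hcc.integral_hasStrictDerivAt 0 s).hasDerivAt
  have hM0 : M 0 = 0 := intervalIntegral.integral_same
  have hc0 : ∀ s, 0 ≤ c s := fun s => sq_nonneg _
  have hMm : Monotone M := monotone_of_deriv_nonneg (fun s => (hM s).differentiableAt)
    (fun s => by rw [(hM s).deriv]; exact hc0 s)
  have hMD : M D1 ≤ ∫ s in 0..D1, (√(m s) + 1) ^ 2 := by
    refine intervalIntegral.integral_mono_on hD1 (hcc.intervalIntegrable _ _) hEint fun s hs => ?_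
    have h2 := (hP s ⟨hs.1, hs.2.trans (hRD n)⟩).le
    have h3 : 1 / ((n:ℝ) + 1) ≤ 1 := by
      rw [div_le_one (by positivity)]; linarith [n.cast_nonneg (α := ℝ)]
    have h4 := abs_le.1 (h2.trans h3)
    have h5 := Real.sqrt_nonneg (m s)
    exact sq_le_sq' (by linarith [h4.1]) (by linarith [h4.2])
  obtain ⟨x, v, hx0, hv0, hx, hv⟩ := exists_finite_kirchhoff (ι := Fin n)
    (lam := fun k => lam k) (p := fun k => lam k ^ (2 * σ))
    (fun k => Real.rpow_nonneg (hlam k) _) hδ hc0 (hPd.pow 2) hM hM0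
    (fun k => u0 k) (fun k => u1 k) n.cast_nonneg
  have hfin : ∀ (f : ℕ → ℝ), (∀ k, 0 ≤ f k) → Summable f → ∑ k : Fin n, f k ≤ ∑' k, f k :=
    fun f hf hs => by
      rw [← Finset.sum_range]
      exact hs.sum_le_tsum _ fun k _ => hf k
  have hS0 : ∑ k : Fin n, lam k ^ 2 * u0 k ^ 2 ≤ D1 :=
    hfin (fun k => lam k ^ 2 * u0 k ^ 2) (fun k => by positivity) h0'
  have hbound := fun t (ht : t ∈ Icc (0:ℝ) n) => sum_lam_sq_le (ι := Fin n) (lam := fun k => lam k)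
    (p := fun k => lam k ^ (2 * σ)) (E := E) (fun k => hlam k)
    (fun k => Real.rpow_nonneg (hlam k) (2 * σ))
    (fun k hk => by
      simpa using Real.rpow_le_rpow_of_exponent_le hk (show 1 ≤ 2 * σ by linarith))
    hδ hc0 hM hM0 hx hv (by
      simp only [hx0, hv0]
      exact add_le_add (hfin (fun k => u1 k ^ 2) (fun k => sq_nonneg _) h1) ((hMm hS0).trans hMD)) ht
  simp only [hx0] at hbound
  have hsum : ∀ t, ∑' j, lam j ^ 2 * (fun k => if h : k < n then x ⟨k, h⟩ else fun _ => 0) j t ^ 2 =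
      ∑ j : Fin n, lam j ^ 2 * x j t ^ 2 := fun t => by
    rw [tsum_eq_sum (s := Finset.range n), Finset.sum_range]
    · exact Finset.sum_congr rfl fun k _ => by simp
    · intro k hk
      simp [Finset.mem_range.not.1 hk]
  refine ⟨fun k => if h : k < n then x ⟨k, h⟩ else fun _ => 0,
    fun k => if h : k < n then v ⟨k, h⟩ else fun _ => 0, fun s => P.eval s,
    hPc, fun s hs => (hP s hs).le, fun k hk => ?_, fun k hk => ?_, fun k hk => ?_, fun k hk => ?_,
    fun k t ht => ?_, fun k t ht => ?_, fun t ht => ?_⟩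
  · exact dif_neg hk.not_gt
  · exact dif_neg hk.not_gt
  · simp [hk, hx0]
  · simp [hk, hv0]
  · by_cases hk : k < n
    · simpa [hk] using hx ⟨k, hk⟩ t ht
    · simpa [hk] using hasDerivWithinAt_const t (Icc (0:ℝ) n) (0:ℝ)
  · rw [hsum]
    by_cases hk : k < n
    · simpa [hk] using hv ⟨k, hk⟩ t ht
    · simpa [hk] using hasDerivWithinAt_const t (Icc (0:ℝ) n) (0:ℝ)
  · rw [hsum]
    refine (hbound t ht).trans ?_
    have e1 : ∑ k : Fin n, u0 k ^ 2 ≤ D0 := hfin (fun k => u0 k ^ 2) (fun k => sq_nonneg _) h0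
    dsimp only [R]
    gcongr

namespace IsGalerkin

variable {lam : ℕ → ℝ} {m : ℝ → ℝ} {σ δ : ℝ} {u0 u1 : ℕ → ℝ} {R : ℝ → ℝ}

theorem init_sq_le {n : ℕ} {x v : ℕ → ℝ → ℝ} {q : ℝ → ℝ}
    (h : IsGalerkin lam m σ δ u0 u1 R n x v q) (k : ℕ) :
    x k 0 ^ 2 ≤ u0 k ^ 2 ∧ v k 0 ^ 2 ≤ u1 k ^ 2 := by
  rcases lt_or_ge k n with hk | hk
  · rw [h.x_init k hk, h.v_init k hk]; exact ⟨le_rfl, le_rfl⟩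
  · rw [h.x_eq_zero k hk, h.v_eq_zero k hk]
    simp only [ne_eq, OfNat.ofNat_ne_zero, not_false_eq_true, zero_pow]
    exact ⟨sq_nonneg _, sq_nonneg _⟩

theorem tsum_nonneg (x : ℕ → ℝ → ℝ) (lam : ℕ → ℝ) (t : ℝ) : 0 ≤ ∑' j, lam j ^ 2 * x j t ^ 2 :=
  _root_.tsum_nonneg fun k => by positivity

theorem exists_coeff_bound (hmc : ContinuousOn m (Ici 0)) (hR : Monotone R) (T : ℝ) :
    ∃ C, 0 ≤ C ∧ ∀ (n : ℕ) (x v : ℕ → ℝ → ℝ) (q : ℝ → ℝ), IsGalerkin lam m σ δ u0 u1 R n x v q →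
      ∀ t ∈ Icc 0 T, t ≤ n → q (∑' j, lam j ^ 2 * x j t ^ 2) ^ 2 ≤ C := by
  have hwc : ContinuousOn (fun s => √(m s)) (Icc 0 (R T)) := hmc.sqrt.mono Icc_subset_Ici_self
  obtain ⟨B, hB⟩ := isCompact_Icc.exists_bound_of_continuousOn hwc
  refine ⟨(B + 1) ^ 2, sq_nonneg _, fun n x v q h t ht htn => ?_⟩
  have hS0 := tsum_nonneg x lam t
  have hS := h.tsum_le t ⟨ht.1, htn⟩
  have h1 := hB _ ⟨hS0, hS.trans (hR ht.2)⟩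
  have h2 := h.near _ ⟨hS0, hS.trans (hR htn)⟩
  have h3 : 1 / ((n:ℝ) + 1) ≤ 1 := by
    rw [div_le_one (by positivity)]; linarith [n.cast_nonneg (α := ℝ)]
  rw [Real.norm_eq_abs] at h1
  have h4 := abs_le.1 (h2.trans h3)
  have h5 := abs_le.1 h1
  exact sq_le_sq' (by linarith [h4.1, h5.1]) (by linarith [h4.2, h5.2])

theorem exists_mode_bound (hlam : ∀ k, 0 ≤ lam k) (hσ : 1 / 2 < σ) (hδ : 0 < δ)
    (hmc : ContinuousOn m (Ici 0)) (hR : Monotone R) (T : ℝ) :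
    ∃ K, 0 ≤ K ∧ ∀ (n : ℕ) (x v : ℕ → ℝ → ℝ) (q : ℝ → ℝ), IsGalerkin lam m σ δ u0 u1 R n x v q →
      ∀ k, ∀ t ∈ Icc 0 T, t ≤ n →
        v k t ^ 2 + lam k ^ 2 * x k t ^ 2 ≤ K * (u1 k ^ 2 + lam k ^ 2 * u0 k ^ 2) := by
  obtain ⟨C, hC0, hC⟩ := exists_coeff_bound (lam := lam) (σ := σ) (δ := δ) (u0 := u0) (u1 := u1)
    hmc hR T
  obtain ⟨K, hK0, hK⟩ := exists_single_mode_bound hσ hδ C T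
  refine ⟨K, hK0, fun n x v q h k t ht htn => ?_⟩
  have hsub : Icc 0 t ⊆ Icc (0:ℝ) n := Icc_subset_Icc_right htn
  refine (hK (lam k) t (x k) (v k) (fun s => q (∑' j, lam j ^ 2 * x j s ^ 2) ^ 2) (hlam k) ht.2
    (fun s hs => ⟨sq_nonneg _, hC n x v q h s ⟨hs.1, hs.2.trans ht.2⟩ (hs.2.trans htn)⟩)
    (fun s hs => (h.hasDeriv_x k s (hsub hs)).mono hsub)
    (fun s hs => (h.hasDeriv_v k s (hsub hs)).mono hsub) t ⟨ht.1, le_rfl⟩).trans ?_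
  obtain ⟨h1, h2⟩ := h.init_sq_le k
  gcongr

theorem continuousOn_tsum {n : ℕ} {x v : ℕ → ℝ → ℝ} {q : ℝ → ℝ}
    (h : IsGalerkin lam m σ δ u0 u1 R n x v q) :
    ContinuousOn (fun t => ∑' j, lam j ^ 2 * x j t ^ 2) (Icc 0 n) := by
  have he : (fun t => ∑' j, lam j ^ 2 * x j t ^ 2) =
      fun t => ∑ j ∈ Finset.range n, lam j ^ 2 * x j t ^ 2 := by
    ext t
    refine tsum_eq_sum fun k hk => ?_
    rw [h.x_eq_zero k (not_lt.1 (Finset.mem_range.not.1 hk))]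
    simp
  rw [he]
  exact continuousOn_finsetSum _ fun k _ =>
    continuousOn_const.mul (ContinuousOn.pow (fun t ht => (h.hasDeriv_x k t ht).continuousWithinAt) 2)

end IsGalerkin

namespace IsGalerkin

variable {lam : ℕ → ℝ} {m : ℝ → ℝ} {σ δ : ℝ} {u0 u1 : ℕ → ℝ} {R : ℝ → ℝ}

theorem exists_lipschitz_bound (hlam : ∀ k, 0 ≤ lam k) (hσ : 1 / 2 < σ) (hδ : 0 < δ)
    (hmc : ContinuousOn m (Ici 0)) (hR : Monotone R) (T : ℝ) :
    ∃ K, 0 ≤ K ∧ ∃ D : ℕ → ℝ, ∀ (n : ℕ) (x v : ℕ → ℝ → ℝ) (q : ℝ → ℝ),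
      IsGalerkin lam m σ δ u0 u1 R n x v q → ∀ k, ∀ t ∈ Icc 0 T, t ≤ n →
        v k t ^ 2 + lam k ^ 2 * x k t ^ 2 ≤ K * (u1 k ^ 2 + lam k ^ 2 * u0 k ^ 2) ∧
        x k t ^ 2 ≤ 2 * u0 k ^ 2 + 2 * T ^ 2 * (K * (u1 k ^ 2 + lam k ^ 2 * u0 k ^ 2)) ∧
        |x k t| ≤ D k ∧ |v k t| ≤ D k ∧
        |-(2 * δ * lam k ^ (2 * σ) * v k t) -
          q (∑' j, lam j ^ 2 * x j t ^ 2) ^ 2 * lam k ^ 2 * x k t| ≤ D k ∧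
        ∀ s ∈ Icc 0 T, s ≤ n →
          |x k s - x k t| ≤ D k * |s - t| ∧ |v k s - v k t| ≤ D k * |s - t| := by
  obtain ⟨K, hK0, hK⟩ := exists_mode_bound (u0 := u0) (u1 := u1) hlam hσ hδ hmc hR T
  obtain ⟨C, hC0, hC⟩ := exists_coeff_bound (lam := lam) (σ := σ) (δ := δ) (u0 := u0) (u1 := u1)
    hmc hR T
  set e : ℕ → ℝ := fun k => K * (u1 k ^ 2 + lam k ^ 2 * u0 k ^ 2) with he
  have he0 : ∀ k, 0 ≤ e k := fun k => by positivity
  set a : ℕ → ℝ := fun k => 2 * u0 k ^ 2 + 2 * T ^ 2 * e k with ha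
  have ha0 : ∀ k, 0 ≤ a k := fun k => by have := he0 k; positivity
  have hp : ∀ k, 0 ≤ lam k ^ (2 * σ) := fun k => Real.rpow_nonneg (hlam k) _
  have hw : ∀ k, 0 ≤ 2 * δ * lam k ^ (2 * σ) * √(e k) + C * lam k ^ 2 * √(a k) := fun k => by
    have := hp k; positivity
  refine ⟨K, hK0, fun k => √(a k) + √(e k) +
    (2 * δ * lam k ^ (2 * σ) * √(e k) + C * lam k ^ 2 * √(a k)), fun n x v q h k => ?_⟩
  have hv : ∀ t ∈ Icc 0 T, t ≤ n → |v k t| ≤ √(e k) := fun t ht htn => by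
    refine Real.abs_le_sqrt (le_trans ?_ (hK n x v q h k t ht htn))
    have : 0 ≤ lam k ^ 2 * x k t ^ 2 := by positivity
    linarith
  have hlip : ∀ (f f' : ℝ → ℝ) (L : ℝ),
      (∀ t ∈ Icc (0:ℝ) n, HasDerivWithinAt f (f' t) (Icc 0 n) t) →
      (∀ t ∈ Icc 0 T, t ≤ n → |f' t| ≤ L) →
      ∀ t ∈ Icc 0 T, t ≤ n → ∀ s ∈ Icc 0 T, s ≤ n → |f s - f t| ≤ L * |s - t| := by
    intro f f' L hf hL t ht htn s hs hsn
    refine (convex_Icc (0:ℝ) (min T n)).norm_image_sub_le_of_norm_hasDerivWithin_le (f' := f')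
      (fun r hr => (hf r ⟨hr.1, hr.2.trans (min_le_right _ _)⟩).mono
        (Icc_subset_Icc_right (min_le_right _ _)))
      (fun r hr => hL r ⟨hr.1, hr.2.trans (min_le_left _ _)⟩ (hr.2.trans (min_le_right _ _)))
      ⟨ht.1, le_min ht.2 htn⟩ ⟨hs.1, le_min hs.2 hsn⟩
  have hx2 : ∀ t ∈ Icc 0 T, t ≤ n → x k t ^ 2 ≤ a k := fun t ht htn => by
    have h1 := hlip _ _ _ (h.hasDeriv_x k) hv 0 ⟨le_rfl, ht.1.trans ht.2⟩ n.cast_nonneg t ht htn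
    have h2 : |x k t - x k 0| ≤ √(e k) * T := h1.trans (by
      rw [sub_zero, abs_of_nonneg ht.1]
      exact mul_le_mul_of_nonneg_left ht.2 (Real.sqrt_nonneg _))
    have h3 : (x k t - x k 0) ^ 2 ≤ e k * T ^ 2 := by
      rw [← sq_abs]
      calc |x k t - x k 0| ^ 2 ≤ (√(e k) * T) ^ 2 := by gcongr
        _ = e k * T ^ 2 := by rw [mul_pow, Real.sq_sqrt (he0 k)]
    have h4 := (h.init_sq_le k).1
    have h5 := sq_nonneg (x k t - x k 0 - x k 0)
    simp only [ha]
    nlinarith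
  have hx : ∀ t ∈ Icc 0 T, t ≤ n → |x k t| ≤ √(a k) := fun t ht htn =>
    Real.abs_le_sqrt (hx2 t ht htn)
  have hacc : ∀ t ∈ Icc 0 T, t ≤ n → |-(2 * δ * lam k ^ (2 * σ) * v k t) -
      q (∑' j, lam j ^ 2 * x j t ^ 2) ^ 2 * lam k ^ 2 * x k t| ≤
      2 * δ * lam k ^ (2 * σ) * √(e k) + C * lam k ^ 2 * √(a k) := fun t ht htn => by
    refine (abs_sub _ _).trans (add_le_add ?_ ?_)
    · rw [abs_neg, abs_mul, abs_of_nonneg (by have := hp k; positivity)]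
      exact mul_le_mul_of_nonneg_left (hv t ht htn) (by have := hp k; positivity)
    · rw [abs_mul, abs_of_nonneg (by positivity)]
      have := hC n x v q h t ht htn
      have := hx t ht htn
      gcongr
  have hse := Real.sqrt_nonneg (e k)
  have hsa := Real.sqrt_nonneg (a k)
  have hwk := hw k
  intro t ht htn
  refine ⟨hK n x v q h k t ht htn, hx2 t ht htn, ?_, ?_, ?_, fun s hs hsn => ⟨?_, ?_⟩⟩
  · linarith [hx t ht htn]
  · linarith [hv t ht htn]
  · linarith [hacc t ht htn]
  · refine (hlip _ _ _ (h.hasDeriv_x k) hv t ht htn s hs hsn).trans ?_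
    exact mul_le_mul_of_nonneg_right (by linarith) (abs_nonneg _)
  · refine (hlip _ _ _ (h.hasDeriv_v k) hacc t ht htn s hs hsn).trans ?_
    exact mul_le_mul_of_nonneg_right (by linarith) (abs_nonneg _)

end IsGalerkin

theorem exists_kirchhoff_system {lam : ℕ → ℝ} (hlam : ∀ k, 0 ≤ lam k) {m : ℝ → ℝ}
    (hmc : ContinuousOn m (Ici 0)) (hm0 : ∀ s, 0 ≤ s → 0 ≤ m s) {σ δ : ℝ}
    (hσ : 1 / 2 < σ) (hδ : 0 < δ) {u0 u1 : ℕ → ℝ} (h0 : Summable fun k => u0 k ^ 2)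
    (h0' : Summable fun k => lam k ^ 2 * u0 k ^ 2) (h1 : Summable fun k => u1 k ^ 2) :
    ∃ (U V : ℕ → ℝ → ℝ) (K : ℝ → ℝ), (∀ T, 0 ≤ K T) ∧ (∀ k, U k 0 = u0 k) ∧ (∀ k, V k 0 = u1 k) ∧
      (∀ k, ∀ t ∈ Ici (0:ℝ), HasDerivWithinAt (U k) (V k t) (Ici 0) t) ∧
      (∀ k, ∀ t ∈ Ici (0:ℝ), HasDerivWithinAt (V k) (-(2 * δ * lam k ^ (2 * σ) * V k t) -
        m (∑' j, lam j ^ 2 * U j t ^ 2) * lam k ^ 2 * U k t) (Ici 0) t) ∧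
      ContinuousOn (fun t => ∑' j, lam j ^ 2 * U j t ^ 2) (Ici 0) ∧
      ∀ T, ∀ t ∈ Icc 0 T, ∀ k,
        V k t ^ 2 + lam k ^ 2 * U k t ^ 2 ≤ K T * (u1 k ^ 2 + lam k ^ 2 * u0 k ^ 2) ∧
        U k t ^ 2 ≤ 2 * u0 k ^ 2 + 2 * T ^ 2 * (K T * (u1 k ^ 2 + lam k ^ 2 * u0 k ^ 2)) := by
  obtain ⟨R, hR, hex⟩ := exists_isGalerkin hlam hmc hσ hδ h0 h0' h1
  choose x v q hG using hex
  choose K hK0 D hD using fun T =>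
    IsGalerkin.exists_lipschitz_bound (u0 := u0) (u1 := u1) hlam hσ hδ hmc hR T
  have he : Summable fun k => u1 k ^ 2 + lam k ^ 2 * u0 k ^ 2 := h1.add h0'
  obtain ⟨φ, g, hφ, hg, hgc⟩ := exists_subseq_tendsto_of_lipschitz (ι := ℕ × Bool)
    (f := fun n i => bif i.2 then x n i.1 else v n i.1) (B := fun i T => D T i.1)
    (fun n i T t ht htn => by
      obtain ⟨_, _, hx, hv, -⟩ := hD T n _ _ _ (hG n) i.1 t ht htn
      rcases i with ⟨k, _ | _⟩
      · exact hv
      · exact hx)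
    (fun n i T s hs t ht hsn htn => by
      obtain ⟨_, _, _, _, _, hl⟩ := hD T n _ _ _ (hG n) i.1 t ht htn
      rcases i with ⟨k, _ | _⟩
      · exact (hl s hs hsn).2
      · exact (hl s hs hsn).1)
  let U : ℕ → ℝ → ℝ := fun k => g (k, true)
  let V : ℕ → ℝ → ℝ := fun k => g (k, false)
  have hU : ∀ k, ∀ t ∈ Ici (0:ℝ), Tendsto (fun n => x (φ n) k t) atTop (𝓝 (U k t)) :=
    fun k => hg (k, true)
  have hV : ∀ k, ∀ t ∈ Ici (0:ℝ), Tendsto (fun n => v (φ n) k t) atTop (𝓝 (V k t)) :=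
    fun k => hg (k, false)
  have hUc : ∀ k, ContinuousOn (U k) (Ici 0) := fun k => hgc (k, true)
  have hVc : ∀ k, ContinuousOn (V k) (Ici 0) := fun k => hgc (k, false)
  have hτ : Tendsto (fun n => (φ n : ℝ)) atTop atTop :=
    tendsto_natCast_atTop_atTop.comp hφ.tendsto_atTop
  have hbd : ∀ T, ∀ t ∈ Icc 0 T, ∀ k,
      V k t ^ 2 + lam k ^ 2 * U k t ^ 2 ≤ K T * (u1 k ^ 2 + lam k ^ 2 * u0 k ^ 2) ∧
      U k t ^ 2 ≤ 2 * u0 k ^ 2 + 2 * T ^ 2 * (K T * (u1 k ^ 2 + lam k ^ 2 * u0 k ^ 2)) := by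
    intro T t ht k
    have hev : ∀ᶠ n in atTop, t ≤ (φ n : ℝ) := hτ.eventually_ge_atTop t
    refine ⟨le_of_tendsto (((hV k t ht.1).pow 2).add (((hU k t ht.1).pow 2).const_mul _))
      (hev.mono fun n hn => (hD T _ _ _ _ (hG (φ n)) k t ht hn).1),
      le_of_tendsto ((hU k t ht.1).pow 2)
      (hev.mono fun n hn => (hD T _ _ _ _ (hG (φ n)) k t ht hn).2.1)⟩
  have hSc : ContinuousOn (fun t => ∑' j, lam j ^ 2 * U j t ^ 2) (Ici 0) := by
    refine tendsto_tsum_nhdsWithin_of_dominated (b := fun T k => K T * (u1 k ^ 2 + lam k ^ 2 * u0 k ^ 2))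
      (fun T => he.mul_left _) (fun T t ht k => ?_)
      (fun k => continuousOn_const.mul ((hUc k).pow 2))
    rw [abs_of_nonneg (by positivity)]
    linarith [(hbd T t ht k).1, sq_nonneg (V k t)]
  have hS : ∀ t ∈ Ici (0:ℝ), Tendsto (fun n => ∑' j, lam j ^ 2 * x (φ n) j t ^ 2) atTop
      (𝓝 (∑' j, lam j ^ 2 * U j t ^ 2)) := by
    intro t ht
    refine tendsto_tsum_of_dominated_convergence
      (he.mul_left (K t)) (fun k => ((hU k t ht).pow 2).const_mul _) ?_
    filter_upwards [hτ.eventually_ge_atTop t] with n hn k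
    rw [Real.norm_eq_abs, abs_of_nonneg (by positivity)]
    linarith [(hD t _ _ _ _ (hG (φ n)) k t ⟨ht, le_rfl⟩ hn).1, sq_nonneg (v (φ n) k t)]
  have hq : ∀ t ∈ Ici (0:ℝ), Tendsto (fun n => q (φ n) (∑' j, lam j ^ 2 * x (φ n) j t ^ 2) ^ 2)
      atTop (𝓝 (m (∑' j, lam j ^ 2 * U j t ^ 2))) := by
    intro t ht
    have hSn : (∑' j, lam j ^ 2 * U j t ^ 2) ∈ Ici (0:ℝ) := IsGalerkin.tsum_nonneg U lam t
    have h2 : Tendsto (fun n => √(m (∑' j, lam j ^ 2 * x (φ n) j t ^ 2))) atTop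
        (𝓝 √(m (∑' j, lam j ^ 2 * U j t ^ 2))) :=
      (hmc.sqrt _ hSn).tendsto.comp (tendsto_nhdsWithin_iff.2
        ⟨hS t ht, Eventually.of_forall fun n => IsGalerkin.tsum_nonneg _ lam t⟩)
    have h3 : Tendsto (fun n => q (φ n) (∑' j, lam j ^ 2 * x (φ n) j t ^ 2) -
        √(m (∑' j, lam j ^ 2 * x (φ n) j t ^ 2))) atTop (𝓝 0) := by
      refine squeeze_zero_norm' ?_
        ((tendsto_one_div_add_atTop_nhds_zero_nat (𝕜 := ℝ)).comp hφ.tendsto_atTop)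
      filter_upwards [hτ.eventually_ge_atTop t] with n hn
      exact (hG (φ n)).near _ ⟨IsGalerkin.tsum_nonneg _ lam t,
        ((hG (φ n)).tsum_le t ⟨ht, hn⟩).trans (hR hn)⟩
    have h4 := (h3.add h2).pow 2
    simpa only [sub_add_cancel, zero_add, Real.sq_sqrt (hm0 _ hSn)] using h4
  have hxc : ∀ n k, ContinuousOn (x n k) (Icc 0 (n:ℝ)) := fun n k t ht =>
    ((hG n).hasDeriv_x k t ht).continuousWithinAt
  have hvc : ∀ n k, ContinuousOn (v n k) (Icc 0 (n:ℝ)) := fun n k t ht =>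
    ((hG n).hasDeriv_v k t ht).continuousWithinAt
  refine ⟨U, V, K, hK0, fun k => ?_, fun k => ?_, fun k t ht => ?_, fun k t ht => ?_, hSc, hbd⟩
  · refine tendsto_nhds_unique (hU k 0 self_mem_Ici) (tendsto_const_nhds.congr' ?_)
    filter_upwards [hφ.tendsto_atTop.eventually_gt_atTop k] with n hn
    exact ((hG _).x_init k hn).symm
  · refine tendsto_nhds_unique (hV k 0 self_mem_Ici) (tendsto_const_nhds.congr' ?_)
    filter_upwards [hφ.tendsto_atTop.eventually_gt_atTop k] with n hn
    exact ((hG _).v_init k hn).symm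
  · exact hasDerivWithinAt_Ici_of_tendsto hτ (fun n => (hG (φ n)).hasDeriv_x k)
      (fun n => hvc _ k)
      (fun T => ⟨D T k, fun n t ht htn => (hD T _ _ _ _ (hG (φ n)) k t ht htn).2.2.2.1⟩)
      (hU k) (hV k) (hVc k) ht
  · refine hasDerivWithinAt_Ici_of_tendsto
      (G := fun t => -(2 * δ * lam k ^ (2 * σ) * V k t) -
        m (∑' j, lam j ^ 2 * U j t ^ 2) * lam k ^ 2 * U k t)
      hτ (fun n => (hG (φ n)).hasDeriv_v k) (fun n => ?_)
      (fun T => ⟨D T k, fun n t ht htn => (hD T _ _ _ _ (hG (φ n)) k t ht htn).2.2.2.2.1⟩)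
      (hV k) (fun t ht => ?_) ?_ ht
    · exact (continuousOn_const.mul (hvc _ k)).neg.sub
        (((((hG (φ n)).continuous_q.comp_continuousOn (hG (φ n)).continuousOn_tsum).pow 2).mul
          continuousOn_const).mul (hxc _ k))
    · exact ((hV k t ht).const_mul _).neg.sub (((hq t ht).mul_const _).mul (hU k t ht))
    · exact (continuousOn_const.mul (hVc k)).neg.sub
        (((hmc.comp hSc fun t _ => IsGalerkin.tsum_nonneg U lam t).mul
          continuousOn_const).mul (hUc k))

theorem L2Cont.congr {I : Set ℝ} {v w : ℝ → ℕ → ℝ} (h : L2Cont I v)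
    (hvw : ∀ t ∈ I, ∀ k, w t k = v t k) : L2Cont I w := by
  refine ⟨fun t ht => ?_, fun t ht ε hε => ?_⟩
  · simpa only [hvw t ht] using h.1 t ht
  · obtain ⟨η, hη, hs⟩ := h.2 t ht ε hε
    exact ⟨η, hη, fun s hsI hst => by simpa only [hvw t ht, hvw s hsI] using hs s hsI hst⟩

/-- Supercritical dissipation: global existence in the interpolation space `V_{ωd}`
for the Kirchhoff equation with strong damping `A^σ u'`, `σ > 1/2`. -/
theorem global_existence_supercritical_interpolation
    (lam : ℕ → ℝ) (hlam : ∀ k, 0 ≤ lam k)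
    (m : ℝ → ℝ) (hmc : ContinuousOn m (Ici 0)) (hm0 : ∀ x : ℝ, 0 ≤ x → 0 ≤ m x)
    (σ δ : ℝ) (hσ : 1 / 2 < σ) (hδ : 0 < δ)
    (ωd : ℝ → ℝ) (hωd : IsModulus ωd)
    (u0 u1 : ℕ → ℝ) (hV : MemV lam ωd u0 u1) :
    ∃ u : ℕ → ℝ → ℝ,
      IsKirchhoffSol lam m σ δ (Ici 0) u0 u1 u ∧
      VRegCurves lam ωd (Ici 0) u := by
  obtain ⟨h0, h0', h1, hVs⟩ := hV
  obtain ⟨U, V, K, hK0, hU0, hV0, hU, hV, hSc, hbd⟩ :=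
    exists_kirchhoff_system hlam hmc hm0 hσ hδ h0 h0' h1
  have he : Summable fun k => u1 k ^ 2 + lam k ^ 2 * u0 k ^ 2 := h1.add h0'
  have hud : UniqueDiffOn ℝ (Ici (0:ℝ)) := uniqueDiffOn_Ici 0
  have hdU : ∀ k, ∀ t ∈ Ici (0:ℝ), derivWithin (U k) (Ici 0) t = V k t := fun k t ht =>
    (hU k t ht).derivWithin (hud t ht)
  have hdV : ∀ k, ∀ t ∈ Ici (0:ℝ), derivWithin (V k) (Ici 0) t =
      -(2 * δ * lam k ^ (2 * σ) * V k t) -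
        m (∑' j, lam j ^ 2 * U j t ^ 2) * lam k ^ 2 * U k t := fun k t ht =>
    (hV k t ht).derivWithin (hud t ht)
  have hddU : ∀ k, ∀ t ∈ Ici (0:ℝ), derivWithin (derivWithin (U k) (Ici 0)) (Ici 0) t =
      derivWithin (V k) (Ici 0) t := fun k t ht =>
    derivWithin_congr (hdU k) (hdU k t ht)
  have hUc : ∀ k, ContinuousOn (U k) (Ici 0) := fun k t ht => (hU k t ht).continuousWithinAt
  have hVc : ∀ k, ContinuousOn (V k) (Ici 0) := fun k t ht => (hV k t ht).continuousWithinAt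
  have hω : ∀ k, 0 < lam k → 0 < ωd (1 / lam k) := fun k hk => hωd.2.2.1 _ (one_div_pos.2 hk)
  have hL : L2Cont (Ici 0) fun t k => lam k * U k t := by
    refine l2Cont_of_dominated (fun T => he.mul_left (K T)) (fun T t ht k => ?_)
      fun k => continuousOn_const.mul (hUc k)
    rw [mul_pow]
    linarith [(hbd T t ht k).1, sq_nonneg (V k t)]
  have hLV : L2Cont (Ici 0) fun t k => V k t := by
    refine l2Cont_of_dominated (fun T => he.mul_left (K T)) (fun T t ht k => ?_) hVc
    have : 0 ≤ lam k ^ 2 * U k t ^ 2 := by positivity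
    linarith [(hbd T t ht k).1]
  have hLU : L2Cont (Ici 0) fun t k => U k t :=
    l2Cont_of_dominated
      (fun T => (h0.mul_left 2).add ((he.mul_left (K T)).mul_left (2 * T ^ 2)))
      (fun T t ht k => (hbd T t ht k).2) hUc
  have hVb : ∀ T, ∀ t ∈ Icc 0 T, ∀ k, 0 < lam k →
      (V k t ^ 2 + lam k ^ 2 * U k t ^ 2) / ωd (1 / lam k) ≤ K T * Vsum lam ωd u0 u1 k := by
    intro T t ht k hk
    have := hω k hk
    rw [Vsum, if_pos hk, ← mul_div_assoc]
    gcongr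
    exact (hbd T t ht k).1
  refine ⟨U, ⟨fun k => ?_, hU0, fun k => ?_, fun k t ht => ?_, hLU, hL, ?_⟩, fun t ht => ?_, ?_, ?_⟩
  · have hV1 : ContDiffOn ℝ 1 (V k) (Ici 0) := by
      refine (contDiffOn_one_iff_derivWithin hud).2
        ⟨fun t ht => (hV k t ht).differentiableWithinAt, ContinuousOn.congr ?_ (hdV k)⟩
      exact (continuousOn_const.mul (hVc k)).neg.sub
        (((hmc.comp hSc fun t _ => IsGalerkin.tsum_nonneg U lam t).mul
          continuousOn_const).mul (hUc k))
    rw [← one_add_one_eq_two, contDiffOn_succ_iff_derivWithin hud]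
    exact ⟨fun t ht => (hU k t ht).differentiableWithinAt, by simp, hV1.congr (hdU k)⟩
  · rw [hdU k 0 self_mem_Ici, hV0]
  · rw [hddU k t ht, hdV k t ht, hdU k t ht]
    ring
  · exact hLV.congr fun t ht k => hdU k t ht
  · refine Summable.of_nonneg_of_le (fun k => ?_) (fun k => ?_) (hVs.mul_left (K t))
    · unfold Vsum
      split_ifs with hk
      · have := hω k hk
        positivity
      · exact le_rfl
    · by_cases hk : 0 < lam k
      · rw [Vsum, if_pos hk, hdU k t ht]
        exact hVb t t ⟨ht, le_rfl⟩ k hk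
      · simp [Vsum, hk]
  · refine l2Cont_of_dominated (fun T => hVs.mul_left (K T)) (fun T t ht k => ?_) fun k => ?_
    · by_cases hk : 0 < lam k
      · have h2 := hω k hk
        rw [if_pos hk, div_pow, Real.sq_sqrt h2.le, mul_pow]
        refine le_trans ?_ (hVb T t ht k hk)
        gcongr
        linarith [sq_nonneg (V k t)]
      · simp [Vsum, hk]
    · split_ifs
      · exact (continuousOn_const.mul (hUc k)).div_const _
      · exact continuousOn_const
  · refine (l2Cont_of_dominated (w := fun t k => if 0 < lam k then V k t / √(ωd (1 / lam k)) else 0)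
      (fun T => hVs.mul_left (K T)) (fun T t ht k => ?_) fun k => ?_).congr fun t ht k => by
        rw [hdU k t ht]
    · by_cases hk : 0 < lam k
      · have h2 := hω k hk
        rw [if_pos hk, div_pow, Real.sq_sqrt h2.le]
        refine le_trans ?_ (hVb T t ht k hk)
        gcongr
        have : 0 ≤ lam k ^ 2 * U k t ^ 2 := by positivity
        linarith
      · simp [Vsum, hk]
    · split_ifs
      · exact (hVc k).div_const _
      · exact continuousOn_const
end
end
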